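/- Any finite planar simple graph G = (V, E) has a proper 5-coloring such that one color class contains at most |V|/6 vertices; that is, V can be partitioned into five independent sets V1, V2, V3, V4, V5 (possibly empty) with |V5| ≤ |V|/6. -/

import Mathlib

open SimpleGraph

variable {V : Type}

/-- The involution of the darts of a graph reversing each dart. -/
def dartRev (G : SimpleGraph V) : Equiv.Perm G.Dart :=
  Function.Involutive.toPerm SimpleGraph.Dart.symm SimpleGraph.Dart.symm_involutive

/-- The face permutation of a rotation system `σ`: it sends a dart `(u,v)` to `σ (v,u)`. -/
def facePerm {G : SimpleGraph V} (σ : Equiv.Perm G.Dart) : Equiv.Perm G.Dart :=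
  (dartRev G).trans σ

/-- The setoid on `α` whose classes are the orbits (cycles) of a permutation of `α`. -/
def orbitSetoid {α : Type*} (f : Equiv.Perm α) : Setoid α :=
  ⟨f.SameCycle, ⟨fun x => Equiv.Perm.SameCycle.refl f x, fun h => h.symm, fun h h' => h.trans h'⟩⟩

/-- The number of faces of a rotation system: the number of orbits of the face permutation. -/
noncomputable def numFaces {G : SimpleGraph V} (σ : Equiv.Perm G.Dart) : ℕ :=
  Nat.card (Quotient (orbitSetoid (facePerm σ)))

/-- The number of darts in the face (orbit of the face permutation) containing the dart `d`. -/
noncomputable def faceSize {G : SimpleGraph V} (σ : Equiv.Perm G.Dart) (d : G.Dart) : ℕ :=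
  Nat.card {e : G.Dart // (facePerm σ).SameCycle d e}

/-- `σ` is a rotation system on `G`: every dart and its image share their first vertex, and
the `σ`-orbit of every dart consists of all darts sharing its first vertex. -/
structure IsRotationSystem (G : SimpleGraph V) (σ : Equiv.Perm G.Dart) : Prop where
  fst_eq : ∀ d : G.Dart, (σ d).toProd.1 = d.toProd.1
  orbit_eq : ∀ d e : G.Dart, d.toProd.1 = e.toProd.1 → σ.SameCycle d e

/-- The degree of a vertex. -/
noncomputable def deg (G : SimpleGraph V) (v : V) : ℕ := Nat.card (G.neighborSet v)

/-- A plane triangulation: a finite connected simple graph on at least 4 vertices equipped with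
a rotation system satisfying Euler's formula `|V| - |E| + F = 2` in which every face consists of
exactly 3 darts. -/
structure IsPlaneTriangulation [Fintype V] (G : SimpleGraph V) (σ : Equiv.Perm G.Dart) :
    Prop where
  connected : G.Connected
  four_le_card : 4 ≤ Fintype.card V
  rot : IsRotationSystem G σ
  euler : Fintype.card V + numFaces σ = Nat.card G.edgeSet + 2
  face_size_eq : ∀ d : G.Dart, faceSize σ d = 3

/-- A proper 5-coloring (colors `0,...,4` standing for `1,...,5`). -/
def Proper5 (G : SimpleGraph V) (c : V → Fin 5) : Prop :=
  ∀ ⦃u w : V⦄, G.Adj u w → c u ≠ c w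

/-- A finite simple graph is planar if it is isomorphic to a subgraph of a plane triangulation. -/
def IsPlanar [Fintype V] (G : SimpleGraph V) : Prop :=
  ∃ (W : Type) (iW : Fintype W) (T : SimpleGraph W) (σ : Equiv.Perm T.Dart),
    @IsPlaneTriangulation W iW T σ ∧ ∃ f : G →g T, Function.Injective f

/-- `w` is the neighbor of `v` following `u` in the cyclic (counterclockwise) order
around `v` given by the rotation system `σ`. -/
def NextNbr {G : SimpleGraph V} (σ : Equiv.Perm G.Dart) (v u w : V) : Prop :=
  ∃ h : G.Adj v u, (σ ⟨(v, u), h⟩).toProd.2 = w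

/-- A minimal counterexample: a plane triangulation admitting no proper 5-coloring with some
color class of size at most `|V|/6`, while every planar graph on fewer vertices admits one. -/
def IsMinimalCounterexample [Fintype V] (G : SimpleGraph V) (σ : Equiv.Perm G.Dart) : Prop :=
  IsPlaneTriangulation G σ ∧
  (¬ ∃ c : V → Fin 5, Proper5 G c ∧
      ∃ k : Fin 5, 6 * Nat.card {v : V | c v = k} ≤ Fintype.card V) ∧
  (∀ (W : Type) [Fintype W] (H : SimpleGraph W), IsPlanar H →
      Fintype.card W < Fintype.card V →
      ∃ c : W → Fin 5, Proper5 H c ∧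
        ∃ k : Fin 5, 6 * Nat.card {w : W | c w = k} ≤ Fintype.card W)


namespace FC
open Finset Function
open scoped Classical

/-- A triangulation of the sphere, given by the "next neighbour" function. -/
structure Tri (V : Type) [Fintype V] where
  adj : V → V → Prop
  symm : ∀ {a b}, adj a b → adj b a
  irrefl : ∀ a, ¬ adj a a
  nx : V → V → V
  nx_adj : ∀ {v u}, adj v u → adj v (nx v u)
  face : ∀ {v u}, adj v u → nx (nx v u) v = u
  trans : ∀ (v u : V) (p : V → Prop), adj v u → p u →
    (∀ x, adj v x → p x → p (nx v x)) → ∀ x, adj v x → p x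
  conn : ∀ (p : V → Prop) (a : V), p a → (∀ x y, adj x y → p x → p y) → ∀ b, p b
  euler : ∑ v, (univ.filter (adj v)).card + 12 = 6 * Fintype.card V

namespace Tri
variable {V : Type} [Fintype V] (T : Tri V)

/-- neighbours -/
noncomputable def N (v : V) : Finset V := univ.filter (T.adj v)
/-- degree -/
noncomputable def d (v : V) : ℕ := (T.N v).card

variable {T}
@[simp] lemma mem_N {v u : V} : u ∈ T.N v ↔ T.adj v u := by simp [N]

lemma ne {a b : V} (h : T.adj a b) : a ≠ b := fun e => T.irrefl b (e ▸ h)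

lemma nx1 {v u : V} (h : T.adj v u) : T.nx (T.nx v u) v = u := T.face h
lemma adj_nx {v u : V} (h : T.adj v u) : T.adj u (T.nx v u) := by
  have := T.nx_adj (T.symm (T.nx_adj h))
  rw [T.face h] at this
  exact T.symm this
lemma nx2 {v u : V} (h : T.adj v u) : T.nx u (T.nx v u) = v := by
  have := T.face (T.symm (T.nx_adj h))
  rwa [T.face h] at this
/-- `T.nx u v` is the neighbour preceding `u` around `v`. -/
lemma nx_pv {v u : V} (h : T.adj v u) : T.nx v (T.nx u v) = u := nx2 (T.symm h)
lemma adj_pv {v u : V} (h : T.adj v u) : T.adj v (T.nx u v) := adj_nx (T.symm h)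
lemma nx_inj {v a b : V} (ha : T.adj v a) (hb : T.adj v b) (h : T.nx v a = T.nx v b) : a = b := by
  rw [← nx1 ha, h, nx1 hb]
lemma nx_ne {v u : V} (h : T.adj v u) : T.nx v u ≠ u := (ne (adj_nx h)).symm

/-- ring around v -/
noncomputable def r (T : Tri V) (v u : V) (k : ℕ) : V := (T.nx v)^[k] u

@[simp] lemma r_zero (v u : V) : T.r v u 0 = u := rfl
lemma r_succ (v u : V) (k : ℕ) : T.r v u (k+1) = T.nx v (T.r v u k) := by
  simp [r, Function.iterate_succ_apply']
lemma r_adj {v u : V} (h : T.adj v u) (k : ℕ) : T.adj v (T.r v u k) := by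
  induction k with
  | zero => exact h
  | succ k ih => rw [r_succ]; exact T.nx_adj ih
lemma r_surj {v u w : V} (h : T.adj v u) (hw : T.adj v w) : ∃ k, T.r v u k = w :=
  T.trans v u (fun w => ∃ k, T.r v u k = w) h ⟨0, rfl⟩
    (fun x _ ⟨k, hk⟩ => ⟨k+1, by rw [r_succ, hk]⟩) w hw

lemma r_cancel {v u : V} (h : T.adj v u) {i j : ℕ} (k : ℕ)
    (e : T.r v u (i + k) = T.r v u (j + k)) : T.r v u i = T.r v u j := by
  induction k with
  | zero => exact e
  | succ k ih =>
    apply ih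
    rw [← Nat.add_assoc, ← Nat.add_assoc, r_succ, r_succ] at e
    exact nx_inj (r_adj h _) (r_adj h _) e

lemma r_periodicPt {v u : V} (h : T.adj v u) : 0 < minimalPeriod (T.nx v) u := by
  have : ¬ Injective (fun k : ℕ => T.r v u k) := not_injective_infinite_finite _
  simp only [Injective, not_forall] at this
  obtain ⟨i, j, e, hne⟩ := this
  wlog hij : i < j generalizing i j
  · exact this j i e.symm (Ne.symm hne) (by omega)
  have h0 : T.r v u (0 + i) = T.r v u ((j - i) + i) := by
    simpa [Nat.sub_add_cancel hij.le] using e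
  have := r_cancel h i h0
  apply IsPeriodicPt.minimalPeriod_pos (n := j - i) (by omega)
  exact this.symm

lemma r_mod {v u : V} (k : ℕ) : T.r v u (k % minimalPeriod (T.nx v) u) = T.r v u k :=
  iterate_mod_minimalPeriod_eq

lemma minPer {v u : V} (h : T.adj v u) : minimalPeriod (T.nx v) u = T.d v := by
  have : T.N v = (range (minimalPeriod (T.nx v) u)).image (T.r v u) := by
    ext w
    simp only [mem_N, mem_image, mem_range]
    constructor
    · intro hw
      obtain ⟨k, rfl⟩ := r_surj h hw
      exact ⟨k % minimalPeriod (T.nx v) u, Nat.mod_lt _ (r_periodicPt h), r_mod k⟩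
    · rintro ⟨k, _, rfl⟩; exact r_adj h k
  rw [d, this, card_image_of_injOn, card_range]
  intro i hi j hj e
  simp only [coe_range, Set.mem_Iio] at hi hj
  exact iterate_injOn_Iio_minimalPeriod hi hj e

lemma d_pos {v u : V} (h : T.adj v u) : 0 < T.d v := by rw [← minPer h]; exact r_periodicPt h
lemma r_d {v u : V} (h : T.adj v u) : T.r v u (T.d v) = u := by
  rw [← minPer h]; exact iterate_minimalPeriod
lemma r_inj {v u : V} (h : T.adj v u) {i j : ℕ} (hi : i < T.d v) (hj : j < T.d v)
    (e : T.r v u i = T.r v u j) : i = j := by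
  rw [← minPer h] at hi hj
  exact iterate_injOn_Iio_minimalPeriod hi hj e
lemma r_lt {v u w : V} (h : T.adj v u) (hw : T.adj v w) : ∃ k < T.d v, T.r v u k = w := by
  obtain ⟨k, rfl⟩ := r_surj h hw
  exact ⟨k % T.d v, Nat.mod_lt _ (d_pos h), by rw [← minPer h]; exact r_mod k⟩
lemma r_modd {v u : V} (h : T.adj v u) (k : ℕ) : T.r v u (k % T.d v) = T.r v u k := by
  rw [← minPer h]; exact r_mod k
lemma r_add (v u : V) (i j : ℕ) : T.r v u (i + j) = T.r v (T.r v u i) j := by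
  simp only [r]; rw [Nat.add_comm, iterate_add_apply]
lemma r_adj_succ {v u : V} (h : T.adj v u) (k : ℕ) : T.adj (T.r v u k) (T.r v u (k+1)) := by
  rw [r_succ]; exact adj_nx (r_adj h k)
lemma N_eq {v u : V} (h : T.adj v u) : T.N v = (range (T.d v)).image (T.r v u) := by
  ext w
  simp only [mem_N, mem_image, mem_range]
  constructor
  · intro hw; exact r_lt h hw
  · rintro ⟨k, _, rfl⟩; exact r_adj h k
lemma r_inj' {v u : V} (h : T.adj v u) {i j : ℕ} 
    (e : T.r v u i = T.r v u j) : i % T.d v = j % T.d v := by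
  apply r_inj h (Nat.mod_lt _ (d_pos h)) (Nat.mod_lt _ (d_pos h))
  rw [r_modd h, r_modd h, e]
end Tri
end FC


namespace FC
open Finset Function
open scoped Classical
namespace Tri
variable {V : Type} [Fintype V]

/-- darts -/
abbrev Dt (T : Tri V) := {p : V × V // T.adj p.1 p.2}
/-- face map -/
def fp (T : Tri V) (e : T.Dt) : T.Dt := ⟨(e.1.2, T.nx e.1.2 e.1.1), T.nx_adj (T.symm e.2)⟩
/-- reversal -/
def rv (T : Tri V) (e : T.Dt) : T.Dt := ⟨(e.1.2, e.1.1), T.symm e.2⟩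

variable {T : Tri V}
lemma rv_rv (e : T.Dt) : T.rv (T.rv e) = e := rfl
lemma rv_ne (e : T.Dt) : T.rv e ≠ e := by
  intro h
  have := congrArg (fun x : T.Dt => x.1.1) h
  exact ne e.2 this.symm
lemma fp3 (e : T.Dt) : T.fp (T.fp (T.fp e)) = e := by
  obtain ⟨⟨u, v⟩, h⟩ := e
  have h' := T.symm h
  simp only [fp, Subtype.mk.injEq, Prod.mk.injEq]
  constructor
  · exact T.face h'
  · rw [T.face h']; exact nx2 h'

lemma card_Dt : Fintype.card T.Dt = ∑ v, T.d v := by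
  rw [Fintype.card_subtype, ← Finset.univ_product_univ, card_eq_sum_card_fiberwise (f := Prod.fst) (t := univ)]
  · apply sum_congr rfl
    intro v _
    rw [d]
    refine card_bij' (fun p _ => p.2) (fun u _ => (v, u)) ?_ ?_ ?_ ?_
    · rintro ⟨a, b⟩ h; simp at h ⊢; rw [← h.2]; exact h.1
    · intro u h; simpa using h
    · rintro ⟨a, b⟩ h; simp at h ⊢; rw [← h.2]
    · intro u h; rfl
  · intro; simp

abbrev K2 := ZMod 2

/-- face-invariant functions -/
def Phi (T : Tri V) : Submodule K2 (T.Dt → K2) where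
  carrier := {f | ∀ e, f (T.fp e) = f e}
  add_mem' := by intro a b ha hb e; simp [ha e, hb e]
  zero_mem' := by intro e; rfl
  smul_mem' := by intro c f hf e; simp [hf e]

/-- symmetric functions -/
def Sy (T : Tri V) : Submodule K2 (T.Dt → K2) where
  carrier := {f | ∀ e, f (T.rv e) = f e}
  add_mem' := by intro a b ha hb e; simp [ha e, hb e]
  zero_mem' := by intro e; rfl
  smul_mem' := by intro c f hf e; simp [hf e]

/-- boundary -/
noncomputable def bd (T : Tri V) : (T.Dt → K2) →ₗ[K2] (V → K2) where
  toFun f v := ∑ e ∈ univ.filter (fun e : T.Dt => e.1.1 = v), f e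
  map_add' := by intro a b; ext v; simp [sum_add_distrib]
  map_smul' := by intro a b; ext v; simp [mul_sum]

/-- coboundary of a face function -/
def dl (T : Tri V) : (T.Dt → K2) →ₗ[K2] (T.Dt → K2) where
  toFun f e := f e + f (T.rv e)
  map_add' := by intro a b; ext v; simp; ring
  map_smul' := by intro a b; ext v; simp; ring

lemma finrank_Phi : Fintype.card T.Dt ≤ 3 * Module.finrank K2 T.Phi := by
  let h : T.Dt → Finset T.Dt := fun e => {e, T.fp e, T.fp (T.fp e)}
  have hfp : ∀ e, h (T.fp e) = h e := by
    intro e; simp only [h, fp3]; ext x; simp; tauto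
  let Q := Set.range h
  have h1 : Fintype.card Q ≤ Module.finrank K2 T.Phi := by
    let L : (Q → K2) →ₗ[K2] T.Phi :=
      { toFun := fun g => ⟨fun e => g ⟨h e, e, rfl⟩, by
          intro e; show g _ = g _; congr 2; exact hfp e⟩
        map_add' := by intro a b; rfl
        map_smul' := by intro a b; rfl }
    have hL : Injective L := by
      intro a b hab
      ext ⟨q, e, rfl⟩
      exact congrFun (congrArg Subtype.val hab) e
    have := LinearMap.finrank_le_finrank_of_injective hL
    rwa [Module.finrank_fintype_fun_eq_card] at this
  have h2 : Fintype.card T.Dt ≤ 3 * Fintype.card Q := by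
    let g : Q × Fin 3 → T.Dt := fun p => (T.fp)^[p.2] (p.1.2.choose)
    have hg : Surjective g := by
      intro e
      let q : Q := ⟨h e, e, rfl⟩
      have hq : h q.2.choose = h e := q.2.choose_spec
      have : e ∈ h q.2.choose := by rw [hq]; simp [h]
      simp only [h, mem_insert, mem_singleton] at this
      rcases this with h | h | h
      · exact ⟨(q, 0), h.symm⟩
      · exact ⟨(q, 1), h.symm⟩
      · exact ⟨(q, 2), h.symm⟩
    have := Fintype.card_le_of_surjective g hg
    rw [Fintype.card_prod, Fintype.card_fin] at this
    omega
  omega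

lemma finrank_Sy : 2 * Module.finrank K2 T.Sy ≤ Fintype.card T.Dt := by
  let h : T.Dt → Finset T.Dt := fun e => {e, T.rv e}
  let Q := Set.range h
  have h1 : Module.finrank K2 T.Sy ≤ Fintype.card Q := by
    let L : T.Sy →ₗ[K2] (Q → K2) :=
      { toFun := fun g q => g.1 q.2.choose
        map_add' := by intro a b; rfl
        map_smul' := by intro a b; rfl }
    have hL : Injective L := by
      intro a b hab
      ext e
      let q : Q := ⟨h e, e, rfl⟩
      have hq : h q.2.choose = h e := q.2.choose_spec
      have h3 : e ∈ h q.2.choose := by rw [hq]; simp [h]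
      have h4 : a.1 q.2.choose = b.1 q.2.choose := congrFun hab q
      simp only [h, mem_insert, mem_singleton] at h3
      rcases h3 with h3 | h3
      · rw [h3]; exact h4
      · rw [h3, a.2, b.2]; exact h4
    have := LinearMap.finrank_le_finrank_of_injective hL
    rwa [Module.finrank_fintype_fun_eq_card] at this
  have h2 : 2 * Fintype.card Q ≤ Fintype.card T.Dt := by
    let g : Q × Bool → T.Dt := fun p => if p.2 then p.1.2.choose else T.rv p.1.2.choose
    have hh : ∀ e, h (T.rv e) = h e := by
      intro e; simp only [h, rv_rv]; ext x; simp; tauto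
    have hg : Injective g := by
      rintro ⟨q, b⟩ ⟨q', b'⟩ e
      have e1 : h q.2.choose = q := q.2.choose_spec
      have e2 : h q'.2.choose = q' := q'.2.choose_spec
      have e3 : ∀ p, h (g p) = p.1 := by
        rintro ⟨p, _ | _⟩
        · simp only [g]; simp [hh]; exact p.2.choose_spec
        · simp only [g]; simp; exact p.2.choose_spec
      have e4 : q = q' := by
        apply Subtype.ext
        rw [← e3 (q, b), e, e3]
      subst e4
      congr 1
      cases b <;> cases b' <;> simp [g] at e ⊢
      · exact rv_ne _ e
      · exact rv_ne _ e.symm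
    have := Fintype.card_le_of_injective g hg
    rw [Fintype.card_prod, Fintype.card_bool] at this
    omega
  omega

lemma bd_apply (f : T.Dt → K2) (v : V) :
    T.bd f v = ∑ e ∈ univ.filter (fun e : T.Dt => e.1.1 = v), f e := rfl

lemma finrank_bd : Fintype.card V ≤ Module.finrank K2 (T.Sy.map T.bd) + 1 := by
  by_cases hV : Nonempty V
  swap
  · rw [not_nonempty_iff] at hV; simp
  obtain ⟨v0⟩ := hV
  let R := T.Sy.map T.bd
  let S := Submodule.span K2 {(Pi.single v0 1 : V → K2)}
  have top : R ⊔ S = ⊤ := by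
    rw [eq_top_iff]
    intro f _
    have key : ∀ v, (Pi.single v 1 : V → K2) ∈ R ⊔ S := by
      refine T.conn (fun v => (Pi.single v 1 : V → K2) ∈ R ⊔ S) v0 ?_ ?_
      · exact Submodule.mem_sup_right (Submodule.subset_span rfl)
      · intro x y hxy hx
        let e : T.Dt := ⟨(x, y), hxy⟩
        let z : T.Dt → K2 := Pi.single e 1 + Pi.single (T.rv e) 1
        have hz : z ∈ T.Sy := by
          intro a
          have h1 : (T.rv a = e) ↔ (a = T.rv e) :=
            ⟨fun h => by rw [← h, rv_rv], fun h => by rw [h, rv_rv]⟩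
          have h2 : (T.rv a = T.rv e) ↔ (a = e) :=
            ⟨fun h => by rw [← rv_rv a, h, rv_rv], fun h => by rw [h]⟩
          simp only [z, Pi.add_apply, Pi.single_apply, h1, h2]
          ring
        have hb : T.bd z = Pi.single x 1 + Pi.single y 1 := by
          ext v
          simp only [bd_apply, z, Pi.add_apply, sum_add_distrib, Pi.single_apply, sum_ite_eq', mem_filter, mem_univ, true_and]
          congr 1
          · simp [e, eq_comm]
          · simp [e, rv, eq_comm]; congr
        have : (Pi.single y 1 : V → K2) = T.bd z - Pi.single x 1 := by rw [hb]; ring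
        rw [this]
        exact Submodule.sub_mem _ (Submodule.mem_sup_left ⟨z, hz, rfl⟩) hx
    have : f = ∑ v, f v • (Pi.single v 1 : V → K2) := by
      ext w; simp [Pi.single_apply]
    rw [this]
    exact Submodule.sum_mem _ fun v _ => Submodule.smul_mem _ _ (key v)
  have h1 := Submodule.finrank_add_le_finrank_add_finrank R S
  rw [top, finrank_top, Module.finrank_fintype_fun_eq_card] at h1
  have h2 : Module.finrank K2 S ≤ 1 := by
    refine (finrank_span_le_card _).trans ?_
    simp
  show _ ≤ Module.finrank K2 R + 1
  omega

lemma Phi_const (f : T.Dt → K2) (hf : f ∈ T.Phi) (h : T.dl f = 0) : ∀ a b, f a = f b := by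
  have h1 : ∀ e, f (T.rv e) = f e := by
    intro e
    have : f e + f (T.rv e) = 0 := congrFun h e
    rw [CharTwo.add_eq_zero] at this; exact this.symm
  rintro ⟨⟨a, a'⟩, ha⟩
  have key : ∀ x, ∀ y (hxy : T.adj x y), f ⟨(x, y), hxy⟩ = f ⟨(a, a'), ha⟩ := by
    have rot : ∀ x y (hxy : T.adj x y), f ⟨(x, T.nx x y), T.nx_adj hxy⟩ = f ⟨(x,y), hxy⟩ := by
      intro x y hxy
      have := hf ⟨(y, x), T.symm hxy⟩
      rw [show f ⟨(x,y), hxy⟩ = f ⟨(y, x), T.symm hxy⟩ from (h1 ⟨(x,y), hxy⟩).symm, ← this]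
      rfl
    have rot2 : ∀ x y (hxy : T.adj x y), f ⟨(x, y), hxy⟩ = f ⟨(a, a'), ha⟩ → 
        ∀ z (hxz : T.adj x z), f ⟨(x, z), hxz⟩ = f ⟨(a, a'), ha⟩ := by
      intro x y hxy e z hxz
      exact T.trans x y (fun z => ∀ hz : T.adj x z, f ⟨(x, z), hz⟩ = f ⟨(a, a'), ha⟩) hxy
        (fun _ => e) (fun w hw ih _ => by rw [← ih hw]; exact rot x w hw) z hxz hxz
    refine T.conn (fun x => ∀ y (hxy : T.adj x y), f ⟨(x, y), hxy⟩ = f ⟨(a, a'), ha⟩) a ?_ ?_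
    · exact rot2 a a' ha rfl
    · intro x y hxy hx
      apply rot2 y x (T.symm hxy)
      rw [← hx y hxy]; exact h1 ⟨(x,y), hxy⟩
  rintro ⟨⟨b, b'⟩, hb⟩
  exact (key b b' hb).symm

lemma dl_range : T.Sy ⊓ LinearMap.ker T.bd ≤ T.Phi.map T.dl := by
  have le : T.Phi.map T.dl ≤ T.Sy ⊓ LinearMap.ker T.bd := by
    rintro _ ⟨f, hf, rfl⟩
    constructor
    · intro e
      show f _ + f _ = f _ + f _
      rw [rv_rv, add_comm]
    · apply LinearMap.mem_ker.2
      ext v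
      rw [bd_apply]
      show ∑ e ∈ _, (f e + f (T.rv e)) = 0
      rw [sum_add_distrib, CharTwo.add_eq_zero]
      symm
      refine sum_bij (fun e _ => T.fp (T.rv e)) ?_ ?_ ?_ ?_
      · intro e he; simpa [fp, rv] using he
      · intro a _ b _ h
        have : T.rv a = T.rv b := by rw [← fp3 (T.rv a), h, fp3]
        rw [← rv_rv a, this, rv_rv]
      · intro b hb
        refine ⟨T.rv (T.fp (T.fp b)), ?_, ?_⟩
        · have : T.rv (T.fp (T.fp b)) = ⟨((T.fp (T.fp (T.fp b))).1.1, _), (T.rv (T.fp (T.fp b))).2⟩ := rfl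
          simp only [mem_filter, mem_univ, true_and] at hb ⊢
          rw [this]; simp only [fp3]; exact hb
        · rw [rv_rv, fp3]
      · intro e _; exact (hf (T.rv e)).symm
  have fr : Module.finrank K2 ↥(T.Sy ⊓ LinearMap.ker T.bd) ≤ Module.finrank K2 (T.Phi.map T.dl) := by
    have e1 := T.euler
    have e2 := finrank_Phi (T := T)
    have e3 := finrank_Sy (T := T)
    have e4 := finrank_bd (T := T)
    have e5 : Fintype.card T.Dt + 12 = 6 * Fintype.card V := by rw [card_Dt]; exact e1
    have r1 := LinearMap.finrank_range_add_finrank_ker (T.dl.domRestrict T.Phi)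
    have r2 := LinearMap.finrank_range_add_finrank_ker (T.bd.domRestrict T.Sy)
    rw [LinearMap.range_domRestrict] at r1 r2
    have k1 : Module.finrank K2 (LinearMap.ker (T.dl.domRestrict T.Phi)) ≤ 1 := by
      rw [finrank_le_one_iff]
      let one : T.Phi := ⟨fun _ => 1, fun _ => rfl⟩
      have h1 : one ∈ LinearMap.ker (T.dl.domRestrict T.Phi) := by
        rw [LinearMap.mem_ker]; ext e; show (1:K2) + 1 = 0; decide
      refine ⟨⟨one, h1⟩, ?_⟩
      rintro ⟨⟨f, hf⟩, hk⟩
      rw [LinearMap.mem_ker] at hk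
      have := Phi_const f hf hk
      by_cases hD : Nonempty T.Dt
      · obtain ⟨e0⟩ := hD
        refine ⟨f e0, ?_⟩
        apply Subtype.ext; apply Subtype.ext
        ext e
        show f e0 * 1 = f e
        rw [mul_one]; exact this _ _
      · refine ⟨0, ?_⟩
        apply Subtype.ext; apply Subtype.ext
        ext e
        exact (hD ⟨e⟩).elim
    have k2 : Module.finrank K2 (LinearMap.ker (T.bd.domRestrict T.Sy)) = Module.finrank K2 ↥(T.Sy ⊓ LinearMap.ker T.bd) := by
      rw [LinearMap.ker_domRestrict, ← Submodule.finrank_map_subtype_eq T.Sy, Submodule.map_comap_subtype]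
    omega
  exact (Submodule.eq_of_le_of_finrank_le le fr).ge

lemma H (z : V → V → K2) (zs : ∀ x y, z x y = z y x) (z0 : ∀ x y, ¬ T.adj x y → z x y = 0)
    (zb : ∀ x, ∑ y, z x y = 0) : ∃ f : V → V → K2,
    (∀ u v, T.adj u v → f u v = f v (T.nx v u)) ∧ (∀ u v, T.adj u v → f u v + f v u = z u v) := by
  let z' : T.Dt → K2 := fun e => z e.1.1 e.1.2
  have hz : z' ∈ T.Sy ⊓ LinearMap.ker T.bd := by
    constructor
    · intro e; exact zs _ _
    · apply LinearMap.mem_ker.2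
      ext v
      rw [bd_apply, Pi.zero_apply, ← zb v, ← sum_filter_of_ne (p := T.adj v) (fun y _ h => by by_contra h'; exact h (z0 _ _ h'))]
      refine sum_bij (fun e _ => e.1.2) ?_ ?_ ?_ ?_
      · rintro ⟨⟨a, b⟩, h⟩ he; simp at he ⊢; rw [← he]; exact h
      · rintro ⟨⟨a, b⟩, h⟩ he ⟨⟨a', b'⟩, h'⟩ he' e
        simp at he he' e
        subst he; subst he'; subst e; rfl
      · intro b hb; simp at hb
        exact ⟨⟨(v, b), hb⟩, by simp, rfl⟩
      · rintro ⟨⟨a, b⟩, h⟩ he; simp at he; subst he; rfl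
  obtain ⟨f, hf, hd⟩ := dl_range hz
  refine ⟨fun u v => if h : T.adj u v then f ⟨(u,v), h⟩ else 0, ?_, ?_⟩
  · intro u v h
    dsimp only
    rw [dif_pos h, dif_pos (T.nx_adj (T.symm h))]
    exact (hf ⟨(u,v),h⟩).symm
  · intro u v h
    dsimp only
    rw [dif_pos h, dif_pos (T.symm h)]
    exact congrFun hd ⟨(u,v),h⟩

/-- connection inside a set -/
def Cn (T : Tri V) (A : Set V) : V → V → Prop :=
  Relation.ReflTransGen (fun x y => T.adj x y ∧ x ∈ A ∧ y ∈ A)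

lemma Cn.chain {A : Set V} {a c : V} (h : T.Cn A a c) (ha : a ∈ A) : c ∈ A ∧ ∃ z : V → V → K2,
    (∀ x y, z x y = z y x) ∧ (∀ x y, z x y ≠ 0 → T.adj x y ∧ x ∈ A ∧ y ∈ A) ∧
    ∀ x, ∑ y, z x y = (if x = a then 1 else 0) + (if x = c then 1 else 0) := by
  induction h with
  | refl =>
    refine ⟨ha, fun _ _ => 0, fun _ _ => rfl, by simp, ?_⟩
    intro x; simp [CharTwo.add_self_eq_zero]
  | @tail b c _ hbc ih =>
    obtain ⟨hb, z, h1, h2, h3⟩ := ih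
    refine ⟨hbc.2.2, fun x y => z x y + ((if x = b ∧ y = c then 1 else 0) + (if x = c ∧ y = b then 1 else 0)), ?_, ?_, ?_⟩
    · intro x y; dsimp only; rw [h1 x y]; simp only [and_comm (a := x = b), and_comm (a := x = c)]; ring
    · intro x y h
      by_cases e1 : x = b ∧ y = c
      · rw [e1.1, e1.2]; exact hbc
      · by_cases e2 : x = c ∧ y = b
        · rw [e2.1, e2.2]; exact ⟨T.symm hbc.1, hbc.2.2, hbc.2.1⟩
        · simp only [if_neg e1, if_neg e2] at h
          exact h2 x y (by simpa using h)
    · intro x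
      simp only [sum_add_distrib, h3, ite_and]
      rw [show (∑ y, if x = b then (if y = c then (1:K2) else 0) else 0) = if x = b then 1 else 0 by
        split_ifs <;> simp]
      rw [show (∑ y, if x = c then (if y = b then (1:K2) else 0) else 0) = if x = c then 1 else 0 by
        split_ifs <;> simp]
      have : ∀ p q s : K2, p + q + (q + s) = p + s := by decide
      exact this _ _ _

lemma Sep {v u : V} (h : T.adj v u) {i j k l : ℕ} (hij : i < j) (hjk : j < k) (hkl : k < l)
    (hl : l < T.d v) {A B : Set V} (hA : v ∉ A) (hB : v ∉ B) (hAB : Disjoint A B)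
    (iA : T.r v u i ∈ A) (jB : T.r v u j ∈ B)
    (h1 : T.Cn A (T.r v u i) (T.r v u k)) (h2 : T.Cn B (T.r v u j) (T.r v u l)) : False := by
  obtain ⟨kA, z, zs, z0, zb⟩ := h1.chain iA
  have lB : T.r v u l ∈ B := (h2.chain jB).1
  have hik : T.r v u i ≠ T.r v u k := fun e => by have := r_inj h (by omega) (by omega) e; omega
  set a := T.r v u i with ha
  set c := T.r v u k with hc
  have hva : T.adj v a := r_adj h i
  have hvc : T.adj v c := r_adj h k
  have hav : a ≠ v := (ne hva).symm
  have hcv : c ≠ v := (ne hvc).symm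
  have zv : ∀ y, z v y = 0 := by
    intro y; by_contra hy; exact hA (z0 _ _ hy).2.1
  let g : V → V → K2 := fun x y => if x = v ∧ (y = a ∨ y = c) then 1 else 0
  have gne : ∀ x y, g x y ≠ 0 → x = v ∧ (y = a ∨ y = c) := by
    intro x y hh; by_contra hn; simp [g, hn] at hh
  have gv : ∀ y, g v y = if y = a ∨ y = c then 1 else 0 := by intro y; simp [g]
  have gn : ∀ x y, x ≠ v → g x y = 0 := by intro x y hx; simp [g, hx]
  have gn2 : ∀ x y, y ≠ a → y ≠ c → g x y = 0 := by intro x y hx hy; simp [g, hx, hy]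
  obtain ⟨f, f1, f2⟩ := T.H (fun x y => z x y + (g x y + g y x))
    (by intro x y; rw [zs]; ring)
    (by
      intro x y hxy
      have e1 : z x y = 0 := by by_contra hn; exact hxy (z0 _ _ hn).1
      have e2 : g x y = 0 := by
        by_contra hn; obtain ⟨rfl, rfl | rfl⟩ := gne _ _ hn
        · exact hxy hva
        · exact hxy hvc
      have e3 : g y x = 0 := by
        by_contra hn; obtain ⟨rfl, rfl | rfl⟩ := gne _ _ hn
        · exact hxy (T.symm hva)
        · exact hxy (T.symm hvc)
      rw [e1, e2, e3]; rfl)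
    (by
      intro x
      rw [sum_add_distrib, sum_add_distrib, zb]
      by_cases hx : x = v
      · subst hx
        have s1 : ∑ y, g x y = 0 := by
          simp only [gv]
          rw [← sum_filter]
          rw [show (univ.filter fun y => y = a ∨ y = c) = {a, c} by ext; simp]
          rw [sum_pair hik]; rfl
        have s2 : ∑ y, g y x = 0 := by
          apply sum_eq_zero; intro y _; exact gn2 _ _ hav.symm hcv.symm
        rw [s1, s2, if_neg hav.symm, if_neg hcv.symm]; rfl
      · have s1 : ∑ y, g x y = 0 := by
          apply sum_eq_zero; intro y _; exact gn _ _ hx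
        have s2 : ∑ y, g y x = g v x := by
          apply sum_eq_single_of_mem v (mem_univ _); intro y _ hy; exact gn _ _ hy
        rw [s1, s2, gv]
        by_cases e1 : x = a
        · have : x ≠ c := by rw [e1]; exact hik
          simp [e1, hik]; decide
        · by_cases e2 : x = c
          · simp [e2, hik.symm]; decide
          · simp [e1, e2])
  -- constant along B
  have zB : ∀ b ∈ B, ∀ y, z b y + (g b y + g y b) = 0 := by
    intro b hb y
    have bA : b ∉ A := fun hbA => Set.disjoint_left.1 hAB hbA hb
    have e1 : z b y = 0 := by by_contra hn; exact bA (z0 _ _ hn).2.1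
    rw [e1, gn b y (by rintro rfl; exact hB hb), gn2 y b (by rintro rfl; exact bA iA) (by rintro rfl; exact bA kA)]
    rfl
  have eqB : ∀ b ∈ B, ∀ y, T.adj b y → f b y = f y b := by
    intro b hb y hy
    have := f2 b y hy
    rw [zB b hb y, CharTwo.add_eq_zero] at this
    exact this
  have cB : ∀ b ∈ B, ∀ x y, T.adj b x → T.adj b y → f b x = f b y := by
    intro b hb x y hx hy
    refine T.trans b x (fun y => f b x = f b y) hx rfl ?_ y hy
    intro w hw e
    rw [e, eqB b hb w hw, f1 w b (T.symm hw)]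
  have hjl : ∀ w, T.Cn B (T.r v u j) w → w ∈ B ∧ ∀ x y, T.adj w y → T.adj (T.r v u j) x → f (T.r v u j) x = f w y := by
    intro w hw
    induction hw with
    | refl => exact ⟨jB, fun x y hy hx => cB _ jB _ _ hx hy⟩
    | @tail b b' _ hbb ih =>
      refine ⟨hbb.2.2, fun x y hy hx => ?_⟩
      rw [ih.2 x b' hbb.1 hx, eqB b hbb.2.1 _ hbb.1, cB b' hbb.2.2 _ _ (T.symm hbb.1) hy]
  have e1 := (hjl _ h2).2 v v (T.symm (r_adj h l)) (T.symm (r_adj h j))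
  rw [eqB _ jB _ (T.symm (r_adj h j)), eqB _ lB _ (T.symm (r_adj h l))] at e1
  have step : ∀ n, f v (T.r v u (n+1)) = f v (T.r v u n) + (if T.r v u n = a ∨ T.r v u n = c then 1 else 0) := by
    intro n
    have s1 := f2 v _ (r_adj h n)
    have s2 := f1 _ v (T.symm (r_adj h n))
    rw [r_succ, ← s2]
    simp only [zv, gv] at s1
    rw [gn _ v (ne (r_adj h n)).symm] at s1
    generalize (if T.r v u n = a ∨ T.r v u n = c then (1:K2) else 0) = q at *
    generalize f v (T.r v u n) = p at *
    clear s2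
    generalize f (T.r v u n) v = s at *
    clear e1
    revert s1; revert p q s; decide
  have step2 : ∀ n, j ≤ n → n ≤ l → f v (T.r v u n) = f v (T.r v u j) + if k < n then 1 else 0 := by
    intro n hn
    induction n, hn using Nat.le_induction with
    | base => intro _; simp [show ¬ k < j by omega]
    | succ n hn ih =>
      intro hnl
      rw [step n, ih (by omega)]
      have n1 : T.r v u n ≠ a := fun e => by have := r_inj h (by omega) (by omega) e; omega
      have n2 : T.r v u n = c ↔ n = k := ⟨fun e => r_inj h (by omega) (by omega) e, fun e => by rw [e]⟩
      simp only [n1, n2, false_or]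
      rcases lt_trichotomy n k with q | q | q
      · simp [show ¬ k < n by omega, show n ≠ k by omega, show ¬ k < n + 1 by omega]
      · simp [q]
      · simp [q, show n ≠ k by omega, show k < n + 1 by omega]
  have := step2 l (by omega) le_rfl
  rw [← e1, if_pos hkl] at this
  generalize f v (T.r v u j) = p at this
  revert p; decide
end Tri
end FC


namespace FC
open Finset Function
open scoped Classical

section conv
variable {W : Type} [Fintype W] {G : SimpleGraph W} {σ : Equiv.Perm G.Dart}

lemma cycle_pow {α : Type} [Fintype α] (f : Equiv.Perm α) {d e : α} (h : f.SameCycle d e) :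
    ∃ n : ℕ, (f ^ n) d = e := by
  obtain ⟨n, _, hn⟩ := h.exists_pow_eq'
  exact ⟨n, hn⟩

lemma pow3 {α : Type} [Fintype α] (f : Equiv.Perm α) (d : α)
    (h : Nat.card {e : α // f.SameCycle d e} = 3) : f (f (f d)) = d := by
  have hp : 0 < minimalPeriod f d := by
    apply IsPeriodicPt.minimalPeriod_pos (n := orderOf f) (orderOf_pos f)
    show f^[orderOf f] d = d
    rw [← Equiv.Perm.coe_pow, pow_orderOf_eq_one]; rfl
  let g : Fin (minimalPeriod f d) → {e : α // f.SameCycle d e} := fun i => ⟨f^[i] d, (i : ℤ), by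
    rw [← Equiv.Perm.coe_pow]; rfl⟩
  have hg : Bijective g := by
    constructor
    · intro i j e
      have := congrArg Subtype.val e
      exact Fin.ext (iterate_injOn_Iio_minimalPeriod i.2 j.2 this)
    · rintro ⟨e, he⟩
      obtain ⟨n, rfl⟩ := cycle_pow f he
      refine ⟨⟨n % minimalPeriod f d, Nat.mod_lt _ hp⟩, ?_⟩
      apply Subtype.ext
      show f^[n % minimalPeriod f d] d = _
      rw [iterate_mod_minimalPeriod_eq, ← Equiv.Perm.coe_pow]
  have := Nat.card_eq_of_bijective g hg
  rw [h, Nat.card_fin] at this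
  have h2 := iterate_minimalPeriod (f := f) (x := d)
  rw [this] at h2
  exact h2

/-- next neighbour function of a rotation system -/
noncomputable def nxt (G : SimpleGraph W) (σ : Equiv.Perm G.Dart) (v u : W) : W :=
  if h : G.Adj v u then (σ ⟨(v, u), h⟩).toProd.2 else u

lemma nxt_dart (h : IsRotationSystem G σ) {v u : W} (hv : G.Adj v u) :
    ∃ h' : G.Adj v (nxt G σ v u), σ ⟨(v,u), hv⟩ = ⟨(v, nxt G σ v u), h'⟩ := by
  have h1 := h.fst_eq ⟨(v,u), hv⟩
  have h2 := (σ ⟨(v,u), hv⟩).adj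
  simp only at h1
  have e : (σ ⟨(v,u), hv⟩).toProd = (v, nxt G σ v u) := by
    rw [nxt, dif_pos hv]
    exact Prod.ext h1 rfl
  rw [e] at h2
  exact ⟨h2, SimpleGraph.Dart.ext _ _ e⟩

lemma exists_tri (h : IsPlaneTriangulation G σ) : ∃ T : Tri W, ∀ a b, T.adj a b ↔ G.Adj a b := by
  refine ⟨⟨G.Adj, fun h => h.symm, fun a => G.loopless.irrefl a, nxt G σ, ?_, ?_, ?_, ?_, ?_⟩, fun _ _ => Iff.rfl⟩
  · intro v u hv; exact (nxt_dart h.rot hv).1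
  · intro v u hv
    obtain ⟨h1, e1⟩ := nxt_dart h.rot hv
    obtain ⟨h2, e2⟩ := nxt_dart h.rot h1.symm
    have := pow3 (facePerm σ) ⟨(u,v), hv.symm⟩ (h.face_size_eq _)
    have f1 : facePerm σ ⟨(u,v), hv.symm⟩ = ⟨(v, nxt G σ v u), h1⟩ := e1
    rw [f1] at this
    have f2 : facePerm σ ⟨(v, nxt G σ v u), h1⟩ = ⟨(nxt G σ v u, _), h2⟩ := e2
    rw [f2] at this
    have f3 : facePerm σ ⟨(nxt G σ v u, _), h2⟩ = _ := (nxt_dart h.rot h2.symm).2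
    rw [f3] at this
    exact congrArg (fun d : G.Dart => d.toProd.1) this
  · intro v u p hv hu hp x hx
    obtain ⟨n, hn⟩ := cycle_pow σ (h.rot.orbit_eq ⟨(v,u), hv⟩ ⟨(v,x), hx⟩ rfl)
    have : ∀ n : ℕ, ∃ w, ∃ hw : G.Adj v w, (σ ^ n) ⟨(v,u), hv⟩ = ⟨(v,w), hw⟩ ∧ p w := by
      intro n
      induction n with
      | zero => exact ⟨u, hv, rfl, hu⟩
      | succ n ih =>
        obtain ⟨w, hw, e, pw⟩ := ih
        refine ⟨nxt G σ v w, (nxt_dart h.rot hw).1, ?_, hp w hw pw⟩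
        rw [pow_succ', Equiv.Perm.mul_apply, e]
        exact (nxt_dart h.rot hw).2
    obtain ⟨w, hw, e, pw⟩ := this n
    rw [hn] at e
    have : x = w := congrArg (fun d : G.Dart => d.toProd.2) e
    rwa [this]
  · intro p a ha hp b
    obtain ⟨w⟩ := h.connected.preconnected a b
    induction w with
    | nil => exact ha
    | cons hadj _ ih => exact ih (hp _ _ hadj ha)
  · have e1 := h.euler
    have e2 : Nat.card G.Dart = 3 * numFaces σ := by
      have : Nat.card G.Dart = Nat.card (Σ q : Quotient (orbitSetoid (facePerm σ)), {d : G.Dart // Quotient.mk _ d = q}) :=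
        Nat.card_congr (Equiv.sigmaFiberEquiv _).symm
      rw [this, Nat.card_sigma, numFaces]
      have : ∀ q : Quotient (orbitSetoid (facePerm σ)), Nat.card {d : G.Dart // Quotient.mk _ d = q} = 3 := by
        intro q
        induction q using Quotient.inductionOn with
        | _ d =>
        rw [← h.face_size_eq d, faceSize]
        apply Nat.card_congr
        apply Equiv.subtypeEquivRight
        intro e
        rw [Quotient.eq]
        exact ⟨fun h => Equiv.Perm.SameCycle.symm h, fun h => Equiv.Perm.SameCycle.symm h⟩
      simp only [this, sum_const, card_univ, smul_eq_mul, Nat.card_eq_fintype_card]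
      ring
    have e3 : Nat.card G.Dart = 2 * Nat.card G.edgeSet := by
      rw [Nat.card_eq_fintype_card, G.dart_card_eq_twice_card_edges, Nat.card_eq_fintype_card]
      rw [SimpleGraph.edgeFinset_card]
    have e4 : Nat.card G.Dart = ∑ v, (univ.filter (G.Adj v)).card := by
      rw [Nat.card_eq_fintype_card, G.dart_card_eq_sum_degrees]
      apply sum_congr rfl
      intro v _
      rw [← G.card_neighborFinset_eq_degree]
      congr 1; ext; simp
    omega
end conv
end FC


namespace FC
open Finset Function
open scoped Classical
namespace Tri
variable {V : Type} [Fintype V] {T : Tri V}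

/-- proper on a set -/
def PropOn (T : Tri V) (U : Finset V) (c : V → Fin 5) : Prop :=
  ∀ x ∈ U, ∀ y ∈ U, T.adj x y → c x ≠ c y

lemma Cn.symm {A : Set V} {a b : V} (h : T.Cn A a b) : T.Cn A b a := by
  induction h with
  | refl => exact Relation.ReflTransGen.refl
  | tail _ h2 ih => exact Relation.ReflTransGen.head ⟨T.symm h2.1, h2.2.2, h2.2.1⟩ ih

lemma insert_free {U : Finset V} {v : V} (hv : v ∉ U) {c : V → Fin 5} (hc : T.PropOn U c)
    (k : Fin 5) (hk : k ≠ 4) (hfree : ∀ u ∈ U, T.adj v u → c u ≠ k) :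
    ∃ c', T.PropOn (insert v U) c' ∧ (∀ u ∈ U, (c' u = 4 ↔ c u = 4)) ∧ c' v ≠ 4 := by
  refine ⟨Function.update c v k, ?_, ?_, ?_⟩
  · intro x hx y hy hxy
    have hne := ne hxy
    rw [mem_insert] at hx hy
    by_cases ex : x = v
    · subst ex
      have hy' : y ∈ U := hy.resolve_left (Ne.symm hne)
      rw [update_self, update_of_ne (Ne.symm hne)]
      exact (hfree y hy' hxy).symm
    · have hx' := hx.resolve_left ex
      by_cases ey : y = v
      · subst ey
        rw [update_self, update_of_ne hne]
        exact hfree x hx' (T.symm hxy)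
      · rw [update_of_ne ex, update_of_ne ey]
        exact hc x hx' y (hy.resolve_left ey) hxy
  · intro u hu
    rw [update_of_ne (by rintro rfl; exact hv hu)]
  · rw [update_self]; exact hk

lemma insert_swap {U : Finset V} {v : V} (hv : v ∉ U) {c : V → Fin 5} (hc : T.PropOn U c)
    {p q : Fin 5} (hp : p ≠ 4) (hq : q ≠ 4) {a b : V} (ha : a ∈ U) (ca : c a = p)
    (ua : ∀ u ∈ U, T.adj v u → c u = p → u = a) (ub : ∀ u ∈ U, T.adj v u → c u = q → u = b)
    (hab : ¬ T.Cn {x | x ∈ U ∧ (c x = p ∨ c x = q)} a b) :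
    ∃ c', T.PropOn (insert v U) c' ∧ (∀ u ∈ U, (c' u = 4 ↔ c u = 4)) ∧ c' v ≠ 4 := by
  set A : Set V := {x | x ∈ U ∧ (c x = p ∨ c x = q)} with hA
  have aA : a ∈ A := ⟨ha, Or.inl ca⟩
  have RA : ∀ x, T.Cn A a x → x ∈ A := fun x hx => (hx.chain aA).1
  let c1 : V → Fin 5 := fun x => if T.Cn A a x then Equiv.swap p q (c x) else c x
  have key : ∀ x ∈ U, ∀ y ∈ U, T.adj x y → T.Cn A a x → ¬ T.Cn A a y → c1 x ≠ c1 y := by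
    intro x hx y hy hxy cx cy
    have xA := RA x cx
    have yA : y ∉ A := fun yA => cy (Relation.ReflTransGen.tail cx ⟨hxy, xA, yA⟩)
    have : ¬ (c y = p ∨ c y = q) := fun h => yA ⟨hy, h⟩
    push Not at this
    simp only [c1, if_pos cx, if_neg cy]
    rcases xA.2 with e | e
    · rw [e, Equiv.swap_apply_left]; exact this.2.symm
    · rw [e, Equiv.swap_apply_right]; exact this.1.symm
  have hc1 : T.PropOn U c1 := by
    intro x hx y hy hxy
    by_cases cx : T.Cn A a x <;> by_cases cy : T.Cn A a y
    · simp only [c1, if_pos cx, if_pos cy]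
      exact fun e => hc x hx y hy hxy ((Equiv.swap p q).injective e)
    · exact key x hx y hy hxy cx cy
    · exact (key y hy x hx (T.symm hxy) cy cx).symm
    · simp only [c1, if_neg cx, if_neg cy]
      exact hc x hx y hy hxy
  have h4 : ∀ u, (c1 u = 4 ↔ c u = 4) := by
    intro u
    by_cases cu : T.Cn A a u
    · simp only [c1, if_pos cu]
      rw [Equiv.swap_apply_eq_iff, Equiv.swap_apply_of_ne_of_ne hp.symm hq.symm]
    · simp only [c1, if_neg cu]
  obtain ⟨c', h1, h2, h3⟩ := insert_free hv hc1 p hp (by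
    intro u hu hvu e
    by_cases cu : T.Cn A a u
    · simp only [c1, if_pos cu] at e
      rw [Equiv.swap_apply_eq_iff, Equiv.swap_apply_left] at e
      have := ub u hu hvu e
      subst this
      exact hab cu
    · simp only [c1, if_neg cu] at e
      have := ua u hu hvu e
      subst this
      exact cu Relation.ReflTransGen.refl)
  exact ⟨c', h1, fun u hu => (h2 u hu).trans (h4 u), h3⟩

lemma insert_col {U : Finset V} {v : V} (hv : v ∉ U) {c : V → Fin 5} (hc : T.PropOn U c)
    (hcard : ((T.N v).filter (fun u => u ∈ U ∧ c u ≠ 4)).card ≤ 4) :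
    ∃ c', T.PropOn (insert v U) c' ∧ (∀ u ∈ U, (c' u = 4 ↔ c u = 4)) ∧ c' v ≠ 4 := by
  by_cases hfree : ∃ k : Fin 5, k ≠ 4 ∧ ∀ u ∈ U, T.adj v u → c u ≠ k
  · obtain ⟨k, hk, h⟩ := hfree; exact insert_free hv hc k hk h
  push Not at hfree
  have hex : ∀ k : Fin 4, ∃ u ∈ U, T.adj v u ∧ c u = k.castSucc := by
    intro k; apply hfree; intro h
    have h1 := congrArg Fin.val h
    have := k.2
    simp at h1; omega
  choose a aU va ca using hex
  have ainj : Injective a := by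
    intro i j e
    have := ca i; rw [e, ca j] at this
    exact (Fin.castSucc_injective _ this).symm
  have himg : univ.image a = (T.N v).filter (fun u => u ∈ U ∧ c u ≠ 4) := by
    apply eq_of_subset_of_card_le
    · intro x hx
      simp only [mem_image, mem_univ, true_and] at hx
      obtain ⟨k, rfl⟩ := hx
      simp only [mem_filter, mem_N]
      refine ⟨va k, aU k, ?_⟩
      rw [ca k]; intro h
      have h1 := congrArg Fin.val h
      have := k.2
      simp at h1; omega
    · rw [card_image_of_injective _ ainj]; simpa using hcard
  have uniq : ∀ (k : Fin 4), ∀ u ∈ U, T.adj v u → c u = k.castSucc → u = a k := by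
    intro k u hu hvu e
    have : u ∈ univ.image a := by
      rw [himg]; simp only [mem_filter, mem_N]
      refine ⟨hvu, hu, ?_⟩
      rw [e]; intro h
      have h1 := congrArg Fin.val h
      have := k.2
      simp at h1; omega
    simp only [mem_image, mem_univ, true_and] at this
    obtain ⟨j, rfl⟩ := this
    rw [ca j] at e
    rw [Fin.castSucc_injective _ e]
  have n4 : ∀ k : Fin 4, (k.castSucc : Fin 5) ≠ 4 := by decide
  have h0 := va 0
  have hidx : ∀ k, ∃ n < T.d v, T.r v (a 0) n = a k := fun k => r_lt h0 (va k)
  choose n nlt hn using hidx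
  have ninj : Injective n := by
    intro i j e; apply ainj; rw [← hn i, ← hn j, e]
  let π := Tuple.sort n
  have hm : StrictMono (n ∘ π) := (Tuple.monotone_sort n).strictMono_of_injective (ninj.comp π.injective)
  by_cases hA : T.Cn {x | x ∈ U ∧ (c x = (π 0).castSucc ∨ c x = (π 2).castSucc)} (a (π 0)) (a (π 2))
  · by_cases hB : T.Cn {x | x ∈ U ∧ (c x = (π 1).castSucc ∨ c x = (π 3).castSucc)} (a (π 1)) (a (π 3))
    · exfalso
      have l1 : n (π 0) < n (π 1) := hm (by decide)
      have l2 : n (π 1) < n (π 2) := hm (by decide)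
      have l3 : n (π 2) < n (π 3) := hm (by decide)
      rw [← hn, ← hn (π 2)] at hA
      rw [← hn, ← hn (π 3)] at hB
      refine Sep h0 l1 l2 l3 (nlt _) (fun h => hv h.1) (fun h => hv h.1) ?_ ?_ ?_ hA hB
      · rw [Set.disjoint_left]
        rintro x ⟨_, h1⟩ ⟨_, h2⟩
        have ne1 : ∀ i j : Fin 4, i ≠ j → (π i).castSucc ≠ (π j).castSucc := by
          intro i j hij h; exact hij (π.injective (Fin.castSucc_injective _ h))
        rcases h1 with h1 | h1 <;> rcases h2 with h2 | h2 <;> rw [h1] at h2 <;> revert h2 <;> apply ne1 <;> decide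
      · rw [hn]; exact ⟨aU _, Or.inl (ca _)⟩
      · rw [hn]; exact ⟨aU _, Or.inl (ca _)⟩
    · exact insert_swap hv hc (n4 _) (n4 _) (aU _) (ca _) (uniq _) (uniq _) hB
  · exact insert_swap hv hc (n4 _) (n4 _) (aU _) (ca _) (uniq _) (uniq _) hA
end Tri
end FC


namespace FC
open Finset Function
open scoped Classical
namespace Tri
variable {V : Type} [Fintype V] {T : Tri V}

lemma exists_nbr (h : 2 ≤ Fintype.card V) (w : V) : ∃ a, T.adj w a := by
  by_contra hn
  push Not at hn
  have : ∀ b, b = w := T.conn (fun b => b = w) w rfl (fun x y hxy hx => by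
    subst hx; exact (hn y hxy).elim)
  have : Fintype.card V ≤ 1 := Fintype.card_le_one_iff.2 fun a b => by rw [this a, this b]
  omega

lemma d_ge3 (h : 4 ≤ Fintype.card V) (w : V) : 3 ≤ T.d w := by
  obtain ⟨a, ha⟩ := T.exists_nbr (by omega) w
  by_contra hd
  have h0 := d_pos ha
  have h1 := r_d ha
  have : T.d w = 1 ∨ T.d w = 2 := by omega
  rcases this with e | e
  · rw [e, r_succ, r_zero] at h1
    exact nx_ne ha h1
  · rw [e, r_succ, r_succ, r_zero] at h1
    set b := T.nx w a with hb
    have wb : T.adj w b := T.nx_adj ha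
    have ab : T.adj a b := adj_nx ha
    have Na : ∀ x, T.adj a x → x = w ∨ x = b := by
      refine T.trans a w (fun x => x = w ∨ x = b) (T.symm ha) (Or.inl rfl) ?_
      rintro x _ (rfl | rfl)
      · right; have := T.face wb; rw [h1] at this; exact this
      · left; exact nx2 ha
    have Nb : ∀ x, T.adj b x → x = w ∨ x = a := by
      refine T.trans b w (fun x => x = w ∨ x = a) (T.symm wb) (Or.inl rfl) ?_
      rintro x _ (rfl | rfl)
      · right; exact T.face ha
      · left; have := nx2 wb; rw [h1] at this; exact this
    have Nw : ∀ x, T.adj w x → x = a ∨ x = b := by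
      refine T.trans w a (fun x => x = a ∨ x = b) ha (Or.inl rfl) ?_
      rintro x _ (rfl | rfl)
      · right; rfl
      · left; exact h1
    have all : ∀ x, x = w ∨ x = a ∨ x = b := by
      refine T.conn (fun x => x = w ∨ x = a ∨ x = b) w (Or.inl rfl) ?_
      rintro x y hxy (rfl | rfl | rfl)
      · exact Or.inr (Nw y hxy)
      · rcases Na y hxy with h | h <;> simp [h]
      · rcases Nb y hxy with h | h <;> simp [h]
    have : (univ : Finset V) ⊆ {w, a, b} := by intro x _; simpa using all x
    have := card_le_card this
    have h3 : ({w, a, b} : Finset V).card ≤ 3 := card_le_three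
    rw [card_univ] at this
    omega

lemma sum_card_rel (R : V → V → Prop) :
    ∑ v, (univ.filter (R v)).card = (univ.filter fun p : V × V => R p.1 p.2).card := by
  rw [← Finset.univ_product_univ, card_eq_sum_card_fiberwise (f := Prod.fst) (t := univ)]
  · apply sum_congr rfl
    intro v _
    symm
    refine card_bij' (fun p _ => p.2) (fun u _ => (v, u)) ?_ ?_ ?_ ?_
    · rintro ⟨a, b⟩ h; simp at h ⊢; rw [← h.2]; exact h.1
    · intro u h; simpa using h
    · rintro ⟨a, b⟩ h; simp at h ⊢; rw [← h.2]
    · intro u h; rfl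
  · intro; simp

/-! ### deleting a vertex of degree 3 -/

lemma delete {w : V} (hd : T.d w = 3) : ∃ T' : Tri {x // x ≠ w}, ∀ x y, T'.adj x y ↔ T.adj x.1 y.1 := by
  let nx' : {x // x ≠ w} → {x // x ≠ w} → {x // x ≠ w} := fun v u =>
    if h : T.nx v u ≠ w then ⟨T.nx v u, h⟩ else if h' : T.nx v w ≠ w then ⟨T.nx v w, h'⟩ else u
  have e1 : ∀ v u : {x // x ≠ w}, T.nx v u ≠ w → (nx' v u).1 = T.nx v u := by
    intro v u h; simp only [nx', dif_pos h]
  have e2 : ∀ v u : {x // x ≠ w}, T.adj v u → T.nx v u = w → T.adj v w ∧ (nx' v u).1 = T.nx v w := by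
    intro v u h1 h2
    have hv : T.adj v w := by have := T.nx_adj h1; rwa [h2] at this
    have := nx_ne hv
    refine ⟨hv, ?_⟩
    simp only [nx', dif_neg (not_not.2 h2), dif_pos this]
  have c3 : ∀ a, T.adj w a → T.nx w (T.nx w (T.nx w a)) = a := by
    intro a ha
    have := r_d ha
    rwa [hd, r_succ, r_succ, r_succ, r_zero] at this
  refine ⟨⟨fun x y => T.adj x y, fun h => T.symm h, fun a => T.irrefl a, nx', ?_, ?_, ?_, ?_, ?_⟩, fun _ _ => Iff.rfl⟩
  · intro v u h
    by_cases hw : T.nx v u = w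
    · obtain ⟨h1, h2⟩ := e2 v u h hw
      rw [h2]; exact T.nx_adj h1
    · rw [e1 v u hw]; exact T.nx_adj h
  · intro v u h
    apply Subtype.ext
    by_cases hw : T.nx v u = w
    · obtain ⟨h1, h2⟩ := e2 v u h hw
      have wv := T.symm h1
      have f1 : T.nx w v = u := by have := T.face h; rwa [hw] at this
      set t := T.nx w u.1 with ht
      have f2 : T.nx w t = v := by rw [ht, ← f1]; exact c3 _ wv
      have wu : T.adj w u := f1 ▸ T.nx_adj wv
      have wt : T.adj w t := T.nx_adj wu
      have f3 : T.nx v w = t := by rw [← f2]; exact T.face wt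
      have f4 : T.nx t v = w := by rw [← f2]; exact nx2 wt
      rw [f3] at h2
      have f5 : T.adj (nx' v u).1 v := by rw [h2]; have := adj_nx wt; rwa [f2] at this
      rw [(e2 (nx' v u) v f5 (by rw [h2]; exact f4)).2, h2]
      exact T.face wu
    · have h1 := e1 v u hw
      have h2 : T.nx (nx' v u).1 v = u := by rw [h1]; exact T.face h
      rw [e1 _ _ (by rw [h2]; exact u.2), h2]
  · intro v u p hvu hu hp x hx
    have := T.trans v u (fun x => (∀ h : x ≠ w, p ⟨x, h⟩) ∧ (x = w → ∀ h : T.nx v w ≠ w, p ⟨T.nx v w, h⟩)) hvu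
      ⟨fun _ => hu, fun h => (u.2 h).elim⟩ (by
        intro y hy ⟨py1, py2⟩
        by_cases yw : y = w
        · subst yw
          exact ⟨fun h => py2 rfl h, fun h => (nx_ne hy h).elim⟩
        · have := hp ⟨y, yw⟩ hy (py1 yw)
          constructor
          · intro h
            have h' := e1 v ⟨y, yw⟩ h
            convert this
            exact h'.symm
          · intro h h'
            have h' := (e2 v ⟨y, yw⟩ hy h).2
            convert this
            exact h'.symm) x hx
    exact this.1 x.2
  · intro p a ha hp b
    have := T.conn (fun x => (∀ h : x ≠ w, p ⟨x, h⟩) ∧ (x = w → ∀ y, T.adj w y → ∀ h : y ≠ w, p ⟨y, h⟩)) a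
      ⟨fun _ => ha, fun h => (a.2 h).elim⟩ (by
        intro x y hxy ⟨p1, p2⟩
        by_cases xw : x = w
        · subst xw
          exact ⟨fun h => p2 rfl y hxy h, fun h => (ne hxy h.symm).elim⟩
        · have px := p1 xw
          refine ⟨fun h => hp ⟨x, xw⟩ ⟨y, h⟩ hxy px, ?_⟩
          rintro rfl
          intro z hz
          refine T.trans y x (fun z => ∀ h : z ≠ y, p ⟨z, h⟩) (T.symm hxy) (fun _ => px) ?_ z hz
          intro q hq pq h
          exact hp ⟨q, (ne hq).symm⟩ ⟨_, h⟩ (adj_nx hq) (pq _)) b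
    exact this.1 b.2
  · have e := T.euler
    have e3 : ∀ v : {x // x ≠ w}, (univ.filter fun y : {x // x ≠ w} => T.adj v y).card + (if T.adj w v then 1 else 0) = T.d v := by
      intro v
      have : (univ.filter fun y : {x // x ≠ w} => T.adj v y).card = ((T.N v).erase w).card := by
        rw [← card_map (Embedding.subtype _)]
        congr 1
        ext x
        simp [and_comm]
      rw [this]
      split_ifs with h
      · exact card_erase_add_one (mem_N.2 (T.symm h))
      · rw [erase_eq_of_notMem (fun h' => h (T.symm (mem_N.1 h'))), d]; rfl
    have e4 : ∑ v : {x // x ≠ w}, T.d v + T.d w = ∑ v, T.d v := by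
      rw [← Finset.sum_subtype (univ.erase w) (by simp) T.d]
      exact sum_erase_add _ _ (mem_univ w)
    have e5 : ∑ v : {x // x ≠ w}, (if T.adj w v then 1 else 0) = 3 := by
      rw [← Finset.sum_subtype (univ.erase w) (by simp) (fun v => if T.adj w v then 1 else 0), ← hd, d, card_eq_sum_ones, ← sum_filter]
      apply sum_congr _ (fun _ _ => rfl)
      ext x
      simp only [mem_filter, mem_erase, mem_univ, and_true, mem_N, and_iff_right_iff_imp]
      exact fun h => (ne h).symm
    have e6 : Fintype.card {x // x ≠ w} + 1 = Fintype.card V := by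
      rw [Fintype.card_subtype_compl, Fintype.card_subtype_eq]
      have : 0 < Fintype.card V := Fintype.card_pos_iff.2 ⟨w⟩
      omega
    have e7 := sum_congr rfl fun v (_ : v ∈ (univ : Finset {x // x ≠ w})) => e3 v
    rw [sum_add_distrib, e5] at e7
    have e8 : ∑ v, T.d v + 12 = 6 * Fintype.card V := e
    omega

/-! ### flipping an edge -/

set_option maxHeartbeats 1000000 in
lemma flip {w a b c : V} (wa : T.adj w a) (hb : T.nx w a = b) (hc : T.nx w b = c) (hac : a ≠ c)
    (nac : ¬ T.adj a c) : ∃ T' : Tri V, T'.N w = (T.N w).erase b ∧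
      ∀ x y, x ≠ w → y ≠ w → T.adj x y → T'.adj x y := by
  have wb : T.adj w b := hb ▸ T.nx_adj wa
  have wc : T.adj w c := hc ▸ T.nx_adj wb
  have ab : T.adj a b := hb ▸ adj_nx wa
  have bc : T.adj b c := hc ▸ adj_nx wb
  have e1 : T.nx b w = a := by rw [← hb]; exact T.face wa
  have e2 : T.nx a b = w := by rw [← hb]; exact nx2 wa
  have e3 : T.nx c w = b := by rw [← hc]; exact T.face wb
  have e4 : T.nx b c = w := by rw [← hc]; exact nx2 wb
  have nwa := ne wa
  have nwb := ne wb
  have nwc := ne wc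
  have nab := ne ab
  have nbc := ne bc
  have nca : ¬ T.adj c a := fun h => nac (T.symm h)
  let adj' : V → V → Prop := fun x y => (T.adj x y ∧ ¬ (x = w ∧ y = b) ∧ ¬ (x = b ∧ y = w)) ∨
    (x = a ∧ y = c) ∨ (x = c ∧ y = a)
  let nx' : V → V → V := fun x y =>
    if x = w ∧ y = a then c else if x = b ∧ y = c then a else if x = a ∧ y = b then c else
    if x = a ∧ y = c then w else if x = c ∧ y = w then a else if x = c ∧ y = a then b else T.nx x y
  have n1 : nx' w a = c := by simp [nx']
  have n2 : nx' b c = a := by simp [nx', nwb.symm]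
  have n3 : nx' a b = c := by simp [nx', nwa.symm, nab]
  have n4 : nx' a c = w := by simp [nx', nwa.symm, nab, nbc.symm]
  have n5 : nx' c w = a := by simp [nx', nwc.symm, nbc.symm, hac.symm]
  have n6 : nx' c a = b := by simp [nx', nwc.symm, nbc.symm, hac.symm, nwa.symm]
  have n7 : ∀ x y, ¬ (x = w ∧ y = a) → ¬ (x = b ∧ y = c) → ¬ (x = a ∧ y = b) → ¬ (x = a ∧ y = c) →
      ¬ (x = c ∧ y = w) → ¬ (x = c ∧ y = a) → nx' x y = T.nx x y := by
    intro x y h1 h2 h3 h4 h5 h6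
    simp only [nx', if_neg h1, if_neg h2, if_neg h3, if_neg h4, if_neg h5, if_neg h6]
  have A1 : adj' w a := Or.inl ⟨wa, by simp [nab], by simp [nwb]⟩
  have A2 : adj' w c := Or.inl ⟨wc, by simp [nbc.symm], by simp [nwb]⟩
  have A3 : adj' a b := Or.inl ⟨ab, by simp [nwa.symm], by simp [nab]⟩
  have A4 : adj' b c := Or.inl ⟨bc, by simp [nwb.symm], by simp [nwc.symm]⟩
  have A5 : adj' a c := Or.inr (Or.inl ⟨rfl, rfl⟩)
  have sy : ∀ {x y}, adj' x y → adj' y x := by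
    rintro x y (⟨h1, h2, h3⟩ | h | h)
    · exact Or.inl ⟨T.symm h1, fun h => h3 ⟨h.2, h.1⟩, fun h => h2 ⟨h.2, h.1⟩⟩
    · exact Or.inr (Or.inr ⟨h.2, h.1⟩)
    · exact Or.inr (Or.inl ⟨h.2, h.1⟩)
  -- a case principle for darts of the new graph
  have cs : ∀ (p : V → V → Prop), p w a → p b c → p a b → p a c → p c w → p c a →
      (∀ x y, T.adj x y → ¬ (x = w ∧ y = b) → ¬ (x = b ∧ y = w) → 
      ¬ (x = w ∧ y = a) → ¬ (x = b ∧ y = c) → ¬ (x = a ∧ y = b) →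
      ¬ (x = c ∧ y = w) → nx' x y = T.nx x y → p x y) → ∀ x y, adj' x y → p x y := by
    intro p p1 p2 p3 p4 p5 p6 p7 x y h
    by_cases h1 : x = w ∧ y = a
    · rw [h1.1, h1.2]; exact p1
    by_cases h2 : x = b ∧ y = c
    · rw [h2.1, h2.2]; exact p2
    by_cases h3 : x = a ∧ y = b
    · rw [h3.1, h3.2]; exact p3
    by_cases h4 : x = a ∧ y = c
    · rw [h4.1, h4.2]; exact p4
    by_cases h5 : x = c ∧ y = w
    · rw [h5.1, h5.2]; exact p5
    by_cases h6 : x = c ∧ y = a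
    · rw [h6.1, h6.2]; exact p6
    rcases h with ⟨q1, q2, q3⟩ | h | h
    · exact p7 x y q1 q2 q3 h1 h2 h3 h5 (n7 x y h1 h2 h3 h4 h5 h6)
    · exact (h4 h).elim
    · exact (h6 h).elim
  have Hadj : ∀ x y, adj' x y → adj' x (nx' x y) := by
    apply cs
    · rw [n1]; exact A2
    · rw [n2]; exact sy A3
    · rw [n3]; exact A5
    · rw [n4]; exact sy A1
    · rw [n5]; exact sy A5
    · rw [n6]; exact sy A4
    · intro x y h _ _ h1 h2 _ _ e
      rw [e]
      refine Or.inl ⟨T.nx_adj h, ?_, ?_⟩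
      · rintro ⟨rfl, h'⟩
        exact h1 ⟨rfl, nx_inj h wa (h'.trans hb.symm)⟩
      · rintro ⟨rfl, h'⟩
        exact h2 ⟨rfl, nx_inj h bc (h'.trans e4.symm)⟩
  have Hface : ∀ x y, adj' x y → nx' (nx' x y) x = y := by
    apply cs
    · rw [n1, n5]
    · rw [n2, n3]
    · rw [n3, n6]
    · rw [n4, n1]
    · rw [n5, n4]
    · rw [n6, n2]
    · intro x y h g1 g2 h1 h2 h3 h4 e
      rw [e]
      have f := T.face h
      rw [n7]
      · exact f
      · rintro ⟨q1, q2⟩; rw [q1, q2, hb] at f; exact h3 ⟨q2, f.symm⟩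
      · rintro ⟨q1, q2⟩; rw [q1, q2, e4] at f; exact h4 ⟨q2, f.symm⟩
      · rintro ⟨q1, q2⟩; rw [q1, q2, e2] at f; exact g2 ⟨q2, f.symm⟩
      · rintro ⟨q1, q2⟩; apply nca; rw [← q1, ← q2]; exact T.nx_adj h
      · rintro ⟨q1, q2⟩; rw [q1, q2, e3] at f; exact g1 ⟨q2, f.symm⟩
      · rintro ⟨q1, q2⟩; apply nac; rw [← q1, ← q2]; exact T.nx_adj h
  refine ⟨⟨adj', sy, ?_, nx', fun h => Hadj _ _ h, fun h => Hface _ _ h, ?_, ?_, ?_⟩, ?_, ?_⟩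
  · rintro x (⟨h, _⟩ | ⟨h1, h2⟩ | ⟨h1, h2⟩)
    · exact T.irrefl x h
    · exact hac (h1.symm.trans h2)
    · exact hac (h2.symm.trans h1)
  · intro v u p hvu hu hp x hx
    by_cases vw : v = w
    · subst vw
      have h1 : ∀ y, adj' v y ↔ T.adj v y ∧ y ≠ b := by
        intro y; simp [adj', nwa, nwc, nwb]
      have := T.trans v u (fun y => (y ≠ b → p y) ∧ (y = b → p c)) ((h1 u).1 hvu).1
        ⟨fun _ => hu, fun h => (((h1 u).1 hvu).2 h).elim⟩ (by
          intro y hy ⟨py1, py2⟩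
          by_cases yb : y = b
          · subst yb; rw [hc]
            exact ⟨fun _ => py2 rfl, fun _ => py2 rfl⟩
          · have h := hp y ((h1 y).2 ⟨hy, yb⟩) (py1 yb)
            by_cases ya : y = a
            · subst ya; rw [n1] at h; rw [hb]; exact ⟨fun h => (h rfl).elim, fun _ => h⟩
            · rw [n7 v y (by simp [ya]) (by simp [nwb]) (by simp [nwa]) (by simp [nwa]) (by simp [nwc]) (by simp [nwc])] at h
              exact ⟨fun _ => h, fun e => (ya (nx_inj hy wa (e.trans hb.symm))).elim⟩) x ((h1 x).1 hx).1
      exact this.1 ((h1 x).1 hx).2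
    by_cases vb : v = b
    · subst vb
      have h1 : ∀ y, adj' v y ↔ T.adj v y ∧ y ≠ w := by
        intro y; simp [adj', nwb.symm, nab.symm, nbc]
      have := T.trans v u (fun y => (y ≠ w → p y) ∧ (y = w → p a)) ((h1 u).1 hvu).1
        ⟨fun _ => hu, fun h => (((h1 u).1 hvu).2 h).elim⟩ (by
          intro y hy ⟨py1, py2⟩
          by_cases yb : y = w
          · subst yb; rw [e1]
            exact ⟨fun _ => py2 rfl, fun _ => py2 rfl⟩
          · have h := hp y ((h1 y).2 ⟨hy, yb⟩) (py1 yb)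
            by_cases ya : y = c
            · subst ya; rw [n2] at h; rw [e4]; exact ⟨fun h => (h rfl).elim, fun _ => h⟩
            · rw [n7 v y (by simp [nwb.symm]) (by simp [ya]) (by simp [nab.symm]) (by simp [nab.symm]) (by simp [nbc]) (by simp [nbc])] at h
              exact ⟨fun _ => h, fun e => (ya (nx_inj hy bc (e.trans e4.symm))).elim⟩) x ((h1 x).1 hx).1
      exact this.1 ((h1 x).1 hx).2
    by_cases va : v = a
    · subst va
      have h1 : ∀ y, adj' v y ↔ T.adj v y ∨ y = c := by
        intro y; simp [adj', nwa.symm, nab, hac]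
      have stp : ∀ y, T.adj v y → p y → p (T.nx v y) := by
        intro y hy py
        have h := hp y ((h1 y).2 (Or.inl hy)) py
        by_cases yb : y = b
        · subst yb; rw [n3] at h; rw [e2, ← n4]; exact hp c ((h1 c).2 (Or.inr rfl)) h
        · have yc : y ≠ c := by rintro rfl; exact nac hy
          rwa [n7 v y (by simp [nwa.symm]) (by simp [nab]) (by simp [yb]) (by simp [yc]) (by simp [hac]) (by simp [hac])] at h
      have start : ∃ u', T.adj v u' ∧ p u' := by
        rcases (h1 u).1 hvu with h | h
        · exact ⟨u, h, hu⟩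
        · subst h; refine ⟨w, T.symm wa, ?_⟩
          rw [← n4]; exact hp u hvu hu
      obtain ⟨u', hu', pu'⟩ := start
      have all := T.trans v u' p hu' pu' stp
      rcases (h1 x).1 hx with h | h
      · exact all x h
      · rw [h, ← n3]; exact hp b A3 (all b ab)
    by_cases vc : v = c
    · subst vc
      have h1 : ∀ y, adj' v y ↔ T.adj v y ∨ y = a := by
        intro y; simp [adj', nwc.symm, nbc.symm, hac.symm]
      have stp : ∀ y, T.adj v y → p y → p (T.nx v y) := by
        intro y hy py
        have h := hp y ((h1 y).2 (Or.inl hy)) py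
        by_cases yb : y = w
        · subst yb; rw [n5] at h; rw [e3, ← n6]; exact hp a ((h1 a).2 (Or.inr rfl)) h
        · have yc : y ≠ a := by rintro rfl; exact nca hy
          rwa [n7 v y (by simp [nwc.symm]) (by simp [nbc.symm]) (by simp [hac.symm]) (by simp [hac.symm]) (by simp [yb]) (by simp [yc])] at h
      have start : ∃ u', T.adj v u' ∧ p u' := by
        rcases (h1 u).1 hvu with h | h
        · exact ⟨u, h, hu⟩
        · subst h; refine ⟨b, T.symm bc, ?_⟩
          rw [← n6]; exact hp u hvu hu
      obtain ⟨u', hu', pu'⟩ := start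
      have all := T.trans v u' p hu' pu' stp
      rcases (h1 x).1 hx with h | h
      · exact all x h
      · rw [h, ← n5]; exact hp w (sy A2) (all w (T.symm wc))
    · have h1 : ∀ y, adj' v y ↔ T.adj v y := by
        intro y; simp [adj', vw, vb, va, vc]
      refine T.trans v u p ((h1 u).1 hvu) hu ?_ x ((h1 x).1 hx)
      intro y hy py
      have h := hp y ((h1 y).2 hy) py
      rwa [n7 v y (by simp [vw]) (by simp [vb]) (by simp [va]) (by simp [va]) (by simp [vc]) (by simp [vc])] at h
  · intro p x0 hx0 hp
    refine T.conn p x0 hx0 ?_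
    intro x y hxy px
    by_cases q1 : x = w ∧ y = b
    · rw [q1.1] at px; rw [q1.2]
      exact hp a b A3 (hp w a A1 px)
    by_cases q2 : x = b ∧ y = w
    · rw [q2.1] at px; rw [q2.2]
      exact hp a w (sy A1) (hp b a (sy A3) px)
    · exact hp x y (Or.inl ⟨hxy, q1, q2⟩) px
  · rw [← T.euler, sum_card_rel, sum_card_rel]
    congr 1
    trans (((univ.filter fun p : V × V => T.adj p.1 p.2) \ {(w, b), (b, w)}) ∪ {(a, c), (c, a)}).card
    · congr 1
      ext ⟨x, y⟩
      simp only [adj', mem_filter, mem_univ, true_and, mem_union, mem_sdiff, mem_insert, mem_singleton, Prod.mk.injEq, not_or]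
    rw [card_union_of_disjoint, card_sdiff_of_subset, card_pair, card_pair]
    · have : 2 ≤ (univ.filter fun p : V × V => T.adj p.1 p.2).card := by
        rw [← card_pair (show (w, b) ≠ (b, w) by simp [nwb])]
        apply card_le_card
        intro p hp
        simp only [mem_insert, mem_singleton] at hp
        rcases hp with rfl | rfl
        · simpa using wb
        · simpa using T.symm wb
      omega
    · simp [hac]
    · simp [nwb]
    · intro p hp
      simp only [mem_insert, mem_singleton] at hp
      rcases hp with rfl | rfl
      · simpa using wb
      · simpa using T.symm wb
    · rw [disjoint_right]
      intro p hp
      simp only [mem_insert, mem_singleton] at hp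
      rcases hp with rfl | rfl
      · simp [nac]
      · simp [nca]
  · ext y
    simp [N, adj', nwa, nwc, nwb, and_comm]
  · intro x y hx hy h
    exact Or.inl ⟨h, by simp [hx], by simp [hy]⟩

lemma cross {w u : V} (hu : T.adj w u) {i j k l : ℕ} (hij : i < j) (hjk : j < k) (hkl : k < l)
    (hl : l < T.d w) (h0 : T.adj (T.r w u i) (T.r w u k)) (h1 : T.adj (T.r w u j) (T.r w u l)) :
    False := by
  refine Sep hu hij hjk hkl hl
    (A := {T.r w u i, T.r w u k}) (B := {T.r w u j, T.r w u l}) ?_ ?_ ?_ (by simp) (by simp) ?_ ?_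
  · simp only [Set.mem_insert_iff, Set.mem_singleton_iff, not_or]
    exact ⟨ne (r_adj hu _), ne (r_adj hu _)⟩
  · simp only [Set.mem_insert_iff, Set.mem_singleton_iff, not_or]
    exact ⟨ne (r_adj hu _), ne (r_adj hu _)⟩
  · rw [Set.disjoint_left]
    intro x hx hx'
    simp only [Set.mem_insert_iff, Set.mem_singleton_iff] at hx hx'
    have key : ∀ i j, i < T.d w → j < T.d w → i ≠ j → T.r w u i ≠ T.r w u j := fun i j hi hj hij e =>
      hij (r_inj hu (by omega) (by omega) e)
    rcases hx with hx | hx <;> rcases hx' with hx' | hx' <;> rw [hx] at hx' <;> revert hx' <;>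
      apply key <;> omega
  · exact Relation.ReflTransGen.single ⟨h0, by simp, by simp⟩
  · exact Relation.ReflTransGen.single ⟨h1, by simp, by simp⟩

lemma exists_flip {w : V} (hd : 4 ≤ T.d w) : ∃ T' : Tri V, T'.d w + 1 = T.d w ∧
      ∀ x y, x ≠ w → y ≠ w → T.adj x y → T'.adj x y := by
  have : (T.N w).Nonempty := card_pos.1 (by change 0 < T.d w; omega)
  obtain ⟨u, hu⟩ := this
  rw [mem_N] at hu
  have key : ∀ i, i + 2 < T.d w → ¬ T.adj (T.r w u i) (T.r w u (i+2)) → ∃ T' : Tri V, T'.d w + 1 = T.d w ∧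
      ∀ x y, x ≠ w → y ≠ w → T.adj x y → T'.adj x y := by
    intro i hi hn
    obtain ⟨T', h1, h2⟩ := flip (r_adj hu i) (r_succ w u i).symm (r_succ w u (i+1)).symm
      (fun e => by have := r_inj hu (by omega) (by omega) e; omega) hn
    refine ⟨T', ?_, h2⟩
    rw [d, d, h1]
    exact card_erase_add_one (mem_N.2 (r_adj hu _))
  by_cases h0 : T.adj (T.r w u 0) (T.r w u 2)
  · by_cases h1 : T.adj (T.r w u 1) (T.r w u 3)
    · exact (cross hu (i := 0) (j := 1) (k := 2) (l := 3) (by omega) (by omega) (by omega) (by omega) h0 h1).elim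
    · exact key 1 (by omega) h1
  · exact key 0 (by omega) h0

/-- the coloring goal on a subset -/
def Good (T : Tri V) (U : Finset V) : Prop :=
  ∃ c, T.PropOn U c ∧ 6 * (U.filter (fun v => c v = 4)).card ≤ U.card

/-- minimal counterexample -/
structure MinCE (T : Tri V) : Prop where
  five : 5 ≤ Fintype.card V
  bad : ¬ T.Good univ
  min : ∀ U : Finset V, U.card < Fintype.card V → T.Good U

lemma good_of_card_le {U : Finset V} (h : U.card ≤ 4) : T.Good U := by
  have e := U.equivFin
  let c : V → Fin 5 := fun v => if h' : v ∈ U then (Fin.castLE (by omega) (e ⟨v, h'⟩) : Fin 4).castSucc else 0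
  refine ⟨c, ?_, ?_⟩
  · intro x hx y hy hxy h'
    simp only [c, dif_pos hx, dif_pos hy] at h'
    have := e.injective (Fin.castLE_injective _ (Fin.castSucc_injective _ h'))
    exact ne hxy (congrArg Subtype.val this)
  · rw [filter_false_of_mem]
    · simp
    · intro v hv h'
      simp only [c, dif_pos hv] at h'
      have h1 := congrArg Fin.val h'
      have := (e ⟨v, hv⟩).2
      simp at h1; omega

theorem all_good (no : ∀ (V : Type) [Fintype V] (T : Tri V), ¬ T.MinCE) :
    ∀ (n : ℕ) (V : Type) [Fintype V] (T : Tri V) (U : Finset V), U.card = n → T.Good U := by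
  intro n
  induction n using Nat.strong_induction_on with
  | _ n IH =>
  have : ∀ (m : ℕ) (V : Type) [Fintype V] (T : Tri V) (U : Finset V), Fintype.card V = m → U.card = n → T.Good U := by
    intro m
    induction m with
    | zero =>
      intro V _ T U hV hU
      apply good_of_card_le
      have := card_le_univ U; omega
    | succ m IHm =>
      intro V _ T U hV hU
      by_cases h4 : U.card ≤ 4
      · exact good_of_card_le h4
      by_cases hUV : U = univ
      · subst hUV
        by_contra hbad
        rw [card_univ] at hU h4
        exact no V T ⟨by omega, hbad, fun U' hU' => IH U'.card (by omega) V T U' rfl⟩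
      · obtain ⟨w, hw⟩ : ∃ w, w ∉ U := by
          by_contra hn; push Not at hn; exact hUV (eq_univ_iff_forall.2 hn)
        have hlt : U.card < Fintype.card V := by
          rw [← card_univ]; exact card_lt_card ((ssubset_univ_iff).2 hUV)
        have inner : ∀ k, ∀ T : Tri V, T.d w = k + 3 → T.Good U := by
          intro k
          induction k with
          | zero =>
            intro T hd
            obtain ⟨T', hT'⟩ := delete hd
            have hcard : Fintype.card {x // x ≠ w} = m := by
              rw [Fintype.card_subtype_compl, Fintype.card_subtype_eq]; omega
            have hU' : (U.subtype (fun x => x ≠ w)).card = U.card := by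
              rw [card_subtype, filter_true_of_mem]
              rintro x hx rfl; exact hw hx
            obtain ⟨c, hc, hn⟩ := IHm {x // x ≠ w} T' (U.subtype (fun x => x ≠ w)) hcard (hU'.trans hU)
            let c' : V → Fin 5 := fun x => if h : x ≠ w then c ⟨x, h⟩ else 0
            have hc' : ∀ x (h : x ≠ w), c' x = c ⟨x, h⟩ := fun x h => by simp only [c', dif_pos h]
            have hne : ∀ x ∈ U, x ≠ w := by rintro x hx rfl; exact hw hx
            refine ⟨c', ?_, ?_⟩
            · intro x hx y hy hxy
              rw [hc' x (hne x hx), hc' y (hne y hy)]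
              apply hc _ (by simpa using hx) _ (by simpa using hy)
              rw [hT']; exact hxy
            · rw [hU'] at hn
              refine le_trans (Nat.mul_le_mul_left _ ?_) hn
              rw [← card_map (Embedding.subtype _)]
              apply card_le_card
              intro x hx
              rw [mem_filter] at hx
              have h := hne x hx.1
              rw [mem_map]
              refine ⟨⟨x, h⟩, ?_, rfl⟩
              rw [mem_filter, mem_subtype, ← hc' x h]
              exact hx
          | succ k ih =>
            intro T hd
            obtain ⟨T', h1, h2⟩ := exists_flip (T := T) (w := w) (by omega)
            obtain ⟨c, hc, hn⟩ := ih T' (by omega)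
            refine ⟨c, ?_, hn⟩
            intro x hx y hy hxy
            apply hc x hx y hy
            apply h2 _ _ _ _ hxy
            · rintro rfl; exact hw hx
            · rintro rfl; exact hw hy
        have h3 := d_ge3 (T := T) (by omega) w
        exact inner (T.d w - 3) T (by omega)
  intro V _ T U hU
  exact this _ V T U rfl hU
end Tri
end FC


namespace FC
open Finset Function
open scoped Classical
namespace Tri
variable {V : Type} [Fintype V] {T : Tri V}

/-- vertices that can be coloured last once the vertices in `Z` carry the special colour -/
inductive Gone (T : Tri V) (Z : Finset V) : V → Prop
  | base (v : V) (h : v ∈ Z) : Gone T Z v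
  | step (v : V) (A : Finset V) (h1 : ∀ a ∈ A, T.adj v a) (h2 : ∀ a ∈ A, Gone T Z a)
      (h3 : T.d v ≤ 4 + A.card) : Gone T Z v

/-- independent -/
def Ind (T : Tri V) (X : Finset V) : Prop := ∀ x ∈ X, ∀ y ∈ X, ¬ T.adj x y

lemma Gone.trans {Z Z' : Finset V} {v : V} (h : T.Gone Z v) (hz : ∀ z ∈ Z, T.Gone Z' z) :
    T.Gone Z' v := by
  induction h with
  | base v h => exact hz v h
  | step v A h1 _ h3 ih => exact Gone.step v A h1 ih h3

lemma Gone.mono {Z Z' : Finset V} {v : V} (h : T.Gone Z v) (hz : Z ⊆ Z') : T.Gone Z' v :=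
  h.trans fun z hz' => Gone.base z (hz hz')

lemma Ind.subset {X Y : Finset V} (h : T.Ind Y) (hs : X ⊆ Y) : T.Ind X :=
  fun x hx y hy => h x (hs hx) y (hs hy)

lemma recolor {Z : Finset V} (hZ : T.Ind Z) {c : V → Fin 5}
    (hc : ∀ x y, ¬ T.Gone Z x → ¬ T.Gone Z y → T.adj x y → c x ≠ c y)
    (hc4 : ∀ x, ¬ T.Gone Z x → c x ≠ 4) :
    ∃ c', T.PropOn univ c' ∧ ∀ x, c' x = 4 ↔ x ∈ Z := by
  let P : Finset V → Prop := fun M => Z ⊆ M ∧ ∀ c, T.PropOn (Mᶜ ∪ Z) c → (∀ x ∈ Mᶜ ∪ Z, (c x = 4 ↔ x ∈ Z)) →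
    ∃ c', T.PropOn univ c' ∧ ∀ x, c' x = 4 ↔ x ∈ Z
  have PZ : P Z := by
    refine ⟨Subset.refl _, fun c h1 h2 => ⟨c, ?_, ?_⟩⟩
    · intro x _ y _
      exact h1 x (by simp [em']) y (by simp [em'])
    · intro x; exact h2 x (by simp [em'])
  obtain ⟨M, hM, hmax⟩ := exists_max_image (univ.filter P) card ⟨Z, by simpa using PZ⟩
  simp only [mem_filter, mem_univ, true_and] at hM hmax
  have all : ∀ v, T.Gone Z v → v ∈ M := by
    intro v h
    induction h with
    | base v h => exact hM.1 h
    | step v A h1 _ h3 ih =>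
      by_contra hv
      have : P (insert v M) := by
        refine ⟨hM.1.trans (subset_insert _ _), fun c g1 g2 => ?_⟩
        have hvZ : v ∉ Z := fun h => hv (hM.1 h)
        have hvU : v ∉ (insert v M)ᶜ ∪ Z := by simp [hvZ]
        have heq : insert v ((insert v M)ᶜ ∪ Z) = Mᶜ ∪ Z := by
          ext x; by_cases hx : x = v <;> simp [hx, hv]
        obtain ⟨c', k1, k2, k3⟩ := insert_col hvU g1 (by
          have : (T.N v).filter (fun u => u ∈ (insert v M)ᶜ ∪ Z ∧ c u ≠ 4) ⊆ T.N v \ A := by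
            intro x hx
            simp only [mem_filter] at hx
            rw [mem_sdiff]
            refine ⟨hx.1, fun hxA => ?_⟩
            have hxM := ih x hxA
            have hxZ : x ∈ Z := by
              have := hx.2.1
              simp only [mem_union, mem_compl, mem_insert, not_or] at this
              exact this.resolve_left (fun h => h.2 hxM)
            exact hx.2.2 ((g2 x hx.2.1).2 hxZ)
          have h4 := card_le_card this
          rw [card_sdiff_of_subset (fun a ha => mem_N.2 (h1 a ha))] at h4
          change _ ≤ T.d v - _ at h4
          omega)
        rw [heq] at k1
        refine hM.2 c' k1 ?_
        intro x hx
        rw [← heq, mem_insert] at hx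
        rcases hx with rfl | hx
        · exact ⟨fun h => (k3 h).elim, fun h => (hvZ h).elim⟩
        · rw [k2 x hx, g2 x hx]
      have := hmax _ this
      rw [card_insert_of_notMem hv] at this
      omega
  have hnM : ∀ x, x ∉ M → ¬ T.Gone Z x := fun x hx h => hx (all x h)
  refine hM.2 (fun x => if x ∈ Z then 4 else c x) ?_ ?_
  · intro x hx y hy hxy
    rw [mem_union, mem_compl] at hx hy
    by_cases xZ : x ∈ Z <;> by_cases yZ : y ∈ Z
    · exact (hZ x xZ y yZ hxy).elim
    · simp only [if_pos xZ, if_neg yZ]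
      exact (hc4 y (hnM y (hy.resolve_right yZ))).symm
    · simp only [if_neg xZ, if_pos yZ]
      exact hc4 x (hnM x (hx.resolve_right xZ))
    · simp only [if_neg xZ, if_neg yZ]
      exact hc x y (hnM x (hx.resolve_right xZ)) (hnM y (hy.resolve_right yZ)) hxy
  · intro x hx
    rw [mem_union, mem_compl] at hx
    by_cases xZ : x ∈ Z
    · simp [xZ]
    · simp only [if_neg xZ, xZ, iff_false]
      exact hc4 x (hnM x (hx.resolve_right xZ))

namespace MinCE
variable (hM : T.MinCE)
include hM

lemma red {S : Finset V} (hS : S.Nonempty) {k : ℕ} (hk : 6 * k ≤ S.card)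
    (h : ∀ X, T.Ind X → Disjoint X S → ∃ Q ⊆ S, Q.card ≤ k ∧ T.Ind (X ∪ Q) ∧ ∀ s ∈ S, T.Gone (X ∪ Q) s) :
    False := by
  have hSc := card_compl_add_card S
  have hSp := hS.card_pos
  obtain ⟨c, hc, hn⟩ := hM.min Sᶜ (by omega)
  have hX : T.Ind (Sᶜ.filter (fun v => c v = 4)) := by
    intro x hx y hy hxy
    rw [mem_filter] at hx hy
    exact hc x hx.1 y hy.1 hxy (hx.2.trans hy.2.symm)
  have hd : Disjoint (Sᶜ.filter (fun v => c v = 4)) S := by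
    rw [Finset.disjoint_left]
    intro x hx
    rw [mem_filter, mem_compl] at hx
    exact hx.1
  obtain ⟨Q, hQS, hQk, hI, hG⟩ := h _ hX hd
  have nS : ∀ x, ¬ T.Gone (Sᶜ.filter (fun v => c v = 4) ∪ Q) x → x ∈ Sᶜ := by
    intro x hx; rw [mem_compl]; exact fun h => hx (hG x h)
  obtain ⟨c', h1, h2⟩ := recolor hI (c := c) (fun x y hx hy hxy => hc x (nS x hx) y (nS y hy) hxy)
    (fun x hx e => hx (Gone.base x (by rw [mem_union, mem_filter]; exact Or.inl ⟨nS x hx, e⟩)))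
  refine hM.bad ⟨c', h1, ?_⟩
  have : univ.filter (fun v => c' v = 4) = Sᶜ.filter (fun v => c v = 4) ∪ Q := by
    ext x; rw [mem_filter, h2]; simp
  rw [this, card_univ]
  have := card_union_le (Sᶜ.filter (fun v => c v = 4)) Q
  omega

lemma d5 (v : V) : 5 ≤ T.d v := by
  by_contra hv
  refine hM.red (S := {v}) (by simp) (k := 0) (by simp) ?_
  intro X hX _
  refine ⟨∅, by simp, by simp, by simpa using hX, ?_⟩
  intro s hs
  rw [mem_singleton] at hs
  subst hs
  exact Gone.step s ∅ (by simp) (by simp) (by simp; omega)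
end MinCE

/-- one special colour suffices to make all of `P` colourable at the end -/
def Elim (T : Tri V) (P : Finset V) : Prop :=
  ∀ X, T.Ind X → Disjoint X P → ∃ Q ⊆ P, Q.card ≤ 1 ∧ T.Ind (X ∪ Q) ∧ ∀ s ∈ P, T.Gone (X ∪ Q) s

lemma MinCE.elim5 (hM : T.MinCE) {P : Finset V} (h : T.Elim P) : P.card ≤ 5 := by
  by_contra hP
  exact hM.red (S := P) (card_pos.1 (by omega)) (k := 1) (by omega) h

/-- number of neighbours in a set -/
noncomputable def nb (T : Tri V) (w : V) (P : Finset V) : ℕ := ((T.N w) ∩ P).card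

lemma nb_ge {w : V} {P A : Finset V} (h1 : A ⊆ P) (h2 : ∀ a ∈ A, T.adj w a) : A.card ≤ T.nb w P :=
  card_le_card fun a ha => mem_inter.2 ⟨mem_N.2 (h2 a ha), h1 ha⟩

lemma nb_mono {w : V} {P Q : Finset V} (h : P ⊆ Q) : T.nb w P ≤ T.nb w Q :=
  card_le_card (inter_subset_inter_left h)

lemma gone_nb {w : V} {Z P : Finset V} (hP : ∀ p ∈ P, T.Gone Z p) (h : T.d w ≤ 4 + T.nb w P) : T.Gone Z w :=
  Gone.step w (T.N w ∩ P) (fun a ha => mem_N.1 (mem_inter.1 ha).1) (fun a ha => hP a (mem_inter.1 ha).2) h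

lemma elim_single {v : V} (h : T.d v ≤ 5) : T.Elim {v} := by
  intro X hX hd
  by_cases hx : ∃ x ∈ X, T.adj v x
  · obtain ⟨x, hx, hvx⟩ := hx
    refine ⟨∅, by simp, by simp, by simpa using hX, ?_⟩
    intro s hs
    rw [mem_singleton] at hs; subst hs
    exact Gone.step s {x} (by simpa using hvx) (by simpa using Gone.base x hx) (by simpa using h)
  · push Not at hx
    refine ⟨{v}, by simp, by simp, ?_, fun s hs => Gone.base s (mem_union_right _ hs)⟩
    intro x h1 y h2 hxy
    rw [mem_union, mem_singleton] at h1 h2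
    rcases h1 with h1 | rfl
    · rcases h2 with h2 | rfl
      · exact hX x h1 y h2 hxy
      · exact hx x h1 (T.symm hxy)
    · rcases h2 with h2 | rfl
      · exact hx y h2 hxy
      · exact T.irrefl _ hxy

lemma Elim.ext {P P' : Finset V} (h : T.Elim P) (hs : P ⊆ P') (hg : ∀ p ∈ P', T.Gone P p) : T.Elim P' := by
  intro X hX hd
  obtain ⟨Q, h1, h2, h3, h4⟩ := h X hX (disjoint_of_subset_right hs hd)
  exact ⟨Q, h1.trans hs, h2, h3, fun s hs' => (hg s hs').trans h4⟩

lemma Elim.insert {P : Finset V} (h : T.Elim P) {w : V} (hw : T.d w ≤ 4 + T.nb w P) : T.Elim (insert w P) := by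
  refine h.ext (subset_insert _ _) ?_
  intro p hp
  rw [mem_insert] at hp
  rcases hp with rfl | hp
  · exact gone_nb (fun p hp => Gone.base p hp) hw
  · exact Gone.base p hp

lemma Elim.insert' {P : Finset V} (h : T.Elim P) {w : V} (hwP : w ∉ P) (hw : T.d w ≤ 5 + T.nb w P)
    (hg : ∀ p ∈ P, T.Gone {w} p) : T.Elim (Insert.insert w P) := by
  intro X hX hd
  by_cases hx : ∃ x ∈ X, T.adj w x
  · obtain ⟨x, hx, hwx⟩ := hx
    obtain ⟨Q, h1, h2, h3, h4⟩ := h X hX (disjoint_of_subset_right (subset_insert _ _) hd)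
    refine ⟨Q, h1.trans (subset_insert _ _), h2, h3, ?_⟩
    intro s hs
    rw [mem_insert] at hs
    rcases hs with rfl | hs
    · have hxP : x ∉ P := fun hxP => Finset.disjoint_left.1 hd hx (mem_insert_of_mem hxP)
      refine Gone.step s (Insert.insert x (T.N s ∩ P)) ?_ ?_ ?_
      · intro a ha
        rw [mem_insert] at ha
        rcases ha with rfl | ha
        · exact hwx
        · exact mem_N.1 (mem_inter.1 ha).1
      · intro a ha
        rw [mem_insert] at ha
        rcases ha with rfl | ha
        · exact Gone.base _ (mem_union_left _ hx)
        · exact h4 a (mem_inter.1 ha).2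
      · rw [card_insert_of_notMem (by simp [hxP])]
        change _ ≤ 4 + (T.nb s P + 1)
        omega
    · exact h4 s hs
  · push Not at hx
    refine ⟨{w}, by simp, by simp, ?_, ?_⟩
    · intro x h1 y h2 hxy
      rw [mem_union, mem_singleton] at h1 h2
      rcases h1 with h1 | rfl
      · rcases h2 with h2 | rfl
        · exact hX x h1 y h2 hxy
        · exact hx x h1 (T.symm hxy)
      · rcases h2 with h2 | rfl
        · exact hx y h2 hxy
        · exact T.irrefl _ hxy
    · intro s hs
      rw [mem_insert] at hs
      rcases hs with rfl | hs
      · exact Gone.base _ (by simp)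
      · exact (hg s hs).mono subset_union_right

lemma MinCE.be (hM : T.MinCE) {S : Finset V} {z : V} (hz : z ∈ S) (hS : ∀ s ∈ S, T.Gone {z} s)
    (h6 : 6 ≤ S.card) (h : ∀ B, T.adj z B → B ∉ S → ∃ P ⊆ S, T.Elim P ∧ T.Gone (Insert.insert B P) z) :
    False := by
  refine hM.red (S := S) ⟨z, hz⟩ (k := 1) (by omega) ?_
  intro X hX hd
  by_cases hx : ∃ x ∈ X, T.adj z x
  · obtain ⟨B, hB, hzB⟩ := hx
    have hBS : B ∉ S := Finset.disjoint_left.1 hd hB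
    obtain ⟨P, hPS, hP, hg⟩ := h B hzB hBS
    obtain ⟨Q, h1, h2, h3, h4⟩ := hP X hX (disjoint_of_subset_right hPS hd)
    refine ⟨Q, h1.trans hPS, h2, h3, ?_⟩
    have gz : T.Gone (X ∪ Q) z := by
      refine hg.trans ?_
      intro y hy
      rw [mem_insert] at hy
      rcases hy with rfl | hy
      · exact Gone.base _ (mem_union_left _ hB)
      · exact h4 y hy
    intro s hs
    refine (hS s hs).trans ?_
    intro y hy
    rw [mem_singleton] at hy
    rw [hy]; exact gz
  · push Not at hx
    refine ⟨{z}, by simpa using hz, by simp, ?_, fun s hs => (hS s hs).mono subset_union_right⟩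
    intro x h1 y h2 hxy
    rw [mem_union, mem_singleton] at h1 h2
    rcases h1 with h1 | rfl
    · rcases h2 with h2 | rfl
      · exact hX x h1 y h2 hxy
      · exact hx x h1 (T.symm hxy)
    · rcases h2 with h2 | rfl
      · exact hx y h2 hxy
      · exact T.irrefl _ hxy
/-- closure of a full eliminable set -/
lemma MinCE.clo (hM : T.MinCE) {P : Finset V} (h : T.Elim P) (h5 : 5 ≤ P.card) {w : V} (hw : w ∉ P) :
    5 + T.nb w P ≤ T.d w := by
  by_contra hn
  have := hM.elim5 (h.insert (w := w) (by omega))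
  rw [card_insert_of_notMem hw] at this
  omega

lemma MinCE.clo' (hM : T.MinCE) {P : Finset V} (h : T.Elim P) (h5 : 5 ≤ P.card) {w : V} (hw : w ∉ P)
    (hg : ∀ p ∈ P, T.Gone {w} p) : 6 + T.nb w P ≤ T.d w := by
  by_contra hn
  have := hM.elim5 (h.insert' (w := w) hw (by omega) hg)
  rw [card_insert_of_notMem hw] at this
  omega
end Tri
end FC


namespace FC
open Finset Function
open scoped Classical
namespace Tri
variable {V : Type} [Fintype V] {T : Tri V}

/-- unoriented faces -/
def F (T : Tri V) (v a b : V) : Prop := T.adj v a ∧ T.adj v b ∧ (T.nx v a = b ∨ T.nx v b = a)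

lemma F.sw {v a b : V} (h : T.F v a b) : T.F v b a := ⟨h.2.1, h.1, h.2.2.symm⟩
lemma F.rot {v a b : V} (h : T.F v a b) : T.F a b v := by
  obtain ⟨h1, h2, h3 | h3⟩ := h
  · subst h3
    exact ⟨adj_nx h1, T.symm h1, Or.inl (nx2 h1)⟩
  · subst h3
    exact ⟨T.symm (adj_nx h2), T.symm h1, Or.inr (nx1 h2)⟩
lemma F.rot2 {v a b : V} (h : T.F v a b) : T.F b v a := h.rot.rot
lemma F.sw2 {v a b : V} (h : T.F v a b) : T.F a v b := h.rot.sw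
lemma F.sw3 {v a b : V} (h : T.F v a b) : T.F b a v := h.rot2.sw
lemma F.bc {v a b : V} (h : T.F v a b) : T.adj a b := h.rot.1
lemma F_nx {v a : V} (h : T.adj v a) : T.F v a (T.nx v a) := ⟨h, T.nx_adj h, Or.inl rfl⟩
lemma F_pv {v a : V} (h : T.adj v a) : T.F v a (T.nx a v) := ⟨h, adj_pv h, Or.inr (nx_pv h)⟩
lemma F.cases {v a b : V} (h : T.F v a b) : b = T.nx v a ∨ b = T.nx a v := by
  obtain ⟨h1, h2, h3 | h3⟩ := h
  · exact Or.inl h3.symm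
  · right; rw [← h3, nx1 h2]
lemma F.three {v a b c d : V} (h : T.F v a b) (h' : T.F v a c) (hn : b ≠ c) (h'' : T.F v a d) :
    d = b ∨ d = c := by
  rcases h.cases with h | h <;> rcases h'.cases with h' | h' <;> rcases h''.cases with h'' | h'' <;>
    simp_all
lemma F_r {v u : V} (h : T.adj v u) (k : ℕ) : T.F v (T.r v u k) (T.r v u (k+1)) := by
  rw [r_succ]; exact F_nx (r_adj h k)

lemma clos {z : V} {S : Finset V} {s : V} (hs : s ∈ S) (hz : T.adj z s)
    (h : ∀ s ∈ S, ∃ p ∈ S, ∃ q ∈ S, p ≠ q ∧ T.F z s p ∧ T.F z s q) : T.d z ≤ S.card := by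
  apply card_le_card
  intro x hx
  refine T.trans z s (· ∈ S) hz hs ?_ x (mem_N.1 hx)
  intro y hy hyS
  obtain ⟨p, hp, q, hq, hpq, h1, h2⟩ := h y hyS
  rcases h1.three h2 hpq (F_nx hy) with h | h
  · simpa only [h] using hp
  · simpa only [h] using hq

lemma clos3 {z a b c : V} (h1 : T.F z a b) (h2 : T.F z b c) (h3 : T.F z c a) : T.d z ≤ 3 := by
  refine (clos (S := {a, b, c}) (s := a) (by simp) h1.1 ?_).trans card_le_three
  intro s hs
  simp only [mem_insert, mem_singleton] at hs
  rcases hs with rfl | rfl | rfl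
  · exact ⟨b, by simp, c, by simp, ne h2.bc, h1, h3.sw⟩
  · exact ⟨a, by simp, c, by simp, (ne h3.bc).symm, h1.sw, h2⟩
  · exact ⟨b, by simp, a, by simp, (ne h1.bc).symm, h2.sw, h3⟩

lemma clos4 {z a b c d : V} (h1 : T.F z a b) (h2 : T.F z b c) (h3 : T.F z c d) (h4 : T.F z d a)
    (hac : a ≠ c) (hbd : b ≠ d) : T.d z ≤ 4 := by
  refine (clos (S := {a, b, c, d}) (s := a) (by simp) h1.1 ?_).trans card_le_four
  intro s hs
  simp only [mem_insert, mem_singleton] at hs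
  rcases hs with rfl | rfl | rfl | rfl
  · exact ⟨b, by simp, d, by simp, hbd, h1, h4.sw⟩
  · exact ⟨a, by simp, c, by simp, hac, h1.sw, h2⟩
  · exact ⟨b, by simp, d, by simp, hbd, h2.sw, h3⟩
  · exact ⟨c, by simp, a, by simp, hac.symm, h3.sw, h4⟩

/-- link of a 5-vertex -/
structure L5 (T : Tri V) (v a b c d e : V) : Prop where
  dv : T.d v = 5
  f1 : T.F v a b
  f2 : T.F v b c
  f3 : T.F v c d
  f4 : T.F v d e
  f5 : T.F v e a
  nd : [v, a, b, c, d, e].Nodup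
  nb : ∀ x, T.adj v x → x = a ∨ x = b ∨ x = c ∨ x = d ∨ x = e
  x1 : T.adj a c → T.adj b d → False
  x2 : T.adj b d → T.adj c e → False
  x3 : T.adj c e → T.adj d a → False
  x4 : T.adj d a → T.adj e b → False
  x5 : T.adj e b → T.adj a c → False

lemma L5.rot {v a b c d e : V} (h : T.L5 v a b c d e) : T.L5 v b c d e a where
  dv := h.dv
  f1 := h.f2
  f2 := h.f3
  f3 := h.f4
  f4 := h.f5
  f5 := h.f1
  nd := by have := h.nd; simp at this ⊢; grind
  nb := by intro x hx; have := h.nb x hx; tauto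
  x1 := h.x2
  x2 := h.x3
  x3 := fun i j => h.x4 i j
  x4 := h.x5
  x5 := h.x1

lemma L5.refl {v a b c d e : V} (h : T.L5 v a b c d e) : T.L5 v a e d c b where
  dv := h.dv
  f1 := h.f5.sw
  f2 := h.f4.sw
  f3 := h.f3.sw
  f4 := h.f2.sw
  f5 := h.f1.sw
  nd := by have := h.nd; simp at this ⊢; grind
  nb := by intro x hx; have := h.nb x hx; tauto
  x1 := fun i j => h.x3 (T.symm j) (T.symm i)
  x2 := fun i j => h.x2 (T.symm j) (T.symm i)
  x3 := fun i j => h.x1 (T.symm j) (T.symm i)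
  x4 := fun i j => h.x5 (T.symm j) (T.symm i)
  x5 := fun i j => h.x4 (T.symm j) (T.symm i)

lemma exL5 {v u : V} (hv : T.d v = 5) (hu : T.adj v u) : ∃ b c d e, T.L5 v u b c d e := by
  have inj : ∀ i j, i < 5 → j < 5 → i ≠ j → T.r v u i ≠ T.r v u j := fun i j hi hj h e =>
    h (r_inj hu (by omega) (by omega) e)
  have cr := fun i j k l (hij : i < j) (hjk : j < k) (hkl : k < l) (hl : l < 5) =>
    cross hu hij hjk hkl (by omega)
  refine ⟨T.r v u 1, T.r v u 2, T.r v u 3, T.r v u 4, ?_⟩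
  have h5 : T.r v u 5 = u := by rw [← hv]; exact r_d hu
  have h0 : T.r v u 0 = u := rfl
  constructor
  · exact hv
  · exact F_r hu 0
  · exact F_r hu 1
  · exact F_r hu 2
  · exact F_r hu 3
  · have := F_r hu 4; rwa [h5] at this
  · have nv : ∀ i, v ≠ T.r v u i := fun i => ne (r_adj hu i)
    have a1 := inj 0 1 (by omega) (by omega) (by omega)
    have a2 := inj 0 2 (by omega) (by omega) (by omega)
    have a3 := inj 0 3 (by omega) (by omega) (by omega)
    have a4 := inj 0 4 (by omega) (by omega) (by omega)
    rw [h0] at a1 a2 a3 a4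
    simp [nv, ne hu, a1, a2, a3, a4, inj]
  · intro x hx
    obtain ⟨k, hk, rfl⟩ := r_lt hu hx
    rw [hv] at hk
    interval_cases k <;> simp
  · intro i j; exact cr 0 1 2 3 (by omega) (by omega) (by omega) (by omega) i j
  · intro i j; exact cr 1 2 3 4 (by omega) (by omega) (by omega) (by omega) i j
  · intro i j; exact cr 0 2 3 4 (by omega) (by omega) (by omega) (by omega) (T.symm j) i
  · intro i j; exact cr 0 1 3 4 (by omega) (by omega) (by omega) (by omega) (T.symm i) (T.symm j)
  · intro i j; exact cr 0 1 2 4 (by omega) (by omega) (by omega) (by omega) j (T.symm i)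

/-! Gone helpers -/
lemma g0 {v : V} : T.Gone {v} v := Gone.base v (by simp)
lemma g1 {Z : Finset V} {w p : V} (hw : T.d w ≤ 5) (hp : T.Gone Z p) (h : T.adj w p) : T.Gone Z w :=
  Gone.step w {p} (by simpa using h) (by simpa using hp) (by simpa using hw)
lemma g2 {Z : Finset V} {w p q : V} (hw : T.d w ≤ 6) (hp : T.Gone Z p) (hq : T.Gone Z q) (h : T.adj w p)
    (h' : T.adj w q) (n : p ≠ q) : T.Gone Z w :=
  Gone.step w {p, q} (by simp [h, h']) (by simp [hp, hq]) (by rw [card_pair n]; exact hw)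
lemma g3 {Z : Finset V} {w p q r : V} (hw : T.d w ≤ 7) (hp : T.Gone Z p) (hq : T.Gone Z q) (hr : T.Gone Z r)
    (h : T.adj w p) (h' : T.adj w q) (h'' : T.adj w r) (n : p ≠ q) (n' : p ≠ r) (n'' : q ≠ r) : T.Gone Z w :=
  Gone.step w {p, q, r} (by simp [h, h', h'']) (by simp [hp, hq, hr])
    (by rw [card_eq_three.2 ⟨p, q, r, n, n', n'', rfl⟩]; exact hw)

lemma nb1 {P : Finset V} {w p : V} (hp : p ∈ P) (h : T.adj w p) : 1 ≤ T.nb w P :=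
  nb_ge (A := {p}) (by simpa using hp) (by simpa using h)
lemma nb2 {P : Finset V} {w p q : V} (hp : p ∈ P) (hq : q ∈ P) (h : T.adj w p) (h' : T.adj w q)
    (n : p ≠ q) : 2 ≤ T.nb w P := by
  have := nb_ge (T := T) (w := w) (A := {p, q}) (P := P) (by simp [insert_subset_iff, hp, hq]) (by simp [h, h'])
  rwa [card_pair n] at this
lemma nb3 {P : Finset V} {w p q r : V} (hp : p ∈ P) (hq : q ∈ P) (hr : r ∈ P) (h : T.adj w p)
    (h' : T.adj w q) (h'' : T.adj w r) (n : p ≠ q) (n' : p ≠ r) (n'' : q ≠ r) : 3 ≤ T.nb w P := by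
  have := nb_ge (T := T) (w := w) (A := {p, q, r}) (P := P) (by simp [insert_subset_iff, hp, hq, hr])
    (by simp [h, h', h''])
  rwa [card_eq_three.2 ⟨p, q, r, n, n', n'', rfl⟩] at this

/-- absorbing -/
lemma MinCE.abs (hM : T.MinCE) {P : Finset V} (h : T.Elim P) (h5 : 5 ≤ P.card) {w : V} (hw : T.Gone P w) :
    w ∈ P := by
  by_contra hn
  have := hM.elim5 (h.ext (P' := Insert.insert w P) (subset_insert _ _) (by
    intro p hp; rw [mem_insert] at hp
    rcases hp with rfl | hp
    · exact hw
    · exact Gone.base _ hp))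
  rw [card_insert_of_notMem hn] at this
  omega

lemma card5 {v a b c d : V} (h : [v, a, b, c, d].Nodup) : ({v, a, b, c, d} : Finset V).card = 5 := by
  simpa using List.toFinset_card_of_nodup h
lemma card6 {v a b c d e : V} (h : [v, a, b, c, d, e].Nodup) : ({v, a, b, c, d, e} : Finset V).card = 6 := by
  simpa using List.toFinset_card_of_nodup h
end Tri
end FC


namespace FC
open Finset Function
open scoped Classical
namespace Tri
variable {V : Type} [Fintype V] {T : Tri V}

/-- closed neighbourhood of `v` without `y` -/
noncomputable def Qs (T : Tri V) (v y : V) : Finset V := insert v ((T.N v).erase y)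
lemma mem_Qs {v y x : V} : x ∈ T.Qs v y ↔ x = v ∨ (x ≠ y ∧ T.adj v x) := by simp [Qs]
lemma L5.Qs {v y p q r s : V} (L : T.L5 v y p q r s) : T.Qs v y = {s, r, q, p, v} := by
  ext x
  rw [mem_Qs]
  have nd := L.nd
  simp only [List.nodup_cons, List.mem_cons, not_or] at nd
  simp only [mem_insert, mem_singleton]
  constructor
  · rintro (rfl | ⟨h1, h2⟩)
    · simp
    · have := L.nb x h2; tauto
  · rintro (rfl | rfl | rfl | rfl | rfl)
    · exact Or.inr ⟨by tauto, L.f4.2.1⟩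
    · exact Or.inr ⟨by tauto, L.f3.2.1⟩
    · exact Or.inr ⟨by tauto, L.f2.2.1⟩
    · exact Or.inr ⟨by tauto, L.f1.2.1⟩
    · simp
lemma card_Qs {v y : V} (hv : T.d v = 5) (hy : T.adj v y) : (T.Qs v y).card = 5 := by
  rw [Tri.Qs, card_insert_of_notMem, card_erase_of_mem (by simpa using hy)]
  · change T.d v - 1 + 1 = 5; omega
  · simp [T.irrefl]

/-- all light path -/
lemma L5.elimA {v y p q r s : V} (L : T.L5 v y p q r s) (hp : T.d p ≤ 6) (hq : T.d q ≤ 6) (hr : T.d r ≤ 6)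
    (hs : T.d s ≤ 6) : T.Elim (T.Qs v y) := by
  rw [L.Qs]
  have nd := L.nd
  simp only [List.nodup_cons, List.mem_cons, not_or] at nd
  have e1 : T.Elim {v} := elim_single L.dv.le
  have e2 := e1.insert' (w := p) (by simp; tauto) (by
    have := nb1 (T := T) (P := {v}) (w := p) (mem_singleton_self v) (T.symm L.f2.1); omega) (by
    intro x hx; rw [mem_singleton] at hx; subst hx; exact g1 L.dv.le g0 L.f2.1)
  have e3 := e2.insert (w := q) (by
    have := nb2 (T := T) (P := {p, v}) (w := q) (p := p) (q := v) (by simp) (by simp) (T.symm L.f2.bc) (T.symm L.f3.1) (by tauto); omega)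
  have e4 := e3.insert (w := r) (by
    have := nb2 (T := T) (P := {q, p, v}) (w := r) (p := q) (q := v) (by simp) (by simp) (T.symm L.f3.bc) (T.symm L.f4.1) (by tauto); omega)
  exact e4.insert (w := s) (by
    have := nb2 (T := T) (P := {r, q, p, v}) (w := s) (p := r) (q := v) (by simp) (by simp) (T.symm L.f4.bc) (T.symm L.f5.1) (by tauto); omega)

/-- a 7-vertex at the end -/
lemma L5.elimB {v y p q r s : V} (L : T.L5 v y p q r s) (hp : T.d p ≤ 6) (hq : T.d q ≤ 6) (hr : T.d r ≤ 6)
    (hs : T.d s ≤ 7) : T.Elim (T.Qs v y) := by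
  rw [L.Qs]
  have nd := L.nd
  simp only [List.nodup_cons, List.mem_cons, not_or] at nd
  have e1 : T.Elim {v} := elim_single L.dv.le
  have e2 := e1.insert' (w := p) (by simp; tauto) (by
    have := nb1 (T := T) (P := {v}) (w := p) (mem_singleton_self v) (T.symm L.f2.1); omega) (by
    intro x hx; rw [mem_singleton] at hx; subst hx; exact g1 L.dv.le g0 L.f2.1)
  have e3 := e2.insert (w := q) (by
    have := nb2 (T := T) (P := {p, v}) (w := q) (p := p) (q := v) (by simp) (by simp) (T.symm L.f2.bc) (T.symm L.f3.1) (by tauto); omega)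
  have e4 := e3.insert (w := r) (by
    have := nb2 (T := T) (P := {q, p, v}) (w := r) (p := q) (q := v) (by simp) (by simp) (T.symm L.f3.bc) (T.symm L.f4.1) (by tauto); omega)
  refine e4.insert' (w := s) (by simp; tauto) (by
    have := nb2 (T := T) (P := {r, q, p, v}) (w := s) (p := r) (q := v) (by simp) (by simp) (T.symm L.f4.bc) (T.symm L.f5.1) (by tauto); omega) ?_
  have k1 : T.Gone {s} v := g1 L.dv.le g0 L.f5.1
  have k2 : T.Gone {s} r := g2 hr k1 g0 (T.symm L.f4.1) L.f4.bc (by tauto)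
  have k3 : T.Gone {s} q := g2 hq k1 k2 (T.symm L.f3.1) L.f3.bc (by tauto)
  have k4 : T.Gone {s} p := g2 hp k1 k3 (T.symm L.f2.1) L.f2.bc (by tauto)
  intro x hx
  simp only [mem_insert, mem_singleton] at hx
  rcases hx with rfl | rfl | rfl | rfl <;> assumption

/-- a 7-vertex at the last but one place -/
lemma L5.elimC {v y p q r s : V} (L : T.L5 v y p q r s) (hp : T.d p ≤ 6) (hq : T.d q ≤ 6) (hr : T.d r ≤ 7)
    (hs : T.d s ≤ 6) : T.Elim (T.Qs v y) := by
  rw [L.Qs]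
  have nd := L.nd
  simp only [List.nodup_cons, List.mem_cons, not_or] at nd
  have e1 : T.Elim {v} := elim_single L.dv.le
  have e2 := e1.insert' (w := p) (by simp; tauto) (by
    have := nb1 (T := T) (P := {v}) (w := p) (mem_singleton_self v) (T.symm L.f2.1); omega) (by
    intro x hx; rw [mem_singleton] at hx; subst hx; exact g1 L.dv.le g0 L.f2.1)
  have e3 := e2.insert (w := q) (by
    have := nb2 (T := T) (P := {p, v}) (w := q) (p := p) (q := v) (by simp) (by simp) (T.symm L.f2.bc) (T.symm L.f3.1) (by tauto); omega)
  have e4 : T.Elim {r, q, p, v} := by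
    refine e3.insert' (w := r) (by simp; tauto) (by
      have := nb2 (T := T) (P := {q, p, v}) (w := r) (p := q) (q := v) (by simp) (by simp) (T.symm L.f3.bc) (T.symm L.f4.1) (by tauto); omega) ?_
    have k1 : T.Gone {r} v := g1 L.dv.le g0 L.f4.1
    have k3 : T.Gone {r} q := g2 hq k1 g0 (T.symm L.f3.1) L.f3.bc (by tauto)
    have k4 : T.Gone {r} p := g2 hp k1 k3 (T.symm L.f2.1) L.f2.bc (by tauto)
    intro x hx
    simp only [mem_insert, mem_singleton] at hx
    rcases hx with rfl | rfl | rfl <;> assumption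
  exact e4.insert (w := s) (by
    have := nb2 (T := T) (P := {r, q, p, v}) (w := s) (p := r) (q := v) (by simp) (by simp) (T.symm L.f4.bc) (T.symm L.f5.1) (by tauto); omega)

lemma L5.y_nQs {v y p q r s : V} (L : T.L5 v y p q r s) : y ∉ T.Qs v y := by
  rw [mem_Qs]; rintro (h | h)
  · exact ne L.f1.1 h.symm
  · exact h.1 rfl

/-- Not all neighbours are light. -/
lemma MinCE.noLight (hM : T.MinCE) {v : V} (hv : T.d v = 5) (h : ∀ u, T.adj v u → T.d u ≤ 6) : False := by
  have : 0 < (T.N v).card := by change 0 < T.d v; omega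
  obtain ⟨y, hy⟩ := card_pos.1 this
  obtain ⟨p, q, r, s, L⟩ := exL5 hv (mem_N.1 hy)
  have nd := L.nd
  simp only [List.nodup_cons, List.mem_cons, not_or] at nd
  have e := L.elimA (h p L.f2.1) (h q L.f3.1) (h r L.f4.1) (h s L.f5.1)
  have := hM.clo e (card_Qs hv L.f1.1).ge L.y_nQs
  have h3 := nb3 (T := T) (P := T.Qs v y) (w := y) (p := v) (q := p) (r := s) (by simp [mem_Qs]) (by rw [L.Qs]; simp)
    (by rw [L.Qs]; simp) (T.symm L.f1.1) L.f1.bc (T.symm L.f5.bc) (by tauto) (by tauto) (by tauto)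
  have := h y L.f1.1
  omega

/-- five-vertex with exactly one big neighbour -/
structure IsA (T : Tri V) (v x : V) : Prop where
  dv : T.d v = 5
  vx : T.adj v x
  dx : 7 ≤ T.d x
  li : ∀ u, T.adj v u → u ≠ x → T.d u ≤ 6

lemma IsA.elim {v x : V} (h : T.IsA v x) : T.Elim (T.Qs v x) := by
  obtain ⟨p, q, r, s, L⟩ := exL5 h.dv h.vx
  have nd := L.nd
  simp only [List.nodup_cons, List.mem_cons, not_or] at nd
  exact L.elimA (h.li p L.f2.1 (by tauto)) (h.li q L.f3.1 (by tauto)) (h.li r L.f4.1 (by tauto)) (h.li s L.f5.1 (by tauto))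

lemma L5.ends {v y p q r s : V} (L : T.L5 v y p q r s) : 3 ≤ T.nb y (T.Qs v y) := by
  have nd := L.nd
  simp only [List.nodup_cons, List.mem_cons, not_or] at nd
  exact nb3 (T := T) (P := T.Qs v y) (w := y) (p := v) (q := p) (r := s) (by simp [mem_Qs]) (by rw [L.Qs]; simp)
    (by rw [L.Qs]; simp) (T.symm L.f1.1) L.f1.bc (T.symm L.f5.bc) (by tauto) (by tauto) (by tauto)

/-- if one link vertex on the light path is gone and so is `v`, all are gone -/
lemma L5.goneA {v y p q r s : V} (L : T.L5 v y p q r s) (hp : T.d p ≤ 6) (hq : T.d q ≤ 6) (hr : T.d r ≤ 6)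
    (hs : T.d s ≤ 6) {Z : Finset V} (hv : T.Gone Z v) (h : T.Gone Z p ∨ T.Gone Z q ∨ T.Gone Z r ∨ T.Gone Z s) :
    ∀ x ∈ T.Qs v y, T.Gone Z x := by
  have a1 : T.Gone Z p → T.Gone Z q := fun h => g2 hq hv h (T.symm L.f3.1) (T.symm L.f2.bc) (ne L.f2.1)
  have a2 : T.Gone Z q → T.Gone Z r := fun h => g2 hr hv h (T.symm L.f4.1) (T.symm L.f3.bc) (ne L.f3.1)
  have a3 : T.Gone Z r → T.Gone Z s := fun h => g2 hs hv h (T.symm L.f5.1) (T.symm L.f4.bc) (ne L.f4.1)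
  have b1 : T.Gone Z q → T.Gone Z p := fun h => g2 hp hv h (T.symm L.f2.1) (L.f2.bc) (ne L.f3.1)
  have b2 : T.Gone Z r → T.Gone Z q := fun h => g2 hq hv h (T.symm L.f3.1) (L.f3.bc) (ne L.f4.1)
  have b3 : T.Gone Z s → T.Gone Z r := fun h => g2 hr hv h (T.symm L.f4.1) (L.f4.bc) (ne L.f5.1)
  have hr' : T.Gone Z r := by
    rcases h with h | h | h | h
    · exact a2 (a1 h)
    · exact a2 h
    · exact h
    · exact b3 h
  intro x hx
  rw [L.Qs] at hx
  simp only [mem_insert, mem_singleton] at hx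
  rcases hx with rfl | rfl | rfl | rfl | rfl
  · exact a3 hr'
  · exact hr'
  · exact b2 hr'
  · exact b1 (b2 hr')
  · exact hv

lemma IsA.gone {v x u : V} (h : T.IsA v x) (hu : u ∈ T.Qs v x) (hd : T.d u = 5) (huv : u ≠ v) :
    ∀ p ∈ T.Qs v x, T.Gone {u} p := by
  obtain ⟨p, q, r, s, L⟩ := exL5 h.dv h.vx
  have nd := L.nd
  simp only [List.nodup_cons, List.mem_cons, not_or] at nd
  have hu' := hu
  rw [mem_Qs] at hu'
  refine L.goneA (h.li p L.f2.1 (by tauto)) (h.li q L.f3.1 (by tauto)) (h.li r L.f4.1 (by tauto))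
    (h.li s L.f5.1 (by tauto)) (g1 h.dv.le g0 (by tauto)) ?_
  rw [L.Qs] at hu
  simp only [mem_insert, mem_singleton] at hu
  rcases hu with rfl | rfl | rfl | rfl | rfl
  · simp [g0]
  · simp [g0]
  · simp [g0]
  · simp [g0]
  · exact (huv rfl).elim

lemma IsA.goneX {v x : V} (h : T.IsA v x) : ∀ p ∈ T.Qs v x, T.Gone {x} p := by
  obtain ⟨p, q, r, s, L⟩ := exL5 h.dv h.vx
  have nd := L.nd
  simp only [List.nodup_cons, List.mem_cons, not_or] at nd
  have k1 : T.Gone {x} v := (g1 h.dv.le g0 h.vx)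
  refine L.goneA (h.li p L.f2.1 (by tauto)) (h.li q L.f3.1 (by tauto)) (h.li r L.f4.1 (by tauto))
    (h.li s L.f5.1 (by tauto)) k1 (Or.inl ?_)
  exact g2 (h.li p L.f2.1 (by tauto)) k1 g0 (T.symm L.f2.1) (T.symm L.f1.bc) (by tauto)

lemma IsA.x_n {v x : V} (h : T.IsA v x) : x ∉ T.Qs v x := by
  rw [mem_Qs]; rintro (h' | h')
  · exact ne h.vx h'.symm
  · exact h'.1 rfl

lemma MinCE.A9 (hM : T.MinCE) {v x : V} (h : T.IsA v x) : 9 ≤ T.d x := by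
  obtain ⟨p, q, r, s, L⟩ := exL5 h.dv h.vx
  have := hM.clo' h.elim (card_Qs h.dv h.vx).ge h.x_n h.goneX
  have := L.ends
  omega

lemma MinCE.A9' (hM : T.MinCE) {v x : V} (h : T.IsA v x) : 6 + T.nb x (T.Qs v x) ≤ T.d x :=
  hM.clo' h.elim (card_Qs h.dv h.vx).ge h.x_n h.goneX

/-- a five-vertex adjacent to `Q` lies in `Q` -/
lemma MinCE.A_five (hM : T.MinCE) {v x u w : V} (h : T.IsA v x) (hu : T.d u = 5) (hw : w ∈ T.Qs v x)
    (hwu : T.adj u w) : u ∈ T.Qs v x := by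
  refine hM.abs h.elim (card_Qs h.dv h.vx).ge ?_
  exact g1 hu.le (Gone.base w hw) hwu

/-- outer neighbours of a five-vertex of `Q` -/
lemma MinCE.A_out (hM : T.MinCE) {v x u w : V} (h : T.IsA v x) (hu : T.d u = 5) (hu' : u ∈ T.Qs v x)
    (huv : u ≠ v) (hw : w ∉ T.Qs v x) (huw : T.adj u w) : 6 + T.nb w (T.Qs v x) ≤ T.d w := by
  refine hM.clo' h.elim (card_Qs h.dv h.vx).ge hw ?_
  intro p hp
  refine (h.gone hu' hu huv p hp).trans ?_
  intro z hz
  rw [mem_singleton] at hz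
  subst hz
  exact g1 hu.le g0 huw

/-- Two A's with a common five -/
lemma MinCE.A_sub (hM : T.MinCE) {v x v' x' u : V} (h : T.IsA v x) (h' : T.IsA v' x') (hu : T.d u = 5)
    (h1 : u ∈ T.Qs v x) (h2 : u ∈ T.Qs v' x') (hn : u ≠ v') : T.Qs v' x' = T.Qs v x := by
  apply eq_of_subset_of_card_le
  · intro p hp
    refine hM.abs h.elim (card_Qs h.dv h.vx).ge ?_
    exact (h'.gone h2 hu hn p hp).mono (by simpa using h1)
  · rw [card_Qs h.dv h.vx, card_Qs h'.dv h'.vx]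

lemma MinCE.AA (hM : T.MinCE) {v a x : V} (h : T.IsA v x) (h' : T.IsA a x) : ¬ T.adj v a := by
  intro hva
  have hax : a ≠ x := ne h'.vx
  have hvx : v ≠ x := ne h.vx
  have a1 : a ∈ T.Qs v x := by rw [mem_Qs]; exact Or.inr ⟨hax, hva⟩
  have v1 : v ∈ T.Qs a x := by rw [mem_Qs]; exact Or.inr ⟨hvx, T.symm hva⟩
  have v0 : v ∈ T.Qs v x := by rw [mem_Qs]; exact Or.inl rfl
  have eq := hM.A_sub h h' h.dv v0 v1 (ne hva)
  have key : ∀ s, s ≠ v → s ≠ a → (T.adj a s ↔ T.adj v s) := by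
    intro s hs hs'
    by_cases hx : s = x
    · rw [hx]; simp [h.vx, h'.vx]
    · have := Finset.ext_iff.1 eq s
      simp only [mem_Qs] at this
      tauto
  obtain ⟨s1, s2, s3, s4, L⟩ := exL5 h.dv hva
  have nd := L.nd
  simp only [List.nodup_cons, List.mem_cons, not_or] at nd
  have c1 : T.adj a s1 := L.f1.bc
  have c2 : T.adj a s2 := (key s2 (by tauto) (by tauto)).2 L.f3.1
  have c3 : T.adj a s3 := (key s3 (by tauto) (by tauto)).2 L.f4.1
  have c4 : T.adj a s4 := T.symm L.f5.bc
  have n24 : ¬ T.adj s2 s4 := fun h => L.x3 h (T.symm c3)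
  have n13 : ¬ T.adj s1 s3 := fun h => L.x1 c2 h
  obtain ⟨p, q, r, t, M⟩ := exL5 h'.dv c2
  have nd' := M.nd
  simp only [List.nodup_cons, List.mem_cons, not_or] at nd'
  have cl : ∀ z, T.F a s2 z → z = s1 ∨ z = s3 := by
    intro z hz
    have z1 : T.adj a z := hz.2.1
    have z2 : T.adj s2 z := hz.bc
    have z3 : z ≠ v := by
      rintro rfl
      have := L.f1.three L.f5.sw (by tauto) hz.rot2.sw2.sw2
      tauto
    have z4 := L.nb z ((key z z3 (ne z1).symm).1 z1)
    have z5 : z ≠ s4 := fun e => n24 (e ▸ z2)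
    have z6 : z ≠ s2 := (ne z2).symm
    have z7 : z ≠ a := (ne z1).symm
    tauto
  have hp := cl p M.f1
  have ht := cl t M.f5.sw
  have : T.F a s2 s1 ∧ T.F a s2 s3 := by
    have h1 := M.f1
    have h2 := M.f5.sw
    have h3 : p ≠ t := by tauto
    rcases hp with rfl | rfl <;> rcases ht with rfl | rfl
    · exact (h3 rfl).elim
    · exact ⟨h1, h2⟩
    · exact ⟨h2, h1⟩
    · exact (h3 rfl).elim
  have := clos4 (z := s2) (a := v) (b := s1) (c := a) (d := s3) L.f2.rot2 this.1.rot.sw.sw.rot.rot.rot this.2.sw2 L.f3.rot.sw.sw (by tauto) (by tauto)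
  have := hM.d5 s2
  omega
end Tri
end FC


namespace FC
open Finset Function
open scoped Classical
namespace Tri
variable {V : Type} [Fintype V] {T : Tri V}

lemma MinCE.t3 (hM : T.MinCE) {v : V} (hv : T.d v = 5) (h : ∀ u, T.adj v u → T.d u ≤ 7) :
    3 ≤ ((T.N v).filter (fun u => T.d u = 7)).card := by
  by_contra hc
  have : ∃ y, T.adj v y ∧ T.d y = 7 := by
    by_contra hn
    push Not at hn
    exact hM.noLight hv fun u hu => by have := h u hu; have := hn u hu; omega
  obtain ⟨y, hvy, hy⟩ := this
  have two : ∀ u w, T.adj v u → T.adj v w → u ≠ w → y ≠ u → y ≠ w → T.d u = 7 → T.d w ≤ 6 := by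
    intro u w hu hw h1 h2 h3 h4
    by_contra h5
    have h6 : T.d w = 7 := by have := h w hw; omega
    apply hc
    have : ({y, u, w} : Finset V) ⊆ (T.N v).filter (fun u => T.d u = 7) := by
      simp [insert_subset_iff, *]
    have := card_le_card this
    rwa [card_eq_three.2 ⟨y, u, w, h2, h3, h1, rfl⟩] at this
  obtain ⟨p, q, r, s, L⟩ := exL5 hv hvy
  have nd := L.nd
  simp only [List.nodup_cons, List.mem_cons, not_or] at nd
  have hp := L.f2.1
  have hq := L.f3.1
  have hr := L.f4.1
  have hs := L.f5.1
  have key : ¬ T.Elim (T.Qs v y) := by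
    intro e
    have := hM.clo e (card_Qs hv L.f1.1).ge L.y_nQs
    have := L.ends
    omega
  have lp := h p hp
  have lq := h q hq
  have lr := h r hr
  have ls := h s hs
  by_cases h1 : T.d p = 7
  · exact key (L.refl.elimB (two p s hp hs (by tauto) (by tauto) (by tauto) h1)
      (two p r hp hr (by tauto) (by tauto) (by tauto) h1) (two p q hp hq (by tauto) (by tauto) (by tauto) h1) lp)
  by_cases h2 : T.d q = 7
  · exact key (L.refl.elimC (two q s hq hs (by tauto) (by tauto) (by tauto) h2)
      (two q r hq hr (by tauto) (by tauto) (by tauto) h2) lq (by omega))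
  by_cases h3 : T.d r = 7
  · exact key (L.elimC (by omega) (by omega) lr (two r s hr hs (by tauto) (by tauto) (by tauto) h3))
  exact key (L.elimB (by omega) (by omega) (by omega) ls)

/-- five-neighbours -/
noncomputable def N5 (T : Tri V) (x : V) : Finset V := (T.N x).filter (fun u => T.d u = 5)
lemma mem_N5 {x u : V} : u ∈ T.N5 x ↔ T.adj x u ∧ T.d u = 5 := by simp [N5]

lemma two_idx {s : Finset ℕ} {d : ℕ} (hd : 1 < d) (hs : ∀ k ∈ s, 1 ≤ k ∧ k < d) (hc : s.card ≤ 2) :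
    ∃ p q, 1 ≤ p ∧ p ≤ q ∧ q < d ∧ ∀ k ∈ s, k = p ∨ k = q := by
  rcases Nat.lt_or_ge s.card 2 with h | h
  · rcases Nat.lt_or_ge s.card 1 with h | h
    · have : s = ∅ := by rw [← card_eq_zero]; omega
      exact ⟨1, 1, le_rfl, le_rfl, hd, by simp [this]⟩
    · obtain ⟨a, rfl⟩ := card_eq_one.1 (show s.card = 1 by omega)
      have := hs a (by simp)
      exact ⟨a, a, this.1, le_rfl, this.2, by simp⟩
  · obtain ⟨a, b, hab, rfl⟩ := card_eq_two.1 (show s.card = 2 by omega)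
    have h1 := hs a (by simp)
    have h2 := hs b (by simp)
    rcases Nat.lt_or_ge a b with h | h
    · exact ⟨a, b, h1.1, h.le, h2.2, by simp⟩
    · exact ⟨b, a, h2.1, h, h1.2, by simp⟩

lemma MinCE.Z (hM : T.MinCE) {x : V} (h5 : 5 ≤ (T.N5 x).card) : (T.N5 x).card + 4 ≤ T.d x := by
  by_contra hc
  have hx5 : x ∉ T.N5 x := by simp [mem_N5, T.irrefl]
  refine hM.be (S := insert x (T.N5 x)) (z := x) (by simp) ?_ (by rw [card_insert_of_notMem hx5]; omega) ?_
  · intro s hs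
    rw [mem_insert] at hs
    rcases hs with rfl | hs
    · exact g0
    · rw [mem_N5] at hs
      exact g1 hs.2.le g0 (T.symm hs.1)
  · intro B hB hBS
    have hB5 : T.d B ≠ 5 := fun h => hBS (by rw [mem_insert, mem_N5]; exact Or.inr ⟨hB, h⟩)
    have hd1 : 1 < T.d x := by have := hM.d5 x; omega
    let s := (range (T.d x)).filter (fun k => 1 ≤ k ∧ T.d (T.r x B k) ≠ 5)
    have hs2 : s.card ≤ 2 := by
      have e1 : (s.image (T.r x B)).card = s.card := by
        apply card_image_of_injOn
        intro i hi j hj e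
        simp only [s, coe_filter, Set.mem_ofPred_eq, mem_range] at hi hj
        exact r_inj hB hi.1 hj.1 e
      have e2 : s.image (T.r x B) ⊆ (T.N x \ T.N5 x).erase B := by
        intro y hy
        simp only [s, mem_image, mem_filter, mem_range] at hy
        obtain ⟨k, ⟨k1, k2, k3⟩, rfl⟩ := hy
        simp only [mem_erase, mem_sdiff, mem_N, mem_N5, not_and]
        refine ⟨fun e => ?_, r_adj hB k, fun _ => k3⟩
        have := r_inj hB (i := k) (j := 0) k1 (by omega) e
        omega
      have e3 := card_le_card e2
      rw [card_erase_of_mem (by simp [mem_N5, hB, hB5]), card_sdiff_of_subset (show T.N5 x ⊆ T.N x from filter_subset _ _), e1] at e3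
      change _ ≤ T.d x - _ - 1 at e3
      omega
    obtain ⟨p, q, p1, pq, qd, hpq⟩ := two_idx hd1 (s := s) (by
      intro k hk; simp only [s, mem_filter, mem_range] at hk; exact ⟨hk.2.1, hk.1⟩) hs2
    have five : ∀ k, 1 ≤ k → k < T.d x → k ≠ p → k ≠ q → T.d (T.r x B k) = 5 := by
      intro k k1 k2 k3 k4
      by_contra hk
      have := hpq k (by simp only [s, mem_filter, mem_range]; exact ⟨k2, k1, hk⟩)
      tauto
    have up : ∀ Z : Finset V, B ∈ Z → ∀ k < p, T.Gone Z (T.r x B k) := by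
      intro Z hZ k
      induction k with
      | zero => intro _; exact Gone.base _ hZ
      | succ k ih =>
        intro hk
        exact g1 (five (k+1) (by omega) (by omega) (by omega) (by omega)).le (ih (by omega))
          (T.symm (r_adj_succ hB k))
    have down : ∀ Z : Finset V, B ∈ Z → ∀ i, i + q < T.d x → T.Gone Z (T.r x B (T.d x - i)) := by
      intro Z hZ i
      induction i with
      | zero => intro _; rw [Nat.sub_zero, r_d hB]; exact Gone.base _ hZ
      | succ i ih =>
        intro hi
        have := r_adj_succ hB (T.d x - (i+1))
        rw [show T.d x - (i+1) + 1 = T.d x - i by omega] at this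
        exact g1 (five (T.d x - (i+1)) (by omega) (by omega) (by omega) (by omega)).le (ih (by omega)) this
    have fin : ∀ Z : Finset V, B ∈ Z → (∀ k, p < k → k < q → T.Gone Z (T.r x B k)) → T.Gone Z x := by
      intro Z hZ hm
      refine Gone.step x (insert B (T.N5 x)) ?_ ?_ ?_
      · intro a ha
        rw [mem_insert, mem_N5] at ha
        rcases ha with rfl | ha
        · exact hB
        · exact ha.1
      · intro a ha
        rw [mem_insert, mem_N5] at ha
        rcases ha with rfl | ha
        · exact Gone.base _ hZ
        · obtain ⟨k, hk, rfl⟩ := r_lt hB ha.1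
          rcases Nat.lt_or_ge k p with h1 | h1
          · exact up Z hZ k h1
          rcases Nat.lt_or_ge q k with h2 | h2
          · have := down Z hZ (T.d x - k) (by omega)
            rwa [show T.d x - (T.d x - k) = k by omega] at this
          rcases Nat.lt_or_ge p k with h3 | h3
          · rcases Nat.lt_or_ge k q with h4 | h4
            · exact hm k h3 h4
            · -- k = q is five, adjacent to a gone one
              have hkq : k = q := by omega
              subst hkq
              have := down Z hZ (T.d x - (k+1)) (by omega)
              rw [show T.d x - (T.d x - (k+1)) = k + 1 by omega] at this
              exact g1 ha.2.le this (r_adj_succ hB k)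
          · have hkp : k = p := by omega
            subst hkp
            have := up Z hZ (k-1) (by omega)
            have h6 := r_adj_succ hB (k-1)
            rw [show k - 1 + 1 = k by omega] at h6
            exact g1 ha.2.le this (T.symm h6)
      · rw [card_insert_of_notMem (by simp [mem_N5, hB5])]
        omega
    rcases Nat.lt_or_ge (p+1) q with h | h
    · refine ⟨{T.r x B (p+1)}, ?_, elim_single ?_, fin _ (by simp) ?_⟩
      · rw [singleton_subset_iff, mem_insert, mem_N5]
        exact Or.inr ⟨r_adj hB _, five (p+1) (by omega) (by omega) (by omega) (by omega)⟩
      · exact (five (p+1) (by omega) (by omega) (by omega) (by omega)).le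
      · intro k hk
        induction k, hk using Nat.le_induction with
        | base => intro _; exact Gone.base _ (by simp)
        | succ k hk ih =>
          intro hkq
          exact g1 (five (k+1) (by omega) (by omega) (by omega) (by omega)).le (ih (by omega))
            (T.symm (r_adj_succ hB k))
    · refine ⟨∅, by simp, ?_, fin _ (by simp) (fun k h1 h2 => by omega)⟩
      intro X hX _
      exact ⟨∅, by simp, by simp, by simpa using hX, by simp⟩

lemma MinCE.Zd (hM : T.MinCE) {x : V} : (T.N5 x).card ≤ 4 ∨ (T.N5 x).card + 4 ≤ T.d x := by
  by_cases h : 5 ≤ (T.N5 x).card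
  · exact Or.inr (hM.Z h)
  · left; omega

/-- the 7-vertex patch -/
lemma elim7 {x : V} (hx : T.d x = 7) {P : Finset V} (hP : T.Elim P) (hxP : x ∉ P) (h2 : 2 ≤ T.nb x P)
    (hg : ∀ p ∈ P, T.Gone {x} p) : T.Elim (insert x P ∪ T.N5 x) := by
  have e := hP.insert' hxP (by omega) hg
  refine e.ext subset_union_left ?_
  intro p hp
  rw [mem_union] at hp
  rcases hp with hp | hp
  · exact Gone.base _ hp
  · rw [mem_N5] at hp
    exact g1 hp.2.le (Gone.base x (by simp)) (T.symm hp.1)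

lemma elim7' {x u u' : V} (hx : T.d x = 7) (hu : u ∈ T.N5 x) (hu' : u' ∈ T.N5 x) (h : T.adj u u') :
    T.Elim (insert x (T.N5 x)) := by
  have e := (elim_single (mem_N5.1 hu).2.le).insert (w := u') (by
    have := nb1 (T := T) (P := {u}) (w := u') (p := u) (by simp) (T.symm h)
    have := (mem_N5.1 hu').2; omega)
  rw [mem_N5] at hu hu'
  have := elim7 hx e (by simp [ne hu.1, ne hu'.1]) (nb2 (p := u) (q := u') (by simp) (by simp) hu.1 hu'.1 (ne h)) (by
    intro p hp
    simp only [mem_insert, mem_singleton] at hp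
    rcases hp with rfl | rfl
    · exact g1 hu'.2.le g0 (T.symm hu'.1)
    · exact g1 hu.2.le g0 (T.symm hu.1))
  convert this using 1
  ext p
  simp only [mem_insert, mem_union, mem_singleton, mem_N5]
  constructor
  · tauto
  · rintro ((rfl | rfl | rfl) | h)
    · simp
    · simp [hu']
    · simp [hu]
    · simp [h]

lemma comb7 : ∀ I ∈ (range 7).powerset, I.card = 4 → ∃ i ∈ I, (i + 1) % 7 ∈ I := by decide +kernel

lemma card_N5_idx {x u : V} (hu : T.adj x u) :
    ((range (T.d x)).filter (fun i => T.d (T.r x u i) = 5)).card = (T.N5 x).card := by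
  rw [← card_image_of_injOn (f := T.r x u)]
  · congr 1
    ext y
    simp only [mem_image, mem_filter, mem_range, mem_N5]
    constructor
    · rintro ⟨i, ⟨h1, h2⟩, rfl⟩; exact ⟨r_adj hu i, h2⟩
    · rintro ⟨h1, h2⟩
      obtain ⟨k, hk, rfl⟩ := r_lt hu h1
      exact ⟨k, ⟨hk, h2⟩, rfl⟩
  · intro i hi j hj e
    simp only [coe_filter, Set.mem_ofPred_eq, mem_range] at hi hj
    exact r_inj hu hi.1 hj.1 e

lemma elim74 {x : V} (hx : T.d x = 7) (h4 : (T.N5 x).card = 4) : T.Elim (insert x (T.N5 x)) := by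
  obtain ⟨u, hu⟩ := card_pos.1 (show 0 < (T.N5 x).card by omega)
  have hxu := (mem_N5.1 hu).1
  have := card_N5_idx hxu
  rw [hx, h4] at this
  obtain ⟨i, hi, hi'⟩ := comb7 _ (by rw [mem_powerset]; exact filter_subset _ _) this
  rw [mem_filter] at hi hi'
  rw [← hx, r_modd hxu] at hi'
  exact elim7' hx (mem_N5.2 ⟨r_adj hxu i, hi.2⟩) (mem_N5.2 ⟨r_adj hxu (i+1), hi'.2⟩) (r_adj_succ hxu i)
end Tri
end FC


namespace FC
open Finset Function
open scoped Classical
namespace Tri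
variable {V : Type} [Fintype V] {T : Tri V}

lemma MinCE.c7 (hM : T.MinCE) {x v : V} (hx : T.d x = 7) (h4 : (T.N5 x).card = 4) (hv : v ∈ T.N5 x)
    (h : ∀ u, T.adj v u → T.d u ≤ 7) : False := by
  have E := elim74 hx h4
  have hx5 : x ∉ T.N5 x := by simp [mem_N5, T.irrefl]
  have hc5 : 5 ≤ (insert x (T.N5 x)).card := by rw [card_insert_of_notMem hx5]; omega
  have hv' := mem_N5.1 hv
  have hv5 := hv'.2
  have gall : ∀ Z, T.Gone Z x → ∀ p ∈ insert x (T.N5 x), T.Gone Z p := by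
    intro Z hZ p hp
    rw [mem_insert, mem_N5] at hp
    rcases hp with rfl | hp
    · exact hZ
    · exact g1 hp.2.le hZ (T.symm hp.1)
  have caseB : ∀ p b c q, T.L5 v x p b c q → T.d p = 5 → T.d q ≠ 5 → False := by
    intro p b c q L hp hq
    have nd := L.nd
    simp only [List.nodup_cons, List.mem_cons, not_or] at nd
    have k1 : T.Gone {q} v := g1 hv5.le g0 L.f5.1
    have k2 : T.Gone {q} p := g1 hp.le k1 (T.symm L.f2.1)
    have k3 : T.Gone {q} x := g3 hx.le k1 k2 g0 hv'.1 L.f1.bc (T.symm L.f5.bc) (by tauto) (by tauto) (by tauto)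
    have := hM.clo' E hc5 (w := q) (by rw [mem_insert, mem_N5]; tauto) (gall _ k3)
    have := nb2 (T := T) (P := insert x (T.N5 x)) (w := q) (p := v) (q := x) (by simp [hv]) (by simp)
      (T.symm L.f5.1) L.f5.bc (by tauto)
    have := h q L.f5.1
    omega
  have caseC : ∀ p b c q, T.L5 v x p b c q → T.d p ≠ 5 → T.d p ≠ 6 := by
    intro p b c q L hp hp6
    have nd := L.nd
    simp only [List.nodup_cons, List.mem_cons, not_or] at nd
    have e1 : T.Elim {v} := elim_single L.dv.le
    have e2 := e1.insert' (w := p) (by simp; tauto) (by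
      have := nb1 (T := T) (P := {v}) (w := p) (mem_singleton_self v) (T.symm L.f2.1); omega) (by
      intro y hy; rw [mem_singleton] at hy; subst hy; exact g1 L.dv.le g0 L.f2.1)
    have kv : T.Gone {x} v := g1 hv5.le g0 L.f1.1
    have e3 := elim7 hx e2 (by simp; tauto) (nb2 (p := p) (q := v) (by simp) (by simp) L.f1.bc hv'.1 (by tauto)) (by
      intro y hy
      simp only [mem_insert, mem_singleton] at hy
      rcases hy with rfl | rfl
      · exact g2 hp6.le kv g0 (T.symm L.f2.1) (T.symm L.f1.bc) (by tauto)
      · exact kv)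
    have := hM.elim5 e3
    have h6 : insert p (insert x (T.N5 x)) ⊆ insert x {p, v} ∪ T.N5 x := by
      intro y hy
      simp only [mem_insert, mem_union, mem_singleton] at hy ⊢
      tauto
    have := card_le_card h6
    rw [card_insert_of_notMem (by rw [mem_insert, mem_N5]; tauto)] at this
    omega
  have caseD : ∀ p b c q z, T.L5 v x p b c q → T.d p ≠ 5 → T.F x p z → z ≠ v → T.d z ≠ 5 := by
    intro p b c q z L hp hz hzv hz5
    have nd := L.nd
    simp only [List.nodup_cons, List.mem_cons, not_or] at nd
    have := hM.clo E hc5 (w := p) (by rw [mem_insert, mem_N5]; tauto)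
    have := nb3 (T := T) (P := insert x (T.N5 x)) (w := p) (p := v) (q := x) (r := z) (by simp [hv]) (by simp)
      (by rw [mem_insert, mem_N5]; exact Or.inr ⟨hz.2.1, hz5⟩)
      (T.symm L.f2.1) (T.symm L.f1.bc) hz.bc (by tauto) hzv.symm (ne hz.2.1)
    have := h p L.f2.1
    omega
  obtain ⟨p, b, c, q, L⟩ := exL5 hv5 (T.symm hv'.1)
  have nd := L.nd
  simp only [List.nodup_cons, List.mem_cons, not_or] at nd
  by_cases hp : T.d p = 5
  · by_cases hq : T.d q = 5
    · have hb : T.d b = 7 := by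
        by_contra hb
        have h3 := hM.t3 hv5 h
        have : (T.N v).filter (fun u => T.d u = 7) ⊆ {x, c} := by
          intro y hy
          simp only [mem_filter, mem_N] at hy
          simp only [mem_insert, mem_singleton]
          rcases L.nb y hy.1 with rfl | rfl | rfl | rfl | rfl
          · simp
          · omega
          · exact (hb hy.2).elim
          · simp
          · omega
        have := (card_le_card this).trans card_le_two
        omega
      have k1 : T.Gone {b} v := g1 hv5.le g0 L.f3.1
      have k2 : T.Gone {b} p := g1 hp.le k1 (T.symm L.f2.1)
      have k2' : T.Gone {b} q := g1 hq.le k1 (T.symm L.f5.1)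
      have k3 : T.Gone {b} x := g3 hx.le k1 k2 k2' hv'.1 L.f1.bc (T.symm L.f5.bc) (by tauto) (by tauto) (by tauto)
      have := hM.clo' E hc5 (w := b) (by
        rw [mem_insert, mem_N5]
        rintro (h | h)
        · tauto
        · omega) (gall _ k3)
      have := nb2 (T := T) (P := insert x (T.N5 x)) (w := b) (p := v) (q := p) (by simp [hv])
        (by rw [mem_insert, mem_N5]; exact Or.inr ⟨L.f1.bc, hp⟩)
        (T.symm L.f3.1) (T.symm L.f2.bc) (by tauto)
      omega
    · exact caseB _ _ _ _ L hp hq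
  · by_cases hq : T.d q = 5
    · exact caseB _ _ _ _ L.refl hq hp
    · have all : ∀ z, T.F x v z → T.d z ≠ 5 ∧ ∀ z2, T.F x z z2 → z2 ≠ v → T.d z2 ≠ 5 := by
        intro z hz
        rcases L.f1.sw2.three L.f5.rot2 (by tauto) hz with rfl | rfl
        · exact ⟨hp, fun z2 a b => caseD _ _ _ _ z2 L hp a b⟩
        · exact ⟨hq, fun z2 a b => caseD _ _ _ _ z2 L.refl hq a b⟩
      have hxv := hv'.1
      have inj : ∀ i, 0 < i → i < 7 → T.r x v i ≠ v := fun i h0 h7 e => by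
        have := r_inj hxv (i := i) (j := 0) (by omega) (by omega) e
        omega
      have a1 := all _ (F_r hxv 0)
      have a6 := all (T.r x v 6) (by
        have := F_r hxv 6
        rw [show 6 + 1 = T.d x by omega, r_d hxv] at this
        exact this.sw)
      have a2 := a1.2 _ (F_r hxv 1) (inj 2 (by omega) (by omega))
      have a5 := a6.2 _ (F_r hxv 5).sw (inj 5 (by omega) (by omega))
      have hi := card_N5_idx hxv
      have : (range (T.d x)).filter (fun i => T.d (T.r x v i) = 5) ⊆ {0, 3, 4} := by
        intro i hi
        rw [mem_filter, mem_range, hx] at hi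
        obtain ⟨i1, i2⟩ := hi
        interval_cases i
        · simp
        · exact (a1.1 i2).elim
        · exact (a2 i2).elim
        · simp
        · simp
        · exact (a5 i2).elim
        · exact (a6.1 i2).elim
      have := (card_le_card this).trans card_le_three
      omega

/-- the missing-face lemma -/
lemma miss {v p q x a : V} (hv : T.d v = 5) (vp : T.adj v p) (vq : T.adj v q) (vx : T.adj v x) (va : T.adj v a)
    (px : T.adj p x) (pa : T.adj p a) (qx : T.adj q x) (qa : T.adj q a) (hxa : ¬ T.adj x a)
    (npq : p ≠ q) (nxa : x ≠ a) :
    (¬ T.F v x p ∧ T.F v p a ∧ T.F v a q ∧ T.F v q x) ∨ (T.F v x p ∧ ¬ T.F v p a ∧ T.F v a q ∧ T.F v q x) ∨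
    (T.F v x p ∧ T.F v p a ∧ ¬ T.F v a q ∧ T.F v q x) ∨ (T.F v x p ∧ T.F v p a ∧ T.F v a q ∧ ¬ T.F v q x) := by
  have npa := ne pa
  have npx := ne px
  have nqx := ne qx
  have nqa := ne qa
  -- core version with `a` in the third place of the link
  have core : ∀ s1 s3 s4, T.L5 v x s1 a s3 s4 → 
      (¬ T.F v x p ∧ T.F v p a ∧ T.F v a q ∧ T.F v q x) ∨ (T.F v x p ∧ ¬ T.F v p a ∧ T.F v a q ∧ T.F v q x) ∨
      (T.F v x p ∧ T.F v p a ∧ ¬ T.F v a q ∧ T.F v q x) ∨ (T.F v x p ∧ T.F v p a ∧ T.F v a q ∧ ¬ T.F v q x) := by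
    intro s1 s3 s4 L
    have nd := L.nd
    simp only [List.nodup_cons, List.mem_cons, not_or] at nd
    have hp := L.nb p vp
    have hq := L.nb q vq
    have hp' : p = s1 ∨ p = s3 ∨ p = s4 := by clear hq nd; tauto
    have hq' : q = s1 ∨ q = s3 ∨ q = s4 := by clear hp hp' nd; tauto
    clear hp hq
    rcases hp' with rfl | rfl | rfl <;> rcases hq' with rfl | rfl | rfl
    · exact (npq rfl).elim
    · right; right; right
      refine ⟨L.f1, L.f2, L.f3, fun h => ?_⟩
      have := L.f3.sw.three L.f4 (by tauto) h
      tauto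
    · right; right; left
      refine ⟨L.f1, L.f2, fun h => ?_, L.f5⟩
      have := L.f2.sw.three L.f3 (by tauto) h
      tauto
    · left
      refine ⟨fun h => ?_, L.f3.sw, L.f2.sw, L.f1.sw⟩
      have := L.f1.three L.f5.sw (by tauto) h
      tauto
    · exact (npq rfl).elim
    · exact (L.x3 (T.symm qa) px).elim
    · right; left
      refine ⟨L.f5.sw, fun h => ?_, L.f2.sw, L.f1.sw⟩
      have := L.f2.sw.three L.f3 (by tauto) h.sw
      tauto
    · exact (L.x3 (T.symm pa) qx).elim
    · exact (npq rfl).elim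
  obtain ⟨s1, s2, s3, s4, L⟩ := exL5 hv vx
  rcases L.nb a va with rfl | rfl | rfl | rfl | rfl
  · exact (nxa rfl).elim
  · exact (hxa L.f1.bc).elim
  · exact core _ _ _ L
  · exact core _ _ _ L.refl
  · exact (hxa (T.symm L.f5.bc)).elim
end Tri
end FC


namespace FC
open Finset Function
open scoped Classical
namespace Tri
variable {V : Type} [Fintype V] {T : Tri V}

lemma b7_elim {v x y : V} (hv : T.d v = 5) (vx : T.adj v x) (hx : T.d x = 7) (vy : T.adj v y) (hy : 8 ≤ T.d y)
    (ho : ∀ u, T.adj v u → u ≠ x → u ≠ y → T.d u ≤ 6) : T.Elim (T.Qs v y) := by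
  obtain ⟨p, q, r, s, L⟩ := exL5 hv vy
  have nd := L.nd
  simp only [List.nodup_cons, List.mem_cons, not_or] at nd
  have ny : p ≠ y ∧ q ≠ y ∧ r ≠ y ∧ s ≠ y := by
    refine ⟨?_, ?_, ?_, ?_⟩ <;> rintro rfl <;> tauto
  have n1 : p ≠ q := by tauto
  have n2 : p ≠ r := by tauto
  have n3 : p ≠ s := by tauto
  have n4 : q ≠ r := by tauto
  have n5 : q ≠ s := by tauto
  have n6 : r ≠ s := by tauto
  have op := fun h => ho p L.f2.1 h ny.1
  have oq := fun h => ho q L.f3.1 h ny.2.1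
  have or' := fun h => ho r L.f4.1 h ny.2.2.1
  have os := fun h => ho s L.f5.1 h ny.2.2.2
  rcases L.nb x vx with rfl | rfl | rfl | rfl | rfl
  · omega
  · exact L.refl.elimB (os n3.symm) (or' n2.symm) (oq n1.symm) hx.le
  · exact L.refl.elimC (os n5.symm) (or' n4.symm) hx.le (op n1)
  · exact L.elimC (op n2) (oq n4) hx.le (os n6.symm)
  · exact L.elimB (op n3) (oq n5) (or' n6) hx.le

lemma MinCE.b7_N5 (hM : T.MinCE) {v x y w : V} (hv : T.d v = 5) (vx : T.adj v x) (hx : T.d x = 7)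
    (vy : T.adj v y) (hy : 8 ≤ T.d y)
    (ho : ∀ u, T.adj v u → u ≠ x → u ≠ y → T.d u ≤ 6) (hw : w ∈ T.N5 x) : w ∈ T.Qs v y := by
  have e := b7_elim hv vx hx vy hy ho
  rw [mem_N5] at hw
  refine hM.abs e (card_Qs hv vy).ge (g1 hw.2.le (Gone.base x ?_) (T.symm hw.1))
  rw [mem_Qs]
  exact Or.inr ⟨by rintro rfl; omega, vx⟩

lemma pq_bool {i1 i2 i3 i4 B1 B2 B3 B4 : Prop} (o1 : ¬ i1 → B1) (o4 : ¬ i4 → B4) (o2 : ¬ i2 → i1 ∨ i3 → B2)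
    (o3 : ¬ i3 → i2 ∨ i4 → B3) (b12 : B1 → B2 → False) (b13 : B1 → B3 → False) (b14 : B1 → B4 → False)
    (b23 : B2 → B3 → False) (b24 : B2 → B4 → False) (b34 : B3 → B4 → False) :
    (i1 ∨ i2) ∧ (i1 ∨ i3) ∧ (i1 ∨ i4) ∧ (i2 ∨ i3) ∧ (i2 ∨ i4) ∧ (i3 ∨ i4) := by
  by_cases i1 <;> by_cases i2 <;> by_cases i3 <;> by_cases i4 <;> simp_all

/-- inner neighbours of a demander -/
lemma all_adj {u v : V} {P : Finset V} (hP : P.card = 5) (hu : T.d u = 5) (huP : u ∈ P) (hv : v ∈ P)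
    (uv : T.adj u v) (hb : ∀ w z, T.F u w z → w ∉ P → z ∈ P → 8 ≤ T.d w)
    (hh : ∀ w w', T.adj u w → T.adj u w' → 8 ≤ T.d w → 8 ≤ T.d w' → w = w') :
    ∀ z ∈ P, z ≠ u → T.adj u z := by
  obtain ⟨s1, s2, s3, s4, L⟩ := exL5 hu uv
  have nd := L.nd
  simp only [List.nodup_cons, List.mem_cons, not_or] at nd
  have a1 := L.f2.1
  have a2 := L.f3.1
  have a3 := L.f4.1
  have a4 := L.f5.1
  have n12 : s1 ≠ s2 := by tauto
  have n13 : s1 ≠ s3 := by tauto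
  have n14 : s1 ≠ s4 := by tauto
  have n23 : s2 ≠ s3 := by tauto
  have n24 : s2 ≠ s4 := by tauto
  have n34 : s3 ≠ s4 := by tauto
  have key := pq_bool (i1 := s1 ∈ P) (i2 := s2 ∈ P) (i3 := s3 ∈ P) (i4 := s4 ∈ P) (B1 := 8 ≤ T.d s1)
    (B2 := 8 ≤ T.d s2) (B3 := 8 ≤ T.d s3) (B4 := 8 ≤ T.d s4)
    (fun h => hb _ _ L.f1.sw h hv) (fun h => hb _ _ L.f5 h hv)
    (fun h h' => h'.elim (hb _ _ L.f2.sw h) (hb _ _ L.f3 h))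
    (fun h h' => h'.elim (hb _ _ L.f3.sw h) (hb _ _ L.f4 h))
    (fun h h' => n12 (hh _ _ a1 a2 h h')) (fun h h' => n13 (hh _ _ a1 a3 h h'))
    (fun h h' => n14 (hh _ _ a1 a4 h h')) (fun h h' => n23 (hh _ _ a2 a3 h h'))
    (fun h h' => n24 (hh _ _ a2 a4 h h')) (fun h h' => n34 (hh _ _ a3 a4 h h'))
  have h1 : (T.N u \ P).card ≤ 1 := by
    rw [card_le_one]
    intro w hw w' hw'
    rw [mem_sdiff, mem_N] at hw hw'
    obtain ⟨hw, hwP⟩ := hw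
    obtain ⟨hw', hwP'⟩ := hw'
    clear nd
    rcases L.nb w hw with rfl | rfl | rfl | rfl | rfl <;> rcases L.nb w' hw' with rfl | rfl | rfl | rfl | rfl <;>
      simp_all
  have h2 := card_sdiff_add_card_inter (T.N u) P
  have h3 : (T.N u).card = 5 := hu
  have h4 : T.N u ∩ P = P.erase u := by
    apply eq_of_subset_of_card_le
    · intro z hz
      rw [mem_inter, mem_N] at hz
      rw [mem_erase]
      exact ⟨(ne hz.1).symm, hz.2⟩
    · rw [card_erase_of_mem huP]; omega
  intro z hz hzu
  have : z ∈ T.N u ∩ P := by rw [h4, mem_erase]; exact ⟨hzu, hz⟩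
  rw [mem_inter, mem_N] at this
  exact this.1

lemma parity {X1 X2 X3 A1 A2 A3 : Prop}
    (h1 : (¬ X1 ∧ A1 ∧ A2 ∧ X2) ∨ (X1 ∧ ¬ A1 ∧ A2 ∧ X2) ∨ (X1 ∧ A1 ∧ ¬ A2 ∧ X2) ∨ (X1 ∧ A1 ∧ A2 ∧ ¬ X2))
    (h2 : (¬ X1 ∧ A1 ∧ A3 ∧ X3) ∨ (X1 ∧ ¬ A1 ∧ A3 ∧ X3) ∨ (X1 ∧ A1 ∧ ¬ A3 ∧ X3) ∨ (X1 ∧ A1 ∧ A3 ∧ ¬ X3))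
    (h3 : (¬ X2 ∧ A2 ∧ A3 ∧ X3) ∨ (X2 ∧ ¬ A2 ∧ A3 ∧ X3) ∨ (X2 ∧ A2 ∧ ¬ A3 ∧ X3) ∨ (X2 ∧ A2 ∧ A3 ∧ ¬ X3)) :
    False := by
  by_cases X1 <;> by_cases X2 <;> by_cases X3 <;> by_cases A1 <;> by_cases A2 <;> simp_all

lemma MinCE.b7 (hM : T.MinCE) {v x y u1 u2 : V} (hv : T.d v = 5) (vx : T.adj v x) (hx : T.d x = 7)
    (vy : T.adj v y) (hy : 8 ≤ T.d y)
    (ho : ∀ u, T.adj v u → u ≠ x → u ≠ y → T.d u ≤ 6) (h1 : u1 ∈ T.N5 x) (h2 : u2 ∈ T.N5 x)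
    (n1 : u1 ≠ v) (n2 : u2 ≠ v) (n12 : u1 ≠ u2)
    (hh1 : ∀ w w', T.adj u1 w → T.adj u1 w' → 8 ≤ T.d w → 8 ≤ T.d w' → w = w')
    (hh2 : ∀ w w', T.adj u2 w → T.adj u2 w' → 8 ≤ T.d w → 8 ≤ T.d w' → w = w') : False := by
  have E := b7_elim hv vx hx vy hy ho
  have p1 := hM.b7_N5 hv vx hx vy hy ho h1
  have p2 := hM.b7_N5 hv vx hx vy hy ho h2
  have c5 := card_Qs hv vy
  rw [mem_N5] at h1 h2
  have nxy : x ≠ y := by rintro rfl; omega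
  have px : x ∈ T.Qs v y := by rw [mem_Qs]; exact Or.inr ⟨nxy, vx⟩
  have pv : v ∈ T.Qs v y := by rw [mem_Qs]; exact Or.inl rfl
  have nvx := ne vx
  have nx1' := ne h1.1
  have nx2' := ne h2.1
  -- the fifth vertex
  obtain ⟨a, ha⟩ : ∃ a, a ∈ T.Qs v y \ {v, x, u1, u2} := by
    rw [← Finset.Nonempty, ← card_pos]
    have := le_card_sdiff {v, x, u1, u2} (T.Qs v y)
    have := card_le_four (a := v) (b := x) (c := u1) (d := u2)
    omega
  simp only [mem_sdiff, mem_insert, mem_singleton, not_or] at ha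
  obtain ⟨pa, nav, nax, na1, na2⟩ := ha
  replace nav : a ≠ v := nav
  replace nax : a ≠ x := nax
  replace na1 : a ≠ u1 := na1
  replace na2 : a ≠ u2 := na2
  have va : T.adj v a := by rw [mem_Qs] at pa; tauto
  have nay : a ≠ y := by rw [mem_Qs] at pa; tauto
  have v1 : T.adj v u1 := by rw [mem_Qs] at p1; tauto
  have v2 : T.adj v u2 := by rw [mem_Qs] at p2; tauto
  have da := ho a va nax nay
  have eq : ∀ z ∈ T.Qs v y, z = v ∨ z = x ∨ z = u1 ∨ z = u2 ∨ z = a := by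
    have h5 : ({v, x, u1, u2, a} : Finset V) = T.Qs v y := by
      apply eq_of_subset_of_card_le
      · simp [insert_subset_iff, pv, px, p1, p2, pa]
      · rw [c5, card5]
        simp [nvx, n1.symm, n2.symm, nav.symm, nx1', nx2', nax.symm, n12, na1.symm, na2.symm]
    intro z hz
    rw [← h5] at hz
    simpa using hz
  -- `a` has a link neighbour different from `y`
  obtain ⟨z, hz, hzy⟩ : ∃ z, T.F v a z ∧ z ≠ y := by
    obtain ⟨b, c, d, e, L⟩ := exL5 hv va
    have nd := L.nd
    simp only [List.nodup_cons, List.mem_cons, not_or] at nd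
    by_cases hb : b = y
    · exact ⟨e, L.f5.sw, by rintro rfl; tauto⟩
    · exact ⟨b, L.f1, hb⟩
  have pz : z ∈ T.Qs v y := by rw [mem_Qs]; exact Or.inr ⟨hzy, hz.2.1⟩
  have gall : ∀ Z, T.Gone Z v → ∀ p ∈ T.Qs v y, T.Gone Z p := by
    intro Z gv
    have k1 : T.Gone Z u1 := g1 h1.2.le gv (T.symm v1)
    have k2 : T.Gone Z u2 := g1 h2.2.le gv (T.symm v2)
    have k3 : T.Gone Z x := g3 hx.le gv k1 k2 (T.symm vx) h1.1 h2.1 n1.symm n2.symm n12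
    have kz : T.Gone Z z := by
      rcases eq z pz with rfl | rfl | rfl | rfl | rfl
      · exact gv
      · exact k3
      · exact k1
      · exact k2
      · exact (ne hz.bc rfl).elim
    have k4 : T.Gone Z a := g2 da gv kz (T.symm va) hz.bc (ne hz.2.1)
    intro p hp
    rcases eq p hp with rfl | rfl | rfl | rfl | rfl <;> assumption
  have outv : ∀ w, w ∉ T.Qs v y → T.Gone {w} v → 6 + T.nb w (T.Qs v y) ≤ T.d w := fun w hw hg =>
    hM.clo' E c5.ge hw (gall _ hg)
  have hb : ∀ u, T.d u = 5 → T.adj v u → u ∈ T.Qs v y → ∀ w z, T.F u w z → w ∉ T.Qs v y → z ∈ T.Qs v y → 8 ≤ T.d w := by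
    intro u hu vu pu w z hf hw hz
    have := outv w hw (g1 hv.le (g1 hu.le g0 hf.1) vu)
    have := nb2 (T := T) (w := w) pu hz (T.symm hf.1) hf.bc (ne hf.2.1)
    omega
  have ad1 := all_adj c5 h1.2 p1 pv (T.symm v1) (hb u1 h1.2 v1 p1) hh1
  have ad2 := all_adj c5 h2.2 p2 pv (T.symm v2) (hb u2 h2.2 v2 p2) hh2
  have a12 := ad1 u2 p2 n12.symm
  have a1a := ad1 a pa na1
  have a2a := ad2 a pa na2
  have a1x := T.symm h1.1
  have a2x := T.symm h2.1
  have hxa : ¬ T.adj x a := by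
    intro hxa
    have full : ∀ z ∈ T.Qs v y, ∀ z' ∈ T.Qs v y, z ≠ z' → T.adj z z' := by
      have va' := T.symm va
      have vx' := T.symm vx
      have v1' := T.symm v1
      have v2' := T.symm v2
      have a12' := T.symm a12
      have a1a' := T.symm a1a
      have a2a' := T.symm a2a
      have hxa' := T.symm hxa
      have h11 := h1.1
      have h21 := h2.1
      intro z hz z' hz' hn
      rcases eq z hz with rfl | rfl | rfl | rfl | rfl <;> rcases eq z' hz' with rfl | rfl | rfl | rfl | rfl <;>
        first | assumption | exact (hn rfl).elim
    obtain ⟨p, q, r, s, L⟩ := exL5 hv vy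
    have nd := L.nd
    simp only [List.nodup_cons, List.mem_cons, not_or] at nd
    have hQ := L.Qs
    refine L.x2 (full p ?_ r ?_ ?_) (full q ?_ s ?_ ?_)
    · rw [hQ]; simp
    · rw [hQ]; simp
    · clear full; tauto
    · rw [hQ]; simp
    · rw [hQ]; simp
    · clear full; tauto
  have m0 := miss hv v1 v2 vx va a1x a1a a2x a2a hxa n12 nax.symm
  have m1 := miss h1.2 (T.symm v1) a12 a1x a1a vx va a2x a2a hxa n2.symm nax.symm
  have m2 := miss h2.2 (T.symm v2) (T.symm a12) a2x a2a vx va a1x a1a hxa n1.symm nax.symm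
  have e1 : T.F u1 x v ↔ T.F v x u1 := ⟨fun h => h.sw3, fun h => h.sw3⟩
  have e2 : T.F u1 v a ↔ T.F v u1 a := ⟨fun h => h.sw2, fun h => h.sw2⟩
  have e3 : T.F u2 x v ↔ T.F v u2 x := ⟨fun h => h.rot2, fun h => h.rot⟩
  have e4 : T.F u2 v a ↔ T.F v a u2 := ⟨fun h => h.rot, fun h => h.rot2⟩
  have e5 : T.F u2 a u1 ↔ T.F u1 a u2 := ⟨fun h => h.sw3, fun h => h.sw3⟩
  have e6 : T.F u2 u1 x ↔ T.F u1 u2 x := ⟨fun h => h.sw2, fun h => h.sw2⟩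
  rw [e1, e2] at m1
  rw [e3, e4, e5, e6] at m2
  refine parity m0 m1 ?_
  clear m0 m1
  tauto
end Tri
end FC


namespace FC
open Finset Function
open scoped Classical
namespace Tri
variable {V : Type} [Fintype V] {T : Tri V}

lemma L5.Qs_mem {v y p q r s w : V} (L : T.L5 v y p q r s) :
    w ∈ T.Qs v y ↔ w = s ∨ w = r ∨ w = q ∨ w = p ∨ w = v := by
  rw [L.Qs]; simp

/-- for degree nine, `x` meets `Q` in exactly the three consecutive vertices -/
lemma MinCE.A_N9 (hM : T.MinCE) {v x p q r s w : V} (h : T.IsA v x) (dx : T.d x = 9) (L : T.L5 v x p q r s)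
    (hw : w ∈ T.Qs v x) (xw : T.adj x w) : w = v ∨ w = p ∨ w = s := by
  have h1 := hM.A9' h
  have nd := L.nd
  simp only [List.nodup_cons, List.mem_cons, not_or] at nd
  have h2 : ({v, p, s} : Finset V) = (T.Qs v x).filter (fun w => T.adj x w) := by
    apply eq_of_subset_of_card_le
    · intro z hz
      simp only [mem_insert, mem_singleton] at hz
      rw [mem_filter, L.Qs_mem]
      rcases hz with rfl | rfl | rfl
      · exact ⟨by tauto, T.symm h.vx⟩
      · exact ⟨by tauto, L.f1.bc⟩
      · exact ⟨by tauto, T.symm L.f5.bc⟩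
    · have : ({v, p, s} : Finset V).card = 3 := by
        rw [card_eq_three]; exact ⟨v, p, s, by tauto, by tauto, by tauto, rfl⟩
      rw [this]
      have : T.nb x (T.Qs v x) = ((T.Qs v x).filter (fun w => T.adj x w)).card := by
        unfold nb; congr 1; ext z; simp [and_comm]
      omega
  have : w ∈ (T.Qs v x).filter (fun w => T.adj x w) := by rw [mem_filter]; exact ⟨hw, xw⟩
  rw [← h2] at this
  simpa using this

lemma exF5 {v a b : V} (hv : T.d v = 5) (h : T.F v a b) : ∃ c d e, T.L5 v a b c d e := by
  obtain ⟨p, q, r, s, L⟩ := exL5 hv h.1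
  have nd := L.nd
  simp only [List.nodup_cons, List.mem_cons, not_or] at nd
  rcases F.three L.f1 L.f5.sw (by tauto) h with rfl | rfl
  · exact ⟨_, _, _, L⟩
  · exact ⟨_, _, _, L.refl⟩

lemma F.other {v a b : V} (h : T.F v a b) (hd : 3 ≤ T.d v) : ∃ c, c ≠ b ∧ T.F v a c := by
  have key : T.nx v a ≠ T.nx a v := by
    intro e
    have e2 : T.r v a 2 = T.r v a 0 := by
      rw [r_succ, r_succ, r_zero, e, nx_pv h.1]
    have := r_inj h.1 (by omega) (by omega) e2
    omega
  rcases h.cases with rfl | rfl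
  · exact ⟨_, key.symm, F_pv h.1⟩
  · exact ⟨_, key, F_nx h.1⟩

set_option maxHeartbeats 1000000 in
lemma MinCE.side_core (hM : T.MinCE) {v x u b c e : V} (h : T.IsA v x) (dx : T.d x = 9) (du : T.d u = 5)
    (L : T.L5 v x u b c e) : ∃ y t, T.L5 u v x y t b ∧ 7 ≤ T.d y ∧ 8 ≤ T.d t ∧ T.d b ≤ 6 ∧
      ∀ w, T.adj u w → ¬ T.IsA w t := by
  have N9 := fun {w} => hM.A_N9 (w := w) h dx L
  obtain ⟨y, t, b', M⟩ := exF5 du L.f1.rot2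
  have nd := L.nd
  have md := M.nd
  simp only [List.nodup_cons, List.mem_cons, not_or] at nd md
  have hvu : v ≠ u := by tauto
  have hvb : v ≠ b := by tauto
  have hvc : v ≠ c := by tauto
  have hve : v ≠ e := by tauto
  have hxu : x ≠ u := by tauto
  have hxb : x ≠ b := by tauto
  have hxc : x ≠ c := by tauto
  have hxe : x ≠ e := by tauto
  have hub : u ≠ b := by tauto
  have huc : u ≠ c := by tauto
  have hue : u ≠ e := by tauto
  have hbc : b ≠ c := by tauto
  have hbe : b ≠ e := by tauto
  have hce : c ≠ e := by tauto
  obtain rfl : b = b' := by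
    rcases F.three M.f1 M.f5.sw (by tauto) L.f2.sw2 with h | h
    · exact (hxb h.symm).elim
    · exact h
  have huy : u ≠ y := by tauto
  have hut : u ≠ t := by tauto
  have hvy : v ≠ y := by tauto
  have hvt : v ≠ t := by tauto
  have hxy : x ≠ y := by tauto
  have hxt : x ≠ t := by tauto
  have hyt : y ≠ t := by tauto
  have hyb : y ≠ b := by tauto
  have htb : t ≠ b := by tauto
  clear nd md
  have uQ : u ∈ T.Qs v x := by rw [L.Qs_mem]; simp
  have bQ : b ∈ T.Qs v x := by rw [L.Qs_mem]; simp
  have cQ : c ∈ T.Qs v x := by rw [L.Qs_mem]; simp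
  have db : T.d b ≤ 6 := h.li b L.f3.1 hxb.symm
  have de : T.d e ≤ 6 := h.li e L.f5.1 hxe.symm
  have yQ : y ∉ T.Qs v x := by
    intro hy
    rcases N9 hy M.f2.bc with rfl | rfl | rfl
    · exact hvy rfl
    · exact huy rfl
    · have := clos3 M.f2.sw2 L.f5.rot2.sw L.f1.sw2
      omega
  have tQ : t ∉ T.Qs v x := by
    intro ht
    rw [L.Qs_mem] at ht
    rcases ht with rfl | rfl | rfl | rfl | rfl
    · obtain ⟨y', hy', f'⟩ := F.other L.f5.rot2.sw (by omega)
      have nyy : y' ≠ y := by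
        rintro rfl
        have := clos3 f'.rot2 M.f3.rot M.f2.rot2
        have := hM.d5 y'
        omega
      have nq : y' ∈ T.Qs v x → False := by
        intro hq
        rcases N9 hq f'.2.1 with rfl | rfl | rfl
        · exact hy' rfl
        · rcases F.three L.f1.rot M.f2.sw2 hvy f'.sw with h | h
          · exact hvt h.symm
          · exact hyt h.symm
        · exact ne f'.bc rfl
      have nv : y' ≠ v := hy'
      have nu : y' ≠ u := by rintro rfl; exact nq uQ
      have nb' : y' ≠ b := by rintro rfl; exact nq bQ
      have nc : y' ≠ c := by rintro rfl; exact nq cQ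
      have nx' : y' ≠ x := (ne f'.2.1).symm
      have hc : ({x, v, c, u, b, y, y'} : Finset V).card = 7 := by
        have : [x, v, c, u, b, y, y'].Nodup := by
          have hyc : y ≠ c := by rintro rfl; exact yQ cQ
          simp [hxc, hxu, hxb, hxy, nx'.symm, hvc, hvu, hvb, hvy, nv.symm, huc.symm, hbc.symm, hyc.symm, nc.symm,
            hub, huy, nu.symm, hyb.symm, nb'.symm, nyy.symm, (ne h.vx).symm]
        simpa using List.toFinset_card_of_nodup this
      have hs : ({x, v, c, u, b, y, y'} : Finset V) ⊆ T.N t := by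
        intro z hz
        simp only [mem_insert, mem_singleton] at hz
        rw [mem_N]
        rcases hz with rfl | rfl | rfl | rfl | rfl | rfl | rfl
        · exact L.f5.bc
        · exact T.symm L.f5.1
        · exact T.symm L.f4.bc
        · exact T.symm M.f4.1
        · exact M.f4.bc
        · exact T.symm M.f3.bc
        · exact f'.bc
      have := card_le_card hs
      have h7 : (T.N t).card ≤ 6 := de
      omega
    · have := clos3 M.f4.rot2.sw L.f2.rot2.sw L.f3.sw2
      have := hM.d5 b
      omega
    · exact htb rfl
    · exact hut rfl
    · exact hvt rfl
  have dy := hM.A_out h du uQ hvu.symm yQ M.f3.1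
  have dt := hM.A_out h du uQ hvu.symm tQ M.f4.1
  have ny := nb1 (T := T) (w := y) uQ (T.symm M.f3.1)
  have nt := nb2 (T := T) (w := t) uQ bQ (T.symm M.f4.1) M.f4.bc hub
  refine ⟨y, t, M, by omega, by omega, db, ?_⟩
  intro w uw hw
  have dw := hw.dv
  rcases M.nb w uw with rfl | rfl | rfl | rfl | rfl
  · have := hw.li x h.vx hxt
    omega
  · omega
  · omega
  · omega
  · have hs := hM.A_sub h hw du uQ (by rw [mem_Qs]; exact Or.inr ⟨hut, M.f5.rot.2.1⟩) hub
    obtain ⟨p, q, r, K⟩ := exF5 dw L.f2.rot2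
    have kd := K.nd
    simp only [List.nodup_cons, List.mem_cons, not_or] at kd
    have k1 : v ≠ p := kd.2.1.2.1
    have k2 : u ≠ r := kd.2.2.1.2.2.1
    have k3 : q ≠ p := fun h => kd.2.2.2.1.1 h.symm
    have k4 : q ≠ r := kd.2.2.2.2.1.1
    have k5 : q ≠ u := fun h => kd.2.2.1.2.1 h.symm
    have k6 : q ≠ v := fun h => kd.2.1.2.2.1 h.symm
    have k7 : q ≠ w := fun h => kd.1.2.2.2.1 h.symm
    clear kd
    obtain rfl : t = p := by
      rcases F.three K.f1.sw K.f2 k1 M.f4.rot2 with h | h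
      · exact (hvt h.symm).elim
      · exact h
    obtain rfl : c = r := by
      rcases F.three K.f1 K.f5.sw k2 L.f3.sw2 with h | h
      · exact (huc h.symm).elim
      · exact h
    have zq : q ∈ T.Qs v x := by
      rw [← hs, mem_Qs]; exact Or.inr ⟨k3, K.f4.1⟩
    rw [L.Qs_mem] at zq
    have : q = e := by
      clear hs N9
      rcases zq with rfl | rfl | rfl | rfl | rfl
      · rfl
      · exact (k4 rfl).elim
      · exact (k7 rfl).elim
      · exact (k5 rfl).elim
      · exact (k6 rfl).elim
    subst this
    have := clos3 L.f3.rot2 K.f4.rot2 L.f4.rot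
    have := hM.d5 c
    omega

lemma MinCE.side (hM : T.MinCE) {v x u : V} (h : T.IsA v x) (dx : T.d x = 9) (du : T.d u = 5)
    (ux : T.adj u x) (uv : T.adj u v) : ∃ y t b, T.L5 u v x y t b ∧ 7 ≤ T.d y ∧ 8 ≤ T.d t ∧ T.d b ≤ 6 ∧
      ∀ w, T.adj u w → ¬ T.IsA w t := by
  obtain ⟨p, q, r, s, L⟩ := exL5 h.dv h.vx
  have uQ : u ∈ T.Qs v x := by rw [mem_Qs]; exact Or.inr ⟨ne ux, T.symm uv⟩
  rcases hM.A_N9 h dx L uQ (T.symm ux) with rfl | rfl | rfl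
  · exact (ne uv rfl).elim
  · obtain ⟨y, t, h⟩ := hM.side_core h dx du L
    exact ⟨y, t, _, h⟩
  · obtain ⟨y, t, h⟩ := hM.side_core h dx du L.refl
    exact ⟨y, t, _, h⟩

end Tri
end FC


namespace FC
open Finset Function
open scoped Classical
namespace Tri
variable {V : Type} [Fintype V] {T : Tri V}

/-- `u` has one `7`-neighbour `x` and one large neighbour, the rest being small. -/
def B7 (T : Tri V) (u x : V) : Prop :=
  ∃ y, T.adj u y ∧ 8 ≤ T.d y ∧ ∀ w, T.adj u w → w ≠ x → w ≠ y → T.d w ≤ 6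
def H1 (T : Tri V) (u : V) : Prop :=
  ∀ w w', T.adj u w → T.adj u w' → 8 ≤ T.d w → 8 ≤ T.d w' → w = w'
def SideAt (T : Tri V) (u v x : V) : Prop := T.IsA v x ∧ T.d x = 9 ∧ T.adj u v ∧ T.adj u x

structure Dem (T : Tri V) (u : V) (f : V → ℚ) : Prop where
  sum : ∑ x ∈ T.N u, f x = 1
  p1 : ∀ x, T.adj u x → T.d x ≤ 6 → f x ≤ 0
  p2 : ∀ x, T.adj u x → T.d x = 7 → f x ≤ 1/2
  p3 : ∀ x, T.adj u x → T.d x = 7 → f x ≤ 1/3 ∨ T.B7 u x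
  p4 : ∀ x, T.adj u x → T.d x = 7 → f x ≤ 1/4 ∨ T.B7 u x ∨ ∀ w, T.adj u w → T.d w ≤ 7
  p5 : ∀ x, T.adj u x → T.d x = 7 → f x ≤ 0 ∨ T.H1 u ∨ ∃ v x', T.SideAt u v x'
  p6 : ∀ x, T.adj u x → f x ≤ 1
  p7 : ∀ x, T.adj u x → 8 ≤ T.d x → f x ≤ 1/2 ∨ T.IsA u x
  p8 : ∀ v x, T.SideAt u v x → f x ≤ 1/4

noncomputable def ff (T : Tri V) (α β : ℚ) (x : V) : ℚ :=
  (if 8 ≤ T.d x then α else 0) + (if T.d x = 7 then β else 0)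

lemma ff_sum (u : V) (α β : ℚ) : ∑ x ∈ T.N u, T.ff α β x =
    ((T.N u).filter (fun x => 8 ≤ T.d x)).card * α + ((T.N u).filter (fun x => T.d x = 7)).card * β := by
  simp only [ff, sum_add_distrib]
  rw [← sum_filter, ← sum_filter, sum_const, sum_const, nsmul_eq_mul, nsmul_eq_mul]

lemma ff6 {x : V} {α β : ℚ} (h : T.d x ≤ 6) : T.ff α β x = 0 := by
  rw [ff, if_neg (by omega), if_neg (by omega)]; norm_num
lemma ff7 {x : V} {α β : ℚ} (h : T.d x = 7) : T.ff α β x = β := by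
  rw [ff, if_neg (by omega), if_pos (by omega)]; norm_num
lemma ff8 {x : V} {α β : ℚ} (h : 8 ≤ T.d x) : T.ff α β x = α := by
  rw [ff, if_pos (by omega), if_neg (by omega)]; norm_num

lemma MinCE.dem (hM : T.MinCE) {u : V} (hu : T.d u = 5) : ∃ f, T.Dem u f := by
  by_cases hA : ∃ z, T.IsA u z
  · obtain ⟨z, hz⟩ := hA
    have d9 := hM.A9 hz
    have f1 : ∀ x, x ≠ z → (if x = z then (1 : ℚ) else 0) = 0 := fun x h => if_neg h
    refine ⟨fun x => if x = z then 1 else 0, ?_, ?_, ?_, ?_, ?_, ?_, ?_, ?_, ?_⟩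
    · rw [sum_ite_eq', if_pos (mem_N.2 hz.vx)]
    · intro x _ hx; rw [f1 x (by rintro rfl; omega)]
    · intro x _ hx; rw [f1 x (by rintro rfl; omega)]; norm_num
    · intro x _ hx; rw [f1 x (by rintro rfl; omega)]; norm_num
    · intro x _ hx; rw [f1 x (by rintro rfl; omega)]; norm_num
    · intro x _ hx; rw [f1 x (by rintro rfl; omega)]; norm_num
    · intro x _; split_ifs <;> norm_num
    · intro x _ hx
      by_cases h : x = z
      · subst h; exact Or.inr hz
      · rw [f1 x h]; norm_num
    · intro v x ⟨h1, h2, h3, h4⟩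
      rw [f1 x ?_]
      · norm_num
      · rintro rfl; exact hM.AA hz h1 h3
  by_cases hS : ∃ v x, T.SideAt u v x
  · obtain ⟨v, x, h1, h2, h3, h4⟩ := id hS
    obtain ⟨y, t, b, L, dy, dt, db, hw⟩ := hM.side h1 h2 hu h4 h3
    have nd := L.nd
    simp only [List.nodup_cons, List.mem_cons, not_or] at nd
    have nxy : x ≠ y := by tauto
    have nxt : x ≠ t := by tauto
    have nyt : y ≠ t := by tauto
    have hp : ∀ z : V, (if z = t then (1/2 : ℚ) else if z = x ∨ z = y then 1/4 else 0) ≤ 1/2 := by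
      intro z; split_ifs <;> norm_num
    have hq : ∀ z : V, z ≠ t → (if z = t then (1/2 : ℚ) else if z = x ∨ z = y then 1/4 else 0) ≤ 1/4 := by
      intro z hz; rw [if_neg hz]; split_ifs <;> norm_num
    refine ⟨fun z => if z = t then 1/2 else if z = x ∨ z = y then 1/4 else 0, ?_, ?_, ?_, ?_, ?_, ?_, ?_, ?_, ?_⟩
    · have hs : ({x, y, t} : Finset V) ⊆ T.N u := by
        intro z hz
        simp only [mem_insert, mem_singleton] at hz
        rw [mem_N]
        rcases hz with rfl | rfl | rfl
        · exact h4
        · exact L.f3.1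
        · exact L.f4.1
      rw [← sum_subset hs, sum_insert (by simp [nxy, nxt]), sum_insert (by simp [nyt]), sum_singleton]
      · rw [if_neg nxt, if_neg nyt]; norm_num
      · intro z _ hz
        simp only [mem_insert, mem_singleton, not_or] at hz
        rw [if_neg hz.2.2, if_neg (by tauto)]
    · intro z _ hz
      rw [if_neg (by rintro rfl; omega), if_neg (by rintro (rfl | rfl) <;> omega)]
    · intro z _ hz; exact hp z
    · intro z _ hz; exact Or.inl ((hq z (by rintro rfl; omega)).trans (by norm_num))
    · intro z _ hz; exact Or.inl (hq z (by rintro rfl; omega))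
    · intro z _ hz; exact Or.inr (Or.inr hS)
    · intro z _; exact (hp z).trans (by norm_num)
    · intro z _ hz; exact Or.inl (hp z)
    · intro v' z ⟨k1, k2, k3, k4⟩
      exact hq z (by rintro rfl; exact hw _ k3 k1)
  have p8 : ∀ (f : V → ℚ) v x, T.SideAt u v x → f x ≤ 1/4 := fun f v x h => (hS ⟨v, x, h⟩).elim
  by_cases h2 : T.H1 u
  swap
  · have h2' := h2
    unfold H1 at h2
    push Not at h2
    obtain ⟨w, w', a, a', hd, hd', hn⟩ := h2
    have hc : 2 ≤ ((T.N u).filter (fun x => 8 ≤ T.d x)).card := by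
      rw [← card_pair hn]
      apply card_le_card
      intro z hz
      simp only [mem_insert, mem_singleton] at hz
      rw [mem_filter, mem_N]
      rcases hz with rfl | rfl <;> constructor <;> assumption
    have hc' : (2:ℚ) ≤ ((T.N u).filter (fun x => 8 ≤ T.d x)).card := by exact_mod_cast hc
    have hle : (1 : ℚ) / ((T.N u).filter (fun x => 8 ≤ T.d x)).card ≤ 1/2 := by
      rw [div_le_div_iff₀ (by linarith) (by norm_num)]; linarith
    refine ⟨T.ff (1 / ((T.N u).filter (fun x => 8 ≤ T.d x)).card) 0, ?_, ?_, ?_, ?_, ?_, ?_, ?_, ?_, p8 _⟩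
    · rw [ff_sum, mul_zero, add_zero, mul_one_div, div_self (by linarith)]
    · intro x _ hx; rw [ff6 hx]
    · intro x _ hx; rw [ff7 hx]; norm_num
    · intro x _ hx; rw [ff7 hx]; norm_num
    · intro x _ hx; rw [ff7 hx]; norm_num
    · intro x _ hx; rw [ff7 hx]; norm_num
    · intro x _
      rcases (by omega : T.d x ≤ 6 ∨ T.d x = 7 ∨ 8 ≤ T.d x) with h | h | h
      · rw [ff6 h]; norm_num
      · rw [ff7 h]; norm_num
      · rw [ff8 h]; linarith
    · intro x _ hx; rw [ff8 hx]; exact Or.inl hle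
  by_cases hy : ∃ y, T.adj u y ∧ 8 ≤ T.d y
  · obtain ⟨y, uy, dy⟩ := hy
    have hH : (T.N u).filter (fun x => 8 ≤ T.d x) = {y} := by
      ext z
      rw [mem_filter, mem_N, mem_singleton]
      constructor
      · rintro ⟨h, h'⟩; exact h2 _ _ h uy h' dy
      · rintro rfl; exact ⟨uy, dy⟩
    have ht0 : 1 ≤ ((T.N u).filter (fun x => T.d x = 7)).card := by
      rw [Nat.one_le_iff_ne_zero, ← Nat.pos_iff_ne_zero, card_pos]
      by_contra hne
      rw [not_nonempty_iff_eq_empty] at hne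
      refine hA ⟨y, hu, uy, by omega, ?_⟩
      intro w uw hwy
      by_contra hw
      by_cases h7 : T.d w = 7
      · have : w ∈ (T.N u).filter (fun x => T.d x = 7) := by rw [mem_filter, mem_N]; exact ⟨uw, h7⟩
        rw [hne] at this; simp at this
      · exact hwy (h2 _ _ uw uy (by omega) dy)
    have hB : ∀ x, T.adj u x → T.d x = 7 → ((T.N u).filter (fun x => T.d x = 7)).card ≤ 1 → T.B7 u x := by
      intro x ux hx hc
      refine ⟨y, uy, dy, ?_⟩
      intro w uw hwx hwy
      by_contra hw
      by_cases h7 : T.d w = 7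
      · rw [card_le_one] at hc
        exact hwx (hc w (by rw [mem_filter, mem_N]; exact ⟨uw, h7⟩) x (by rw [mem_filter, mem_N]; exact ⟨ux, hx⟩))
      · exact hwy (h2 _ _ uw uy (by omega) dy)
    have ff_s := T.ff_sum u (1/2) (1 / (2 * ((T.N u).filter (fun x => T.d x = 7)).card))
    rw [hH, card_singleton] at ff_s
    generalize ((T.N u).filter (fun x => T.d x = 7)).card = t at *
    have ht : (1:ℚ) ≤ t := by exact_mod_cast ht0
    have b2 : 1 / (2 * (t : ℚ)) ≤ 1/2 := by
      rw [div_le_div_iff₀ (by linarith) (by norm_num)]; linarith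
    have b4 : 2 ≤ t → 1 / (2 * (t : ℚ)) ≤ 1/4 := by
      intro h
      have : (2:ℚ) ≤ t := by exact_mod_cast h
      rw [div_le_div_iff₀ (by linarith) (by norm_num)]; linarith
    refine ⟨T.ff (1/2) (1 / (2 * t)), ?_, ?_, ?_, ?_, ?_, ?_, ?_, ?_, p8 _⟩
    · rw [ff_s]; field_simp; norm_num
    · intro x _ hx; rw [ff6 hx]
    · intro x _ hx; rw [ff7 hx]; exact b2
    · intro x ux hx; rw [ff7 hx]
      by_cases h : 2 ≤ t
      · exact Or.inl ((b4 h).trans (by norm_num))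
      · exact Or.inr (hB x ux hx (by omega))
    · intro x ux hx; rw [ff7 hx]
      by_cases h : 2 ≤ t
      · exact Or.inl (b4 h)
      · exact Or.inr (Or.inl (hB x ux hx (by omega)))
    · intro x _ hx; exact Or.inr (Or.inl h2)
    · intro x _
      rcases (by omega : T.d x ≤ 6 ∨ T.d x = 7 ∨ 8 ≤ T.d x) with h | h | h
      · rw [ff6 h]; norm_num
      · rw [ff7 h]; linarith
      · rw [ff8 h]; norm_num
    · intro x _ hx; rw [ff8 hx]; norm_num
  · push Not at hy
    have hy' : ∀ w, T.adj u w → T.d w ≤ 7 := fun w h => Nat.lt_succ_iff.1 (hy w h)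
    have t3 := hM.t3 hu hy'
    have hH : (T.N u).filter (fun x => 8 ≤ T.d x) = ∅ := by
      rw [filter_eq_empty_iff]
      intro x hx
      have := hy x (mem_N.1 hx)
      omega
    have ff_s := T.ff_sum u 0 (1 / (((T.N u).filter (fun x => T.d x = 7)).card))
    rw [hH, card_empty] at ff_s
    generalize ((T.N u).filter (fun x => T.d x = 7)).card = t at *
    have ht : (3:ℚ) ≤ t := by exact_mod_cast t3
    have b3 : 1 / (t : ℚ) ≤ 1/3 := by
      rw [div_le_div_iff₀ (by linarith) (by norm_num)]; linarith
    refine ⟨T.ff 0 (1 / t), ?_, ?_, ?_, ?_, ?_, ?_, ?_, ?_, p8 _⟩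
    · rw [ff_s]; field_simp; norm_num
    · intro x _ hx; rw [ff6 hx]
    · intro x _ hx; rw [ff7 hx]; linarith
    · intro x _ hx; rw [ff7 hx]; exact Or.inl b3
    · intro x _ hx; exact Or.inr (Or.inr hy')
    · intro x _ hx; exact Or.inr (Or.inl h2)
    · intro x _
      rcases (by omega : T.d x ≤ 6 ∨ T.d x = 7 ∨ 8 ≤ T.d x) with h | h | h
      · rw [ff6 h]; norm_num
      · rw [ff7 h]; linarith
      · rw [ff8 h]; norm_num
    · intro x _ hx; rw [ff8 hx]; norm_num

end Tri
end FC


namespace FC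
open Finset Function
open scoped Classical
namespace Tri
variable {V : Type} [Fintype V] {T : Tri V}

lemma SideAt.mem {u v x : V} (h : T.SideAt u v x) : u ∈ T.Qs v x ∧ u ≠ v := by
  obtain ⟨h1, h2, h3, h4⟩ := h
  refine ⟨?_, ne h3⟩
  rw [mem_Qs]; exact Or.inr ⟨ne h4, T.symm h3⟩

lemma MinCE.bud7 (hM : T.MinCE) {f : V → V → ℚ} (hf : ∀ u, T.d u = 5 → T.Dem u (f u)) {x : V} (hx : T.d x = 7) :
    ∑ u ∈ T.N5 x, f u x ≤ 1 := by
  have D : ∀ u ∈ T.N5 x, T.Dem u (f u) ∧ T.adj u x := fun u hu => ⟨hf u (mem_N5.1 hu).2, T.symm (mem_N5.1 hu).1⟩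
  by_cases hB : ∃ v ∈ T.N5 x, T.B7 v x
  · obtain ⟨v, hv, y, vy, dy, ho⟩ := hB
    have vx := (D v hv).2
    have dv := (mem_N5.1 hv).2
    have nS : ∀ u ∈ T.N5 x, ∀ v' x', ¬ T.SideAt u v' x' := by
      intro u hu v' x' hS
      have hm := hS.mem
      have hP := hM.b7_N5 dv vx hx vy dy ho hu
      have du := (mem_N5.1 hu).2
      have hA := hS.1
      have hsub : T.Qs v' x' = T.Qs v y := by
        apply eq_of_subset_of_card_le
        · intro p hp
          refine hM.abs (b7_elim dv vx hx vy dy ho) (card_Qs dv vy).ge ?_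
          exact (hA.gone hm.1 du hm.2 p hp).mono (by simpa using hP)
        · rw [card_Qs dv vy, card_Qs hA.dv hA.vx]
      have hxP : x ∈ T.Qs v' x' := by
        rw [hsub, mem_Qs]; exact Or.inr ⟨by rintro rfl; omega, vx⟩
      rw [mem_Qs] at hxP
      have := hA.dv
      rcases hxP with rfl | ⟨h1, h2⟩
      · omega
      · have := hA.li x h2 h1
        omega
    have hH : ∀ u ∈ T.N5 x, 0 < f u x → T.H1 u := by
      intro u hu hp
      rcases (D u hu).1.p5 x (D u hu).2 hx with h | h | ⟨v', x', h⟩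
      · linarith
      · exact h
      · exact (nS u hu v' x' h).elim
    have hc : (((T.N5 x).filter (fun u => 0 < f u x)).erase v).card ≤ 1 := by
      rw [card_le_one]
      intro u1 h1 u2 h2
      by_contra hn
      rw [mem_erase, mem_filter] at h1 h2
      exact hM.b7 dv vx hx vy dy ho h1.2.1 h2.2.1 h1.1 h2.1 hn (hH _ h1.2.1 h1.2.2) (hH _ h2.2.1 h2.2.2)
    have hc2 : ((T.N5 x).filter (fun u => 0 < f u x)).card ≤ 2 := by
      have := pred_card_le_card_erase (s := (T.N5 x).filter (fun u => 0 < f u x)) (a := v)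
      omega
    have h1 : ∑ u ∈ T.N5 x, f u x ≤ ∑ u ∈ (T.N5 x).filter (fun u => 0 < f u x), f u x := by
      rw [sum_filter]
      apply sum_le_sum
      intro u _
      split_ifs with h
      · exact le_rfl
      · exact not_lt.1 h
    have h2 := sum_le_card_nsmul ((T.N5 x).filter (fun u => 0 < f u x)) (fun u => f u x) (1/2) (by
      intro u hu
      rw [mem_filter] at hu
      exact (D u hu.1).1.p2 x (D u hu.1).2 hx)
    rw [nsmul_eq_mul] at h2
    have : (((T.N5 x).filter (fun u => 0 < f u x)).card : ℚ) ≤ 2 := by exact_mod_cast hc2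
    linarith
  · push Not at hB
    have hz := hM.Zd (x := x)
    by_cases h4 : (T.N5 x).card = 4
    · have h2 := sum_le_card_nsmul (T.N5 x) (fun u => f u x) (1/4) (by
        intro u hu
        rcases (D u hu).1.p4 x (D u hu).2 hx with h | h | h
        · exact h
        · exact (hB u hu h).elim
        · exact (hM.c7 hx h4 hu h).elim)
      rw [nsmul_eq_mul, h4] at h2
      norm_num at h2
      exact h2
    · have h2 := sum_le_card_nsmul (T.N5 x) (fun u => f u x) (1/3) (by
        intro u hu
        rcases (D u hu).1.p3 x (D u hu).2 hx with h | h
        · exact h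
        · exact (hB u hu h).elim)
      rw [nsmul_eq_mul] at h2
      have : ((T.N5 x).card : ℚ) ≤ 3 := by exact_mod_cast (by omega : (T.N5 x).card ≤ 3)
      linarith

lemma MinCE.bud8 (hM : T.MinCE) {f : V → V → ℚ} (hf : ∀ u, T.d u = 5 → T.Dem u (f u)) {x : V} (hx : T.d x = 8) :
    ∑ u ∈ T.N5 x, f u x ≤ 2 := by
  have hz := hM.Zd (x := x)
  have h2 := sum_le_card_nsmul (T.N5 x) (fun u => f u x) (1/2) (by
    intro u hu
    rw [mem_N5] at hu
    rcases (hf u hu.2).p7 x (T.symm hu.1) hx.ge with h | h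
    · exact h
    · have := hM.A9 h
      omega)
  rw [nsmul_eq_mul] at h2
  have : ((T.N5 x).card : ℚ) ≤ 4 := by exact_mod_cast (by omega : (T.N5 x).card ≤ 4)
  linarith

lemma MinCE.A_dis (hM : T.MinCE) {v v' x w : V} (h : T.IsA v x) (h' : T.IsA v' x) (hn : v ≠ v')
    (h1 : w ∈ T.Qs v x) (h2 : w ∈ T.Qs v' x) : False := by
  have aa := hM.AA h h'
  rw [mem_Qs] at h2
  rcases h2 with rfl | ⟨h3, h4⟩
  · rw [mem_Qs] at h1
    rcases h1 with rfl | ⟨_, h1⟩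
    · exact hn rfl
    · exact aa h1
  · have := hM.A_five h h'.dv h1 h4
    rw [mem_Qs] at this
    rcases this with rfl | ⟨_, h1⟩
    · exact hn rfl
    · exact aa h1

noncomputable def As (T : Tri V) (x : V) : Finset V := (T.N5 x).filter (fun v => T.IsA v x)

lemma mem_As {v x : V} : v ∈ T.As x ↔ T.IsA v x := by
  rw [As, mem_filter, mem_N5]
  exact ⟨fun h => h.2, fun h => ⟨⟨T.symm h.vx, h.dv⟩, h⟩⟩

lemma MinCE.A3 (hM : T.MinCE) (x : V) : 3 * (T.As x).card ≤ T.d x := by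
  have h1 : ((T.As x).biUnion fun v => T.N x ∩ T.Qs v x).card = ∑ v ∈ T.As x, (T.N x ∩ T.Qs v x).card := by
    apply card_biUnion
    intro v hv v' hv' hn
    change Disjoint _ _
    rw [Finset.disjoint_left]
    intro w hw hw'
    rw [mem_inter] at hw hw'
    exact hM.A_dis (mem_As.1 hv) (mem_As.1 hv') hn hw.2 hw'.2
  have h2 : (T.As x).card • 3 ≤ ∑ v ∈ T.As x, (T.N x ∩ T.Qs v x).card := by
    apply card_nsmul_le_sum
    intro v hv
    obtain ⟨p, q, r, s, L⟩ := exL5 (mem_As.1 hv).dv (mem_As.1 hv).vx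
    exact L.ends
  have h3 : ((T.As x).biUnion fun v => T.N x ∩ T.Qs v x).card ≤ (T.N x).card := by
    apply card_le_card
    intro w hw
    rw [mem_biUnion] at hw
    obtain ⟨v, _, h⟩ := hw
    exact (mem_inter.1 h).1
  have h4 : (T.N x).card = T.d x := rfl
  rw [smul_eq_mul] at h2
  omega

lemma MinCE.budgen (hM : T.MinCE) {f : V → V → ℚ} (hf : ∀ u, T.d u = 5 → T.Dem u (f u)) {x : V} (hx : 9 ≤ T.d x) :
    2 * ∑ u ∈ T.N5 x, f u x ≤ (T.N5 x).card + (T.As x).card := by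
  have h : ∑ u ∈ T.N5 x, f u x ≤ ∑ u ∈ T.N5 x, (1/2 + if T.IsA u x then (1/2 : ℚ) else 0) := by
    apply sum_le_sum
    intro u hu
    rw [mem_N5] at hu
    split_ifs with h
    · linarith [(hf u hu.2).p6 x (T.symm hu.1)]
    · rcases (hf u hu.2).p7 x (T.symm hu.1) (by omega) with h' | h'
      · linarith
      · exact (h h').elim
  rw [sum_add_distrib, ← sum_filter, sum_const, sum_const, nsmul_eq_mul, nsmul_eq_mul] at h
  change _ ≤ _ + ((T.As x).card : ℚ) * _ at h
  linarith

end Tri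
end FC


namespace FC
open Finset Function
open scoped Classical
namespace Tri
variable {V : Type} [Fintype V] {T : Tri V}

lemma MinCE.near (hM : T.MinCE) {x u : V} (xu : T.adj x u) {i k : ℕ} (h : T.IsA (T.r x u i) x)
    (hd : T.d (T.r x u k) = 5) (h1 : k ≤ i + 2) (h2 : i ≤ k + 2) : T.r x u k ∈ T.Qs (T.r x u i) x := by
  have one : ∀ m, m = i + 1 ∨ i = m + 1 → T.r x u m ∈ T.Qs (T.r x u i) x := by
    intro m hm
    rw [mem_Qs]
    refine Or.inr ⟨(ne (r_adj xu m)).symm, ?_⟩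
    rcases hm with rfl | rfl
    · exact r_adj_succ xu i
    · exact T.symm (r_adj_succ xu m)
  rcases (by omega : k = i ∨ (k = i + 1 ∨ i = k + 1) ∨ k = i + 2 ∨ i = k + 2) with rfl | h | rfl | rfl
  · rw [mem_Qs]; exact Or.inl rfl
  · exact one k h
  · exact hM.A_five h hd (one (i+1) (Or.inl rfl)) (T.symm (r_adj_succ xu (i+1)))
  · exact hM.A_five h hd (one (k+1) (Or.inr rfl)) (r_adj_succ xu k)

lemma MinCE.excl (hM : T.MinCE) {x u : V} (xu : T.adj x u) {i j k : ℕ} (h : T.IsA (T.r x u i) x)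
    (h' : T.IsA (T.r x u j) x) (hn : T.r x u i ≠ T.r x u j)
    (hi : k ≤ i + 2 ∧ i ≤ k + 2) (hj : k ≤ j + 2 ∧ j ≤ k + 2) : T.d (T.r x u k) ≠ 5 := fun hd =>
  hM.A_dis h h' hn (hM.near xu h hd hi.1 hi.2) (hM.near xu h' hd hj.1 hj.2)

lemma r_per {x u : V} (xu : T.adj x u) (k : ℕ) : T.r x u (k + T.d x) = T.r x u k := by
  rw [← r_modd xu, Nat.add_mod_right, r_modd xu]

/-- two type A neighbours are at cyclic distance at least three -/
lemma MinCE.gap (hM : T.MinCE) {x u : V} (xu : T.adj x u) {i j : ℕ} (h : T.IsA (T.r x u i) x)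
    (h' : T.IsA (T.r x u j) x) (hn : T.r x u i ≠ T.r x u j) (hij : i ≤ j) : i + 3 ≤ j := by
  by_contra hc
  exact hM.excl xu h h' hn (k := i) (by omega) (by omega) h.dv

lemma MinCE.ten (hM : T.MinCE) {x : V} (hx : T.d x = 10) (ha : (T.As x).card = 3) : (T.N5 x).card ≤ 5 := by
  obtain ⟨u, w1, w2, n1, n2, n12, e⟩ := card_eq_three.1 ha
  have Au : T.IsA u x := by rw [← mem_As, e]; simp
  have A1 : T.IsA w1 x := by rw [← mem_As, e]; simp
  have A2 : T.IsA w2 x := by rw [← mem_As, e]; simp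
  clear e ha
  have xu := T.symm Au.vx
  wlog hw : ∃ i j, i < j ∧ j < 10 ∧ T.r x u i = w1 ∧ T.r x u j = w2 generalizing w1 w2
  · obtain ⟨i, hi, ei⟩ := r_lt xu (T.symm A1.vx)
    obtain ⟨j, hj, ej⟩ := r_lt xu (T.symm A2.vx)
    rcases lt_trichotomy i j with h | h | h
    · exact (hw ⟨i, j, h, by omega, ei, ej⟩).elim
    · subst h; exact (n12 (ei.symm.trans ej)).elim
    · exact this w2 w1 n2 n1 n12.symm A2 A1 ⟨j, i, h, by omega, ej, ei⟩
  obtain ⟨i, j, hij, hj, rfl, rfl⟩ := hw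
  have A0 : T.IsA (T.r x u 0) x := by rw [r_zero]; exact Au
  have e10 : T.r x u 10 = u := by have := r_d xu; rwa [hx] at this
  have A10 : T.IsA (T.r x u 10) x := by rw [e10]; exact Au
  have m1 : T.r x u 0 ≠ T.r x u i := by rw [r_zero]; exact n1
  have m2 : T.r x u j ≠ T.r x u 10 := by rw [e10]; exact n2.symm
  have g1 := hM.gap xu A0 A1 m1 (by omega)
  have g2 := hM.gap xu A1 A2 n12 (by omega)
  have g3 := hM.gap xu A2 A10 m2 (by omega)
  have x1 := fun k => hM.excl xu A0 A1 m1 (k := k)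
  have x2 := fun k => hM.excl xu A1 A2 n12 (k := k)
  have x3 := fun k => hM.excl xu A2 A10 m2 (k := k)
  have key : ∃ S : Finset ℕ, S.card = 5 ∧ ∀ k < 10, k ∉ S → T.d (T.r x u k) ≠ 5 := by
    rcases (by omega : (i = 3 ∧ j = 6) ∨ (i = 3 ∧ j = 7) ∨ (i = 4 ∧ j = 7)) with ⟨rfl, rfl⟩ | ⟨rfl, rfl⟩ | ⟨rfl, rfl⟩
    · refine ⟨{0, 3, 6, 7, 9}, rfl, fun k hk hkS => ?_⟩
      simp only [mem_insert, mem_singleton, not_or] at hkS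
      rcases (by omega : k = 1 ∨ k = 2 ∨ k = 4 ∨ k = 5 ∨ k = 8) with rfl | rfl | rfl | rfl | rfl
      · exact x1 _ (by omega) (by omega)
      · exact x1 _ (by omega) (by omega)
      · exact x2 _ (by omega) (by omega)
      · exact x2 _ (by omega) (by omega)
      · exact x3 _ (by omega) (by omega)
    · refine ⟨{0, 3, 4, 6, 7}, rfl, fun k hk hkS => ?_⟩
      simp only [mem_insert, mem_singleton, not_or] at hkS
      rcases (by omega : k = 1 ∨ k = 2 ∨ k = 5 ∨ k = 8 ∨ k = 9) with rfl | rfl | rfl | rfl | rfl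
      · exact x1 _ (by omega) (by omega)
      · exact x1 _ (by omega) (by omega)
      · exact x2 _ (by omega) (by omega)
      · exact x3 _ (by omega) (by omega)
      · exact x3 _ (by omega) (by omega)
    · refine ⟨{0, 1, 3, 4, 7}, rfl, fun k hk hkS => ?_⟩
      simp only [mem_insert, mem_singleton, not_or] at hkS
      rcases (by omega : k = 2 ∨ k = 5 ∨ k = 6 ∨ k = 8 ∨ k = 9) with rfl | rfl | rfl | rfl | rfl
      · exact x1 _ (by omega) (by omega)
      · exact x2 _ (by omega) (by omega)
      · exact x2 _ (by omega) (by omega)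
      · exact x3 _ (by omega) (by omega)
      · exact x3 _ (by omega) (by omega)
  obtain ⟨S, hS, hk⟩ := key
  rw [← card_N5_idx xu, hx]
  refine le_trans (card_le_card ?_) hS.le
  intro k hk'
  rw [mem_filter, mem_range] at hk'
  by_contra hc
  exact hk k hk'.1 hc hk'.2

lemma MinCE.two9 (hM : T.MinCE) {x u : V} (xu : T.adj x u) (hx : T.d x = 9) {j k : ℕ} (h : T.IsA (T.r x u j) x)
    (hj : 1 ≤ j) (hk : k = j + 2 ∨ k + 2 = j) : T.d (T.r x u k) ≠ 5 := by
  intro hd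
  have hQ := hM.near xu h hd (by omega) (by omega)
  obtain ⟨i, rfl⟩ : ∃ i, j = i + 1 := ⟨j - 1, by omega⟩
  obtain ⟨p, q, s, L⟩ := exF5 h.dv (F_r xu (i+1)).rot.sw
  have h9 := hM.A_N9 h hx L hQ (r_adj xu k)
  have nd := L.nd
  simp only [List.nodup_cons, List.mem_cons, not_or] at nd
  have hs : s = T.r x u (i + 1 + 1) ∨ s = T.r x u i := by
    refine F.three (F_r xu (i+1)) (F_r xu i).sw ?_ L.f5.rot2.sw.sw
    intro e
    have := r_inj' xu e
    rw [hx] at this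
    omega
  have fin : ∀ m, T.r x u k = T.r x u m → k % 9 = m % 9 := by
    intro m e
    have := r_inj' xu e
    rwa [hx] at this
  rcases h9 with h | h | h
  · have := fin _ h; omega
  · have := fin _ h; omega
  · rcases hs with rfl | rfl
    · have := fin _ h; omega
    · have := fin _ h; omega

lemma sum_N5_idx {x u : V} (xu : T.adj x u) (φ : V → ℚ) : ∑ w ∈ T.N5 x, φ w =
    ∑ i ∈ range (T.d x), if T.d (T.r x u i) = 5 then φ (T.r x u i) else 0 := by
  have : T.N5 x = (T.N x).filter (fun w => T.d w = 5) := by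
    ext w; rw [mem_N5, mem_filter, mem_N]
  rw [this, sum_filter, N_eq xu, sum_image]
  intro i hi j hj e
  simp only [coe_range, Set.mem_Iio] at hi hj
  exact r_inj xu hi hj e

lemma MinCE.nine (hM : T.MinCE) {f : V → V → ℚ} (hf : ∀ u, T.d u = 5 → T.Dem u (f u)) {x : V} (hx : T.d x = 9)
    (ha : 2 ≤ (T.As x).card) : ∑ u ∈ T.N5 x, f u x ≤ 3 := by
  obtain ⟨u, hu, w, hw, hn⟩ := one_lt_card.1 ha
  rw [mem_As] at hu hw
  have xu := T.symm hu.vx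
  rw [sum_N5_idx xu, hx]
  obtain ⟨h, hh⟩ : ∃ h : ℕ → ℚ, ∀ i, h i = if T.d (T.r x u i) = 5 then f (T.r x u i) x else 0 := ⟨_, fun i => rfl⟩
  simp only [← hh]
  have per : ∀ i, h (i + 9) = h i := by
    intro i
    have := r_per xu i
    rw [hx] at this
    rw [hh, hh, this]
  have b1 : ∀ i, h i ≤ 1 := by
    intro i; rw [hh]; split_ifs with h5
    · exact (hf _ h5).p6 x (T.symm (r_adj xu i))
    · norm_num
  have b2 : ∀ i, h i ≤ 1/2 ∨ T.IsA (T.r x u i) x := by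
    intro i; rw [hh]; split_ifs with h5
    · exact (hf _ h5).p7 x (T.symm (r_adj xu i)) (by omega)
    · norm_num
  have b4 : ∀ j, T.IsA (T.r x u j) x → ∀ k, k = j + 1 ∨ k + 1 = j → h k ≤ 1/4 := by
    intro j hj k hk; rw [hh]; split_ifs with h5
    · refine (hf _ h5).p8 (T.r x u j) x ⟨hj, hx, ?_, T.symm (r_adj xu k)⟩
      rcases hk with rfl | rfl
      · exact T.symm (r_adj_succ xu j)
      · exact r_adj_succ xu k
    · norm_num
  have b0 : ∀ j, T.IsA (T.r x u j) x → 1 ≤ j → ∀ k, k = j + 2 ∨ k + 2 = j → h k ≤ 0 := by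
    intro j hj h1 k hk; rw [hh, if_neg (hM.two9 xu hx hj h1 hk)]
  obtain ⟨k, hk, rfl⟩ := r_lt xu (T.symm hw.vx)
  have e9 : T.r x u 9 = u := by have := r_d xu; rwa [hx] at this
  have A0 : T.IsA (T.r x u 0) x := by rw [r_zero]; exact hu
  have A9 : T.IsA (T.r x u 9) x := by rw [e9]; exact hu
  have g1 := hM.gap xu A0 hw (by rw [r_zero]; exact hn) (by omega)
  have g2 := hM.gap xu hw A9 (by rw [e9]; exact hn.symm) (by omega)
  have q0 := b1 0
  have q1 := b4 0 A0 1 (by omega)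
  have q8 := b4 9 A9 8 (by omega)
  have q7 := b0 9 A9 (by omega) 7 (by omega)
  have q2 := b0 9 A9 (by omega) 11 (by omega)
  rw [per 2] at q2
  have c1 := b1 k
  have c2 := b4 k hw (k+1) (by omega)
  have c3 := b4 k hw (k-1) (by omega)
  have c4 := b0 k hw (by omega) (k+2) (by omega)
  have c5 := b0 k hw (by omega) (k-2) (by omega)
  simp only [sum_range_succ, sum_range_zero]
  rcases (by omega : k = 3 ∨ k = 4 ∨ k = 5 ∨ k = 6) with rfl | rfl | rfl | rfl
  · norm_num at c1 c2 c3 c4 c5 ⊢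
    rcases b2 6 with h6 | h6
    · linarith
    · have := b0 6 h6 (by omega) 4 (by omega)
      have := b0 6 h6 (by omega) 8 (by omega)
      have := b1 6
      linarith
  · norm_num at c1 c2 c3 c4 c5 ⊢
    linarith
  · norm_num at c1 c2 c3 c4 c5 ⊢
    linarith
  · norm_num at c1 c2 c3 c4 c5 ⊢
    rcases b2 3 with h6 | h6
    · linarith
    · have := b0 3 h6 (by omega) 1 (by omega)
      have := b0 3 h6 (by omega) 5 (by omega)
      have := b1 3
      linarith

lemma MinCE.bud (hM : T.MinCE) {f : V → V → ℚ} (hf : ∀ u, T.d u = 5 → T.Dem u (f u)) (x : V) :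
    ∑ u ∈ T.N5 x, f u x ≤ (T.d x : ℚ) - 6 + if T.d x = 5 then 1 else 0 := by
  have h5 := hM.d5 x
  have small : T.d x ≤ 6 → ∑ u ∈ T.N5 x, f u x ≤ 0 := by
    intro h
    apply sum_nonpos
    intro u hu
    rw [mem_N5] at hu
    exact (hf u hu.2).p1 x (T.symm hu.1) h
  by_cases e5 : T.d x = 5
  · have := small (by omega)
    rw [if_pos e5, e5]; push_cast; linarith
  rw [if_neg e5, add_zero]
  by_cases e6 : T.d x = 6
  · have := small (by omega)
    rw [e6]; push_cast; linarith
  by_cases e7 : T.d x = 7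
  · have := hM.bud7 hf e7
    rw [e7]; push_cast; linarith
  by_cases e8 : T.d x = 8
  · have := hM.bud8 hf e8
    rw [e8]; push_cast; linarith
  have hg := hM.budgen hf (x := x) (by omega)
  have hz := hM.Zd (x := x)
  have h3 := hM.A3 x
  have fin : (T.N5 x).card + (T.As x).card + 12 ≤ 2 * T.d x → ∑ u ∈ T.N5 x, f u x ≤ (T.d x : ℚ) - 6 := by
    intro h
    have : ((T.N5 x).card : ℚ) + (T.As x).card + 12 ≤ 2 * T.d x := by exact_mod_cast h
    linarith
  by_cases e9 : T.d x = 9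
  · by_cases ha : 2 ≤ (T.As x).card
    · have := hM.nine hf e9 ha
      rw [e9]; push_cast; linarith
    · exact fin (by omega)
  by_cases e10 : T.d x = 10
  · by_cases ha : (T.As x).card = 3
    · have := hM.ten e10 ha
      exact fin (by omega)
    · exact fin (by omega)
  exact fin (by omega)

lemma no_min : ¬ T.MinCE := by
  intro hM
  have : ∀ u, ∃ f, T.d u = 5 → T.Dem u f := by
    intro u
    by_cases h : T.d u = 5
    · obtain ⟨f, hf⟩ := hM.dem h
      exact ⟨f, fun _ => hf⟩
    · exact ⟨fun _ => 0, fun h' => (h h').elim⟩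
  choose f hf using this
  have h1 : ∑ x, ∑ u ∈ T.N5 x, f u x = ∑ u, if T.d u = 5 then (1 : ℚ) else 0 := by
    have e1 : ∀ x, ∑ u ∈ T.N5 x, f u x = ∑ u, if T.adj u x ∧ T.d u = 5 then f u x else 0 := by
      intro x
      rw [← sum_filter]
      apply sum_congr _ (fun _ _ => rfl)
      ext u
      rw [mem_N5, mem_filter]
      exact ⟨fun h => ⟨mem_univ _, T.symm h.1, h.2⟩, fun h => ⟨T.symm h.2.1, h.2.2⟩⟩
    simp only [e1]
    rw [sum_comm]
    apply sum_congr rfl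
    intro u _
    split_ifs with h
    · simp only [h, and_true]
      rw [← sum_filter, ← (hf u h).sum]
      apply sum_congr _ (fun _ _ => rfl)
      ext x
      simp [mem_N]
    · simp [h]
  have h2 : ∑ x, ∑ u ∈ T.N5 x, f u x ≤ ∑ x, ((T.d x : ℚ) - 6 + if T.d x = 5 then 1 else 0) :=
    sum_le_sum fun x _ => hM.bud hf x
  rw [h1, sum_add_distrib, sum_sub_distrib] at h2
  have h3 : ∑ x, T.d x + 12 = 6 * Fintype.card V := T.euler
  have h4 : ∑ x, (T.d x : ℚ) + 12 = 6 * Fintype.card V := by exact_mod_cast h3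
  rw [sum_const, nsmul_eq_mul, card_univ] at h2
  linarith

end Tri
end FC

theorem statement0 [Fintype V] (G : SimpleGraph V) (hG : IsPlanar G) :
    ∃ c : V → Fin 5, Proper5 G c ∧ 6 * Nat.card {v : V | c v = 4} ≤ Fintype.card V := by
  classical
  obtain ⟨W, iW, T0, σ, hT, f, hf⟩ := hG
  obtain ⟨T, hadj⟩ := FC.exists_tri hT
  obtain ⟨c, hc, hcard⟩ := FC.Tri.all_good (fun V _ T => FC.Tri.no_min) _ W T (Finset.univ.image f) rfl
  refine ⟨fun v => c (f v), ?_, ?_⟩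
  · intro u w huw
    exact hc (f u) (by simp) (f w) (by simp) ((hadj _ _).2 (f.map_adj huw))
  · have e1 : (Finset.univ.image f).card = Fintype.card V := by
      rw [Finset.card_image_of_injective _ hf, Finset.card_univ]
    have e2 : Nat.card {v : V | c (f v) = 4} = ((Finset.univ.image f).filter (fun v => c v = 4)).card := by
      rw [Finset.filter_image, Finset.card_image_of_injective _ hf, Nat.card_eq_fintype_card]
      rw [Fintype.card_subtype]
      rfl
    rw [e1] at hcard
    rw [e2]
    convert hcard using 3
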